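/- arXiv:1210.7628 — 2 statements merged into one kernel-verified Lean document; each statement's English description precedes it below -/
import Mathlib

section
/- Let $\tau$ (with $p=r=1$, distributional potential) be regular at $a$ with fundamental system $\theta_z,\phi_z$ normalized by $\theta_z(a)=\phi_z^{[1]}(a)=\cos\varphi_a$, $-\theta_z^{[1]}(a)=\phi_z(a)=\sin\varphi_a$, and let $m$ be the corresponding Weyl--Titchmarsh function. Then as $|z|\to\infty$ along any nonreal ray: if $\varphi_a=0$, $m(z) = -\sqrt{-z} + o(z^{1/2})$; if $\varphi_a\neq 0$, $m(z) = -\cot\varphi_a + \frac{1}{\sin^2(\varphi_a)\sqrt{-z}} + o(z^{-1/2})$. -/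
open MeasureTheory Set Filter Complex Topology ComplexConjugate

noncomputable section

/-- `f` is locally absolutely continuous on `(a,b)` with a.e. derivative `g`,
encoded via the integral representation. -/
def HasACDeriv (a b : ℝ) (f g : ℝ → ℂ) : Prop :=
  ∀ x ∈ Set.Ioo a b, ∀ y ∈ Set.Ioo a b,
    IntervalIntegrable g volume y x ∧ f x = f y + ∫ t in y..x, g t

/-- `f` lies in the domain `𝔇_τ` with first quasi-derivative `fq = p (f' + s f)` and
`τ f = w`, encoded via the equivalent first order system
`(f, f^{[1]})' = ((-s, 1/p), (q - 0·r, s)) (f, f^{[1]}) - (0, r·w)`. -/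
structure SLSys (a b : ℝ) (p q r s : ℝ → ℝ) (f fq w : ℝ → ℂ) : Prop where
  fst : HasACDeriv a b f fun x => fq x / (p x : ℂ) - (s x : ℂ) * f x
  snd : HasACDeriv a b fq fun x => (s x : ℂ) * fq x + (q x : ℂ) * f x - (r x : ℂ) * w x

/-- Standing hypothesis on the coefficients `p, q, r, s` on `(a,b)`:
real-valued and measurable, `p⁻¹, q, r, s ∈ L¹_loc((a,b))`, `p ≠ 0` and `r > 0` a.e. -/
structure SLHyp (a b : ℝ) (p q r s : ℝ → ℝ) : Prop where
  lt : a < b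
  mp : Measurable p
  mq : Measurable q
  mr : Measurable r
  ms : Measurable s
  ip : ∀ x ∈ Set.Ioo a b, ∀ y ∈ Set.Ioo a b,
    IntervalIntegrable (fun t => (p t)⁻¹) volume y x
  iq : ∀ x ∈ Set.Ioo a b, ∀ y ∈ Set.Ioo a b, IntervalIntegrable q volume y x
  ir : ∀ x ∈ Set.Ioo a b, ∀ y ∈ Set.Ioo a b, IntervalIntegrable r volume y x
  is' : ∀ x ∈ Set.Ioo a b, ∀ y ∈ Set.Ioo a b, IntervalIntegrable s volume y x
  pne : ∀ᵐ t ∂(volume.restrict (Set.Ioo a b)), p t ≠ 0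
  rpos : ∀ᵐ t ∂(volume.restrict (Set.Ioo a b)), 0 < r t

/-- The modified Wronskian `W(f,g)(x) = f(x) g^{[1]}(x) - f^{[1]}(x) g(x)`. -/
def Wr (f fq g gq : ℝ → ℂ) (x : ℝ) : ℂ := f x * gq x - fq x * g x


/-- The branch `√(-z) = (-z)^{1/2}` of the square root with positive real part for
`z` off the negative real axis. -/
def msqrt (z : ℂ) : ℂ := (-z) ^ (1 / 2 : ℂ)

/-- `(u, uq)` solves the system equivalent to `(τ - z) u = 0` (with `p = r = 1`,
`τ u = -(u' + s u)' + s (u' + s u) + q u`, quasi-derivative `uq = u' + s u`) on `[a,b)`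
with the initial conditions `u(a) = d₁`, `u^{[1]}(a) = d₂` at the regular endpoint `a`. -/
structure RegSol (a b : ℝ) (q s : ℝ → ℝ) (z : ℂ) (u uq : ℝ → ℂ) (d₁ d₂ : ℂ) : Prop where
  fst : ∀ x ∈ Set.Ico a b,
    IntervalIntegrable (fun t => uq t - (s t : ℂ) * u t) volume a x ∧
    u x = d₁ + ∫ t in a..x, (uq t - (s t : ℂ) * u t)
  snd : ∀ x ∈ Set.Ico a b,
    IntervalIntegrable (fun t => (s t : ℂ) * uq t + ((q t : ℂ) - z) * u t) volume a x ∧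
    uq x = d₂ + ∫ t in a..x, ((s t : ℂ) * uq t + ((q t : ℂ) - z) * u t)


/-! ### Basic facts on absolutely continuous functions -/

lemma ac_of_dist_le {X Y : Type*} [PseudoMetricSpace X] [PseudoMetricSpace Y]
    {f : ℝ → X} {g : ℝ → Y} {a b : ℝ} (K : ℝ) (hg : AbsolutelyContinuousOnInterval g a b)
    (h : ∀ x ∈ uIcc a b, ∀ y ∈ uIcc a b, dist (f x) (f y) ≤ K * dist (g x) (g y)) :
    AbsolutelyContinuousOnInterval f a b := by
  have h0 := Tendsto.const_mul K hg
  rw [mul_zero] at h0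
  refine squeeze_zero' (Eventually.of_forall fun E => Finset.sum_nonneg fun _ _ => dist_nonneg)
    ?_ h0
  have : ∀ᶠ E in (AbsolutelyContinuousOnInterval.totalLengthFilter ⊓
      𝓟 (AbsolutelyContinuousOnInterval.disjWithin a b)),
      E ∈ AbsolutelyContinuousOnInterval.disjWithin a b :=
    mem_inf_of_right (mem_principal_self _)
  filter_upwards [this] with E hE
  rw [Finset.mul_sum]
  refine Finset.sum_le_sum fun i hi => ?_
  have h1 := hE.1 i hi
  exact h _ h1.1 _ h1.2

lemma ac_integral {f : ℝ → ℂ} {a c : ℝ} (_hac : a ≤ c) (h : IntervalIntegrable f volume a c) (d : ℂ) :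
    AbsolutelyContinuousOnInterval (fun x => d + ∫ t in a..x, f t) a c := by
  have h1 := h.norm.absolutelyContinuousOnInterval_intervalIntegral (c := a) (by simp)
  refine ac_of_dist_le 1 h1 ?_
  intro x hx y hy
  have hx' : IntervalIntegrable f volume a x := h.mono_set (uIcc_subset_uIcc_left hx)
  have hy' : IntervalIntegrable f volume a y := h.mono_set (uIcc_subset_uIcc_left hy)
  rw [one_mul, dist_comm, dist_comm (∫ t in a..x, ‖f t‖), dist_eq_norm, Real.dist_eq, add_sub_add_left_eq_sub,
    intervalIntegral.integral_interval_sub_left hy' hx',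
    intervalIntegral.integral_interval_sub_left hy'.norm hx'.norm]
  exact intervalIntegral.norm_integral_le_abs_integral_norm

lemma ac_ftc {E : Type*} [NormedAddCommGroup E] [NormedSpace ℝ E] [CompleteSpace E]
    {f f' : ℝ → E} {a c : ℝ} (_hac : a ≤ c)
    (hf : AbsolutelyContinuousOnInterval f a c)
    (hI : AbsolutelyContinuousOnInterval (fun x => ∫ t in a..x, f' t) a c)
    (hi : IntervalIntegrable f' volume a c)
    (hd : ∀ᵐ x, x ∈ uIcc a c → HasDerivAt f (f' x) x) :
    f c = f a + ∫ t in a..c, f' t := by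
  have h1 := hf.fun_sub hI
  obtain ⟨C, hC⟩ := h1.const_of_ae_hasDerivAt_zero (by
    filter_upwards [hd, hi.ae_hasDerivAt_integral] with x hx hx2 hx3
    simpa using (hx hx3).fun_sub (hx2 hx3 a left_mem_uIcc))
  have e1 := hC a left_mem_uIcc
  have e2 := hC c right_mem_uIcc
  simp only [intervalIntegral.integral_same, sub_zero] at e1
  rw [e1, ← e2]; abel

/-- Integral representation on `[a,b)`. -/
def ARep (a b : ℝ) (f f' : ℝ → ℂ) : Prop :=
  ∀ x ∈ Set.Ico a b, IntervalIntegrable f' volume a x ∧ f x = f a + ∫ t in a..x, f' t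

lemma ARep.cont {a b : ℝ} {f f' : ℝ → ℂ} (h : ARep a b f f') {c : ℝ} (hc : c ∈ Ico a b) :
    ContinuousOn f (Icc a c) := by
  have h1 := (ac_integral hc.1 (h c hc).1 (f a)).continuousOn
  rw [uIcc_of_le hc.1] at h1
  exact h1.congr fun x hx => (h x ⟨hx.1, hx.2.trans_lt hc.2⟩).2

lemma ARep.mul {a b : ℝ} {f f' g g' : ℝ → ℂ} (hf : ARep a b f f') (hg : ARep a b g g') :
    ARep a b (fun x => f x * g x) (fun x => f' x * g x + f x * g' x) := by
  intro c hc
  have i1 : IntervalIntegrable (fun x => f' x * g x + f x * g' x) volume a c := by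
    have cf := hf.cont hc
    have cg := hg.cont hc
    rw [← uIcc_of_le hc.1] at cf cg
    exact ((hf c hc).1.mul_continuousOn cg).add ((hg c hc).1.continuousOn_mul cf)
  refine ⟨i1, ?_⟩
  set F : ℝ → ℂ := fun x => f a + ∫ t in a..x, f' t with hF
  set G : ℝ → ℂ := fun x => g a + ∫ t in a..x, g' t with hG
  have eF : ∀ x ∈ uIcc a c, f x = F x := fun x hx => by
    rw [uIcc_of_le hc.1] at hx; exact (hf x ⟨hx.1, hx.2.trans_lt hc.2⟩).2
  have eG : ∀ x ∈ uIcc a c, g x = G x := fun x hx => by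
    rw [uIcc_of_le hc.1] at hx; exact (hg x ⟨hx.1, hx.2.trans_lt hc.2⟩).2
  have aF := ac_integral hc.1 (hf c hc).1 (f a)
  have aG := ac_integral hc.1 (hg c hc).1 (g a)
  have key := ac_ftc (f := fun x => F x * G x) (f' := fun x => f' x * g x + f x * g' x) hc.1
    (by simpa using aF.fun_smul aG) (by simpa using ac_integral hc.1 i1 0) i1
    (by
      filter_upwards [(hf c hc).1.ae_hasDerivAt_integral, (hg c hc).1.ae_hasDerivAt_integral]
        with x h1 h2 hx
      have d1 := (h1 hx a left_mem_uIcc).const_add (f a)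
      have d2 := (h2 hx a left_mem_uIcc).const_add (g a)
      rw [eF x hx, eG x hx]
      exact d1.mul d2)
  simp only [← eF a left_mem_uIcc, ← eG a left_mem_uIcc, ← eF c right_mem_uIcc,
    ← eG c right_mem_uIcc] at key
  exact key

lemma ARep.add {a b : ℝ} {f f' g g' : ℝ → ℂ} (hf : ARep a b f f') (hg : ARep a b g g') :
    ARep a b (fun x => f x + g x) (fun x => f' x + g' x) := by
  intro c hc
  refine ⟨(hf c hc).1.add (hg c hc).1, ?_⟩
  rw [intervalIntegral.integral_add (hf c hc).1 (hg c hc).1]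
  show f c + g c = _
  rw [(hf c hc).2, (hg c hc).2]; ring

lemma ARep.const_mul {a b : ℝ} {f f' : ℝ → ℂ} (k : ℂ) (hf : ARep a b f f') :
    ARep a b (fun x => k * f x) (fun x => k * f' x) := by
  intro c hc
  refine ⟨(hf c hc).1.const_mul k, ?_⟩
  rw [intervalIntegral.integral_const_mul]
  show k * f c = _
  rw [(hf c hc).2]; ring

lemma ARep.congr' {a b : ℝ} {f f' g g' : ℝ → ℂ} (hf : ARep a b f f') (h : ∀ x, f x = g x)
    (h' : ∀ x, f' x = g' x) : ARep a b g g' := by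
  have e1 : f = g := funext h
  have e2 : f' = g' := funext h'
  rw [← e1, ← e2]; exact hf

lemma ARep.sub {a b : ℝ} {f f' g g' : ℝ → ℂ} (hf : ARep a b f f') (hg : ARep a b g g') :
    ARep a b (fun x => f x - g x) (fun x => f' x - g' x) :=
  (hf.add (hg.const_mul (-1))).congr' (fun x => by ring) (fun x => by ring)

lemma ARep.conj {a b : ℝ} {f f' : ℝ → ℂ} (hf : ARep a b f f') :
    ARep a b (fun x => conj (f x)) (fun x => conj (f' x)) := by
  intro c hc
  have h := hf c hc
  constructor
  · have := h.1
    rw [intervalIntegrable_iff] at this ⊢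
    exact (Complex.conjCLE.toContinuousLinearMap.integrable_comp this)
  · show conj (f c) = _
    rw [h.2, map_add]
    congr 1
    simp only [intervalIntegral.integral_of_le hc.1]
    exact integral_conj.symm

lemma ARep.exp (a b : ℝ) (k : ℂ) :
    ARep a b (fun x => Complex.exp (k * (x - a))) (fun x => k * Complex.exp (k * (x - a))) := by
  intro c hc
  have hi : IntervalIntegrable (fun x : ℝ => k * Complex.exp (k * (x - a))) volume a c :=
    (by fun_prop : Continuous (fun x : ℝ => k * Complex.exp (k * (x - a)))).intervalIntegrable _ _
  refine ⟨hi, ?_⟩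
  rw [intervalIntegral.integral_eq_sub_of_hasDerivAt (f := fun x : ℝ => Complex.exp (k * (x - a))) _ hi]
  · ring
  · intro x _
    have h1 : HasDerivAt (fun x : ℝ => k * ((x : ℂ) - a)) (k * 1) x :=
      (HasDerivAt.sub_const _ (Complex.ofRealCLM.hasDerivAt (x := x))).const_mul k
    have := h1.cexp
    simpa [mul_comm] using this

lemma ARep.diff {a b : ℝ} {f f' : ℝ → ℂ} (hf : ARep a b f f') {c x : ℝ} (hc : c ∈ Ico a b)
    (hx : x ∈ Ico a b) :
    IntervalIntegrable f' volume c x ∧ f x = f c + ∫ t in c..x, f' t := by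
  have h1 := hf c hc
  have h2 := hf x hx
  refine ⟨h1.1.symm.trans h2.1, ?_⟩
  rw [← intervalIntegral.integral_interval_sub_left h2.1 h1.1, h2.2, h1.2]; ring

lemma gronwall_L1 {a c A : ℝ} (hac : a ≤ c) {h N : ℝ → ℝ} (hh : ∀ x, 0 ≤ h x)
    (hi : IntervalIntegrable h volume a c) (hN : ContinuousOn N (Icc a c))
    (hb : ∀ x ∈ Icc a c, N x ≤ A + ∫ t in a..x, h t * N t) :
    N c ≤ A * Real.exp (∫ t in a..c, h t) := by
  rw [← uIcc_of_le hac] at hN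
  have i1 : IntervalIntegrable (fun t => h t * N t) volume a c := hi.mul_continuousOn hN
  have aH := hi.absolutelyContinuousOnInterval_intervalIntegral (c := a) (by simp)
  have aG := i1.absolutelyContinuousOnInterval_intervalIntegral (c := a) (by simp)
  set H : ℝ → ℝ := fun x => ∫ t in a..x, h t with hH
  set G : ℝ → ℝ := fun x => A + ∫ t in a..x, h t * N t with hG
  have aG' : AbsolutelyContinuousOnInterval G a c := by
    refine ac_of_dist_le 1 aG ?_
    intro x _ y _
    simp [hG]
  have aE : AbsolutelyContinuousOnInterval (fun x => Real.exp (-H x)) a c := by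
    refine ac_of_dist_le 1 aH ?_
    have hpos : ∀ x ∈ uIcc a c, 0 ≤ H x := by
      intro x hx
      rw [uIcc_of_le hac] at hx
      exact intervalIntegral.integral_nonneg hx.1 (fun t _ => hh t)
    have key : ∀ u v : ℝ, 0 ≤ u → u ≤ v → |Real.exp (-u) - Real.exp (-v)| ≤ |u - v| := by
      intro u v hu huv
      rw [abs_of_nonneg (by simpa using huv), abs_of_nonpos (by linarith)]
      have h1 : Real.exp (-u) ≤ 1 := by simpa using hu
      have h2 := Real.add_one_le_exp (-(v - u))
      have h3 : Real.exp (-v) = Real.exp (-u) * Real.exp (-(v-u)) := by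
        rw [← Real.exp_add]; ring_nf
      rw [h3]
      have h4 := Real.exp_pos (-u)
      nlinarith
    intro x hx y hy
    rw [Real.dist_eq, Real.dist_eq, one_mul]
    rcases le_total (H x) (H y) with hxy | hxy
    · exact key _ _ (hpos x hx) hxy
    · rw [abs_sub_comm, abs_sub_comm (H x)]; exact key _ _ (hpos y hy) hxy
  have cE := aE.continuousOn
  have cG := aG'.continuousOn
  have i2 : IntervalIntegrable (fun t => h t * ((N t - G t) * Real.exp (-H t))) volume a c :=
    hi.mul_continuousOn ((hN.sub cG).mul cE)
  have key := ac_ftc (f := fun x => G x * Real.exp (-H x))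
    (f' := fun t => h t * ((N t - G t) * Real.exp (-H t))) hac (aG'.fun_mul aE)
    (i2.absolutelyContinuousOnInterval_intervalIntegral (c := a) (by simp)) i2
    (by
      filter_upwards [hi.ae_hasDerivAt_integral, i1.ae_hasDerivAt_integral] with x h1 h2 hx
      have d1 := ((h1 hx a left_mem_uIcc).neg).exp
      have d2 := (h2 hx a left_mem_uIcc).const_add A
      have d3 := d2.mul d1
      refine HasDerivAt.congr_deriv d3 ?_
      change h x * N x * Real.exp (-H x) + G x * (Real.exp (-H x) * -h x) = _
      ring)
  have neg : ∫ t in a..c, h t * ((N t - G t) * Real.exp (-H t)) ≤ 0 := by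
    rw [← neg_nonneg, ← intervalIntegral.integral_neg]
    apply intervalIntegral.integral_nonneg hac
    intro t ht
    rw [neg_nonneg]
    have h1 := hb t ht
    have h2 := Real.exp_pos (-H t)
    have h3 : N t - G t ≤ 0 := by simp only [hG]; linarith
    exact mul_nonpos_of_nonneg_of_nonpos (hh t) (mul_nonpos_of_nonpos_of_nonneg h3 h2.le)
  have hGa : G a * Real.exp (-H a) = A := by simp [hG, hH]
  simp only [hGa] at key
  have h1 : G c * Real.exp (-H c) ≤ A := by linarith
  have h2 : N c ≤ G c := hb c ⟨hac, le_rfl⟩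
  calc N c ≤ G c := h2
    _ = G c * Real.exp (-H c) * Real.exp (H c) := by
      rw [mul_assoc, ← Real.exp_add]; simp
    _ ≤ _ := by gcongr

/-! ### Solutions, Wronskians -/

section sol
variable {a b : ℝ} {q s : ℝ → ℝ}

lemma RegSol.val1 (hab : a < b) {z : ℂ} {u uq : ℝ → ℂ} {d₁ d₂ : ℂ}
    (h : RegSol a b q s z u uq d₁ d₂) : u a = d₁ := by
  simpa using (h.fst a ⟨le_rfl, hab⟩).2

lemma RegSol.val2 (hab : a < b) {z : ℂ} {u uq : ℝ → ℂ} {d₁ d₂ : ℂ}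
    (h : RegSol a b q s z u uq d₁ d₂) : uq a = d₂ := by
  simpa using (h.snd a ⟨le_rfl, hab⟩).2

lemma RegSol.rep1 (hab : a < b) {z : ℂ} {u uq : ℝ → ℂ} {d₁ d₂ : ℂ}
    (h : RegSol a b q s z u uq d₁ d₂) : ARep a b u (fun t => uq t - (s t : ℂ) * u t) := by
  intro x hx
  rw [h.val1 hab]; exact h.fst x hx

lemma RegSol.rep2 (hab : a < b) {z : ℂ} {u uq : ℝ → ℂ} {d₁ d₂ : ℂ}
    (h : RegSol a b q s z u uq d₁ d₂) :
    ARep a b uq (fun t => (s t : ℂ) * uq t + ((q t : ℂ) - z) * u t) := by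
  intro x hx
  rw [h.val2 hab]; exact h.snd x hx

lemma regSol_of_rep {z : ℂ} {u uq : ℝ → ℂ} {d₁ d₂ : ℂ}
    (h1 : ARep a b u (fun t => uq t - (s t : ℂ) * u t))
    (h2 : ARep a b uq (fun t => (s t : ℂ) * uq t + ((q t : ℂ) - z) * u t))
    (e1 : u a = d₁) (e2 : uq a = d₂) : RegSol a b q s z u uq d₁ d₂ := by
  subst e1 e2
  exact ⟨h1, h2⟩

lemma RegSol.conj (hab : a < b) {z : ℂ} {u uq : ℝ → ℂ} {d₁ d₂ : ℂ}
    (h : RegSol a b q s z u uq d₁ d₂) :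
    RegSol a b q s (conj z) (fun x => conj (u x)) (fun x => conj (uq x)) (conj d₁) (conj d₂) := by
  refine regSol_of_rep ((h.rep1 hab).conj.congr' (fun x => rfl) (fun x => by simp))
    ((h.rep2 hab).conj.congr' (fun x => rfl) (fun x => by simp)) ?_ ?_
  · rw [h.val1 hab]
  · rw [h.val2 hab]

lemma RegSol.comb (hab : a < b) {z : ℂ} {u uq v vq : ℝ → ℂ} {d₁ d₂ e₁ e₂ : ℂ}
    (h : RegSol a b q s z u uq d₁ d₂) (h' : RegSol a b q s z v vq e₁ e₂) (m : ℂ) :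
    RegSol a b q s z (fun x => u x + m * v x) (fun x => uq x + m * vq x)
      (d₁ + m * e₁) (d₂ + m * e₂) := by
  refine regSol_of_rep
    (((h.rep1 hab).add ((h'.rep1 hab).const_mul m)).congr' (fun x => rfl) (fun x => by ring))
    (((h.rep2 hab).add ((h'.rep2 hab).const_mul m)).congr' (fun x => rfl) (fun x => by ring)) ?_ ?_
  · rw [h.val1 hab, h'.val1 hab]
  · rw [h.val2 hab, h'.val2 hab]

lemma wr_rep (hab : a < b) {z ζ : ℂ} {u uq v vq : ℝ → ℂ} {d₁ d₂ e₁ e₂ : ℂ}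
    (h : RegSol a b q s z u uq d₁ d₂) (h' : RegSol a b q s ζ v vq e₁ e₂) :
    ARep a b (Wr u uq v vq) (fun x => (z - ζ) * (u x * v x)) :=
  (((h.rep1 hab).mul (h'.rep2 hab)).sub ((h.rep2 hab).mul (h'.rep1 hab))).congr'
    (fun x => rfl) (fun x => by ring)

lemma wr_const (hab : a < b) {z : ℂ} {u uq v vq : ℝ → ℂ} {d₁ d₂ e₁ e₂ : ℂ}
    (h : RegSol a b q s z u uq d₁ d₂) (h' : RegSol a b q s z v vq e₁ e₂) {x : ℝ}
    (hx : x ∈ Ico a b) : Wr u uq v vq x = d₁ * e₂ - d₂ * e₁ := by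
  have := (wr_rep hab h h' x hx).2
  simp only [sub_self, zero_mul, intervalIntegral.integral_zero, add_zero] at this
  rw [this, Wr, h.val1 hab, h.val2 hab, h'.val1 hab, h'.val2 hab]

lemma dich (hab : a < b)
    (hq : ∀ x ∈ Set.Ioo a b, IntervalIntegrable q volume a x)
    (hs : ∀ x ∈ Set.Ioo a b, IntervalIntegrable s volume a x)
    {z k : ℂ} (hk : k ^ 2 = -z) (hk1 : 1 ≤ ‖k‖) (hre : 0 < k.re)
    {u uq : ℝ → ℂ} {d₁ d₂ : ℂ} (h : RegSol a b q s z u uq d₁ d₂) {c : ℝ} (hc : c ∈ Ioo a b)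
    {ε η : ℝ} (hε : 0 < ε) (hε1 : ε ≤ 1) (hη : 0 < η) (hη1 : η ≤ 1)
    (hκ : ∫ t in a..c, (|s t| + |q t|) ≤ ε * η / 8)
    (hexp : Real.exp (-(2 * k.re * (c - a))) ≤ ε * η / 4)
    (hh : ε * ‖uq a - k * u a‖ < ‖uq a + k * u a‖) :
    ‖uq c - k * u c‖ ≤ η * ‖uq c + k * u c‖ ∧ uq c + k * u c ≠ 0 := by
  have hc' : c ∈ Ico a b := ⟨hc.1.le, hc.2⟩
  set κ := ∫ t in a..c, (|s t| + |q t|) with hκdef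
  have isq : IntervalIntegrable (fun t => |s t| + |q t|) volume a c :=
    (hs c hc).abs.add (hq c hc).abs
  have hκ0 : 0 ≤ κ := intervalIntegral.integral_nonneg hc.1.le (fun t _ => by positivity)
  have hz : z = -k ^ 2 := by rw [hk]; ring
  set Ep : ℝ → ℂ := fun x => uq x + k * u x with hEp
  set Em : ℝ → ℂ := fun x => uq x - k * u x with hEm
  have rA : ARep a b (fun x => Complex.exp (-k * (x - a)) * Ep x)
      (fun x => Complex.exp (-k * (x - a)) * (s x * Em x + q x * u x)) :=
    ((ARep.exp a b (-k)).mul ((h.rep2 hab).add ((h.rep1 hab).const_mul k))).congr'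
      (fun x => rfl) (fun x => by simp only [hEp, hEm, hz]; ring)
  have rB : ARep a b (fun x => Complex.exp (k * (x - a)) * Em x)
      (fun x => Complex.exp (k * (x - a)) * (s x * Ep x + q x * u x)) :=
    ((ARep.exp a b k).mul ((h.rep2 hab).sub ((h.rep1 hab).const_mul k))).congr'
      (fun x => rfl) (fun x => by simp only [hEp, hEm, hz]; ring)
  have nexp : ∀ x : ℝ, ‖Complex.exp (-k * (x - a))‖ = Real.exp (-(k.re * (x - a))) := by
    intro x; rw [Complex.norm_exp]; congr 1; simp
  have nexp2 : ∀ x : ℝ, ‖Complex.exp (k * (x - a))‖ = Real.exp (k.re * (x - a)) := by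
    intro x; rw [Complex.norm_exp]; congr 1; simp
  set P : ℝ → ℝ := fun x => Real.exp (-(k.re * (x - a))) * ‖Ep x‖ with hP
  set R : ℝ → ℝ := fun x => Real.exp (-(k.re * (x - a))) * ‖Em x‖ with hR
  have cu := (h.rep1 hab).cont hc'
  have cuq := (h.rep2 hab).cont hc'
  have cEp : ContinuousOn Ep (Icc a c) := cuq.add (cu.const_mul k)
  have cEm : ContinuousOn Em (Icc a c) := cuq.sub (cu.const_mul k)
  have ce : ContinuousOn (fun x : ℝ => Real.exp (-(k.re * (x - a)))) (Icc a c) := by fun_prop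
  have cM : ContinuousOn (fun x => max (P x) (R x)) (Icc a c) :=
    (ce.mul cEp.norm).sup (ce.mul cEm.norm)
  obtain ⟨x0, hx0, hmax⟩ := isCompact_Icc.exists_isMaxOn (nonempty_Icc.2 hc.1.le) cM
  set M := max (P x0) (R x0) with hM
  have hPM : ∀ x ∈ Icc a c, P x ≤ M := fun x hx => (le_max_left _ _).trans (hmax hx)
  have hRM : ∀ x ∈ Icc a c, R x ≤ M := fun x hx => (le_max_right _ _).trans (hmax hx)
  have hP0 : ∀ x, 0 ≤ P x := fun x => by positivity
  have hR0 : ∀ x, 0 ≤ R x := fun x => by positivity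
  have hM0 : 0 ≤ M := (hP0 x0).trans (le_max_left _ _)
  have hu : ∀ x, ‖u x‖ ≤ (‖Ep x‖ + ‖Em x‖) / 2 := by
    intro x
    have e : 2 * k * u x = Ep x - Em x := by simp only [hEp, hEm]; ring
    have h1 : ‖2 * k * u x‖ ≤ ‖Ep x‖ + ‖Em x‖ := e ▸ norm_sub_le _ _
    rw [norm_mul, norm_mul] at h1
    have h2 : ‖(2 : ℂ)‖ = 2 := by simp
    rw [h2] at h1
    nlinarith [norm_nonneg (u x)]
  have hue : ∀ x ∈ Icc a c, Real.exp (-(k.re * (x - a))) * ‖u x‖ ≤ M := by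
    intro x hx
    have h1 := hPM x hx
    have h2 := hRM x hx
    have h3 := mul_le_mul_of_nonneg_left (hu x) (Real.exp_pos (-(k.re * (x - a)))).le
    simp only [hP, hR] at h1 h2
    linarith
  have hbnd : ∀ x ∈ Icc a c, ∫ t in a..x, (|s t| + |q t|) ≤ κ := by
    intro x hx
    apply intervalIntegral.integral_mono_interval le_rfl hx.1 hx.2 _ isq
    exact Eventually.of_forall fun t => by positivity
  have isqx : ∀ x ∈ Icc a c, IntervalIntegrable (fun t => |s t| + |q t|) volume a x := by
    intro x hx
    refine isq.mono_set ?_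
    rw [uIcc_of_le hx.1, uIcc_of_le hc.1.le]
    exact Icc_subset_Icc_right hx.2
  -- estimate for A
  have hA : ∀ x ∈ Icc a c, |P x - P a| ≤ κ * M := by
    intro x hx
    have h1 := (rA x ⟨hx.1, hx.2.trans_lt hc.2⟩).2
    beta_reduce at h1
    have h2 : ‖∫ t in a..x, Complex.exp (-k * (t - a)) * (s t * Em t + q t * u t)‖
        ≤ ∫ t in a..x, (|s t| + |q t|) * M := by
      refine intervalIntegral.norm_integral_le_of_norm_le hx.1 ?_ ((isqx x hx).mul_const M)
      refine Eventually.of_forall fun t ht => ?_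
      have ht' : t ∈ Icc a c := ⟨ht.1.le, ht.2.trans hx.2⟩
      rw [norm_mul, nexp]
      have h3 : ‖(s t : ℂ) * Em t + q t * u t‖ ≤ |s t| * ‖Em t‖ + |q t| * ‖u t‖ := by
        refine (norm_add_le _ _).trans ?_
        simp [norm_mul]
      have h4 := mul_le_mul_of_nonneg_left h3 (Real.exp_pos (-(k.re * (t - a)))).le
      have h5 := mul_le_mul_of_nonneg_left (hRM t ht') (abs_nonneg (s t))
      have h6 := mul_le_mul_of_nonneg_left (hue t ht') (abs_nonneg (q t))
      simp only [hR] at h5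
      linarith
    rw [intervalIntegral.integral_mul_const] at h2
    have h3 : P x = ‖Complex.exp (-k * (x - a)) * Ep x‖ := by rw [norm_mul, nexp]
    have h4 : P a = ‖Complex.exp (-k * ((a:ℝ) - a)) * Ep a‖ := by rw [norm_mul, nexp]
    rw [h3, h4]
    refine (abs_norm_sub_norm_le _ _).trans ?_
    rw [h1, add_sub_cancel_left]
    exact h2.trans (mul_le_mul_of_nonneg_right (hbnd x hx) hM0)
  have hB : ∀ x ∈ Icc a c, R x ≤ Real.exp (-(2 * k.re * (x - a))) * ‖Em a‖ + κ * M := by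
    intro x hx
    have h1 := (rB x ⟨hx.1, hx.2.trans_lt hc.2⟩).2
    beta_reduce at h1
    have h2 : ‖∫ t in a..x, Complex.exp (k * (t - a)) * (s t * Ep t + q t * u t)‖
        ≤ ∫ t in a..x, (|s t| + |q t|) * (Real.exp (2 * k.re * (x - a)) * M) := by
      refine intervalIntegral.norm_integral_le_of_norm_le hx.1 ?_ ((isqx x hx).mul_const _)
      refine Eventually.of_forall fun t ht => ?_
      have ht' : t ∈ Icc a c := ⟨ht.1.le, ht.2.trans hx.2⟩
      rw [norm_mul, nexp2]
      have h3 : ‖(s t : ℂ) * Ep t + q t * u t‖ ≤ |s t| * ‖Ep t‖ + |q t| * ‖u t‖ := by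
        refine (norm_add_le _ _).trans ?_
        simp [norm_mul]
      have e1 : Real.exp (k.re * (t - a)) =
          Real.exp (2 * k.re * (t - a)) * Real.exp (-(k.re * (t - a))) := by
        rw [← Real.exp_add]; ring_nf
      have e2 : Real.exp (2 * k.re * (t - a)) ≤ Real.exp (2 * k.re * (x - a)) := by
        apply Real.exp_le_exp.2
        have := ht.2
        nlinarith
      have h4 := mul_le_mul_of_nonneg_left h3 (Real.exp_pos (-(k.re * (t - a)))).le
      have h5 := mul_le_mul_of_nonneg_left (hPM t ht') (abs_nonneg (s t))
      have h6 := mul_le_mul_of_nonneg_left (hue t ht') (abs_nonneg (q t))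
      simp only [hP] at h5
      have h7 : Real.exp (-(k.re * (t - a))) * ‖(s t : ℂ) * Ep t + q t * u t‖
        ≤ (|s t| + |q t|) * M := by linarith
      rw [e1, mul_assoc]
      calc _ ≤ Real.exp (2 * k.re * (x - a)) * ((|s t| + |q t|) * M) := by
            apply mul_le_mul e2 h7 (by positivity) (by positivity)
        _ = _ := by ring
    rw [intervalIntegral.integral_mul_const] at h2
    have h3 : R x = Real.exp (-(2 * k.re * (x - a))) * ‖Complex.exp (k * (x - a)) * Em x‖ := by
      rw [norm_mul, nexp2, ← mul_assoc, ← Real.exp_add]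
      simp only [hR]; ring_nf
    have h4 : ‖Complex.exp (k * (x - a)) * Em x‖ ≤ ‖Em a‖ +
        κ * (Real.exp (2 * k.re * (x - a)) * M) := by
      rw [h1]
      refine (norm_add_le _ _).trans ?_
      refine add_le_add (by simp) (h2.trans ?_)
      exact mul_le_mul_of_nonneg_right (hbnd x hx) (by positivity)
    rw [h3]
    refine (mul_le_mul_of_nonneg_left h4 (Real.exp_pos _).le).trans ?_
    have e3 : Real.exp (-(2 * k.re * (x - a))) * Real.exp (2 * k.re * (x - a)) = 1 := by
      rw [← Real.exp_add]; simp
    rw [mul_add]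
    have : Real.exp (-(2 * k.re * (x - a))) * (κ * (Real.exp (2 * k.re * (x - a)) * M))
      = (Real.exp (-(2 * k.re * (x - a))) * Real.exp (2 * k.re * (x - a))) * (κ * M) := by ring
    rw [this, e3, one_mul]
  have hPa : P a = ‖Ep a‖ := by simp [hP]
  have hRa : R a = ‖Em a‖ := by simp [hR]
  change ε * ‖Em a‖ < ‖Ep a‖ at hh
  have hεη : ε * η ≤ 1 := by nlinarith
  have hMle : M ≤ 2 * (‖Ep a‖ / ε) := by
    have h1 : ‖Em a‖ ≤ ‖Ep a‖ / ε := by rw [le_div_iff₀ hε]; linarith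
    have h2 : ‖Ep a‖ ≤ ‖Ep a‖ / ε := by
      rw [le_div_iff₀ hε]; nlinarith [norm_nonneg (Ep a)]
    have h3 : P x0 ≤ ‖Ep a‖ / ε + κ * M := by
      have := (abs_le.1 (hA x0 hx0)).2
      rw [hPa] at this; linarith
    have h4 : R x0 ≤ ‖Ep a‖ / ε + κ * M := by
      have h5 := hB x0 hx0
      have h6 : Real.exp (-(2 * k.re * (x0 - a))) ≤ 1 := by
        apply Real.exp_le_one_iff.2
        have := hx0.1
        nlinarith
      nlinarith [norm_nonneg (Em a)]
    have h5 : M ≤ ‖Ep a‖ / ε + κ * M := max_le h3 h4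
    nlinarith
  have hκM : κ * M ≤ η / 4 * ‖Ep a‖ := by
    calc κ * M ≤ (ε * η / 8) * (2 * (‖Ep a‖ / ε)) := by gcongr
      _ = _ := by field_simp; ring
  have hEa : 0 < ‖Ep a‖ := lt_of_le_of_lt (by positivity) hh
  have hcc : c ∈ Icc a c := ⟨hc.1.le, le_rfl⟩
  have f1 : 3 / 4 * ‖Ep a‖ ≤ P c := by
    have := (abs_le.1 (hA c hcc)).1
    rw [hPa] at this
    nlinarith
  have f2 : R c ≤ η / 2 * ‖Ep a‖ := by
    have h1 := hB c hcc
    have h2 : Real.exp (-(2 * k.re * (c - a))) * ‖Em a‖ ≤ (ε * η / 4) * ‖Em a‖ := by gcongr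
    nlinarith
  have f3 : R c ≤ η * P c := by nlinarith
  have hpos := Real.exp_pos (-(k.re * (c - a)))
  constructor
  · simp only [hR, hP] at f3
    have : Real.exp (-(k.re * (c - a))) * ‖Em c‖ ≤
      Real.exp (-(k.re * (c - a))) * (η * ‖Ep c‖) := by linarith
    exact le_of_mul_le_mul_left this hpos
  · intro h0
    have : Ep c = 0 := h0
    simp only [hP, this, norm_zero, mul_zero] at f1
    linarith

end sol

/-! ### Asymptotics under the self-adjointness condition -/

section asym
variable {a b : ℝ} {q s : ℝ → ℝ}

lemma im_sign (hab : a < b) {z : ℂ} {u uq : ℝ → ℂ} {d₁ d₂ : ℂ} (h : RegSol a b q s z u uq d₁ d₂)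
    (hW : Tendsto (Wr u uq (fun x => conj (u x)) (fun x => conj (uq x))) (𝓝[<] b) (𝓝 0))
    {c : ℝ} (hc : c ∈ Ico a b) : 0 ≤ z.im * (uq c * conj (u c)).im := by
  have hr := wr_rep hab h (h.conj hab)
  set W := Wr u uq (fun x => conj (u x)) (fun x => conj (uq x)) with hWd
  have h1 : ∀ᶠ x in 𝓝[<] b, z.im * (W c).im ≤ z.im * (W x).im := by
    have : Ioo c b ∈ 𝓝[<] b := Ioo_mem_nhdsLT hc.2
    filter_upwards [this] with x hx
    have e := (hr.diff hc ⟨hc.1.trans hx.1.le, hx.2⟩).2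
    have e2 : ∫ t in c..x, (z - conj z) * (u t * conj (u t))
        = ((2 * z.im * ∫ t in c..x, Complex.normSq (u t) : ℝ) : ℂ) * Complex.I := by
      rw [intervalIntegral.integral_const_mul]
      simp only [Complex.mul_conj]
      rw [intervalIntegral.integral_ofReal, Complex.sub_conj]
      push_cast; ring
    beta_reduce at e
    rw [e, e2, Complex.add_im, Complex.im_ofReal_mul, Complex.I_im, mul_one]
    have h3 : 0 ≤ ∫ t in c..x, Complex.normSq (u t) :=
      intervalIntegral.integral_nonneg hx.1.le (fun t _ => Complex.normSq_nonneg _)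
    nlinarith [mul_nonneg (sq_nonneg z.im) h3]
  have h2 : Tendsto (fun x => z.im * (W x).im) (𝓝[<] b) (𝓝 (z.im * (0 : ℂ).im)) :=
    ((Complex.continuous_im.tendsto _).comp hW).const_mul _
  have h3 := ge_of_tendsto h2 h1
  have h4 : (W c).im = -2 * (uq c * conj (u c)).im := by
    simp only [hWd, Wr, Complex.sub_im, Complex.mul_im, Complex.conj_re, Complex.conj_im]; ring
  rw [h4] at h3
  simp at h3
  simp
  linarith

lemma sign_contra {z k U V : ℂ} (hk : k ^ 2 = -z) (hre : 0 < k.re) {η : ℝ} (hη : 0 ≤ η)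
    (hη1 : η ≤ 1) (hη2 : η * (|k.im| + 2 * k.re) < |k.im|)
    (h1 : ‖V - k * U‖ ≤ η * ‖V + k * U‖) (h2 : V + k * U ≠ 0)
    (h3 : 0 ≤ z.im * (V * conj U).im) : False := by
  set P := V + k * U with hP
  set Q := V - k * U with hQ
  have hz : z.im = -2 * (k.re * k.im) := by
    have : z = -k ^ 2 := by rw [hk]; ring
    rw [this, sq]; simp; ring
  have hkk : 0 < Complex.normSq k := Complex.normSq_pos.2 (fun h => by simp [h] at hre)
  have e : 4 * (Complex.normSq k : ℂ) * (V * conj U) = k * ((P + Q) * conj (P - Q)) := by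
    rw [← Complex.mul_conj]
    have e1 : P + Q = 2 * V := by simp only [hP, hQ]; ring
    have e2 : P - Q = 2 * (k * U) := by simp only [hP, hQ]; ring
    have c2 : conj (2 : ℂ) = 2 := Complex.conj_ofNat 2
    rw [e1, e2, map_mul, map_mul, c2]; ring
  have e' : 4 * Complex.normSq k * (V * conj U).im =
      k.im * (Complex.normSq P - Complex.normSq Q) + 2 * k.re * (Q * conj P).im := by
    have := congrArg Complex.im e
    have l : (4 * (Complex.normSq k : ℂ) * (V * conj U)).im
      = 4 * Complex.normSq k * (V * conj U).im := by
      have : (4 * (Complex.normSq k : ℂ)) = ((4 * Complex.normSq k : ℝ) : ℂ) := by push_cast; ring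
      rw [this, Complex.im_ofReal_mul]
    rw [← l, this]
    simp [Complex.normSq_apply]
    ring
  have hQn : Complex.normSq Q ≤ η * Complex.normSq P := by
    rw [Complex.normSq_eq_norm_sq, Complex.normSq_eq_norm_sq]
    have := norm_nonneg P
    have := norm_nonneg Q
    nlinarith [mul_le_mul h1 h1 (norm_nonneg Q) (by positivity), sq_nonneg ‖P‖,
      mul_nonneg (mul_nonneg hη (sub_nonneg.2 hη1)) (sq_nonneg ‖P‖)]
  have hPQ : |(Q * conj P).im| ≤ η * Complex.normSq P := by
    refine (Complex.abs_im_le_norm _).trans ?_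
    rw [norm_mul, Complex.norm_conj, Complex.normSq_eq_norm_sq]
    nlinarith [norm_nonneg P]
  have hPp : 0 < Complex.normSq P := Complex.normSq_pos.2 h2
  have hkim : 0 < |k.im| := lt_of_le_of_lt (by positivity) hη2
  have a1 : 0 ≤ z.im * (4 * Complex.normSq k * (V * conj U).im) := by
    have := mul_nonneg h3 (mul_nonneg (by norm_num : (0:ℝ) ≤ 4) hkk.le)
    linarith
  rw [e', hz] at a1
  have a2 : k.im * (k.im * (Complex.normSq P - Complex.normSq Q) +
    2 * k.re * (Q * conj P).im) ≤ 0 := by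
    by_contra hcon
    push Not at hcon
    have := mul_pos hre hcon
    linarith
  have a3 : -(|k.im| * (η * Complex.normSq P)) ≤ k.im * (Q * conj P).im := by
    have : |k.im * (Q * conj P).im| ≤ |k.im| * (η * Complex.normSq P) := by
      rw [abs_mul]; gcongr
    exact (abs_le.1 this).1
  have a4 : k.im * k.im = |k.im| * |k.im| := (abs_mul_abs_self _).symm
  have a5 : |k.im| * |k.im| * ((1 - η) * Complex.normSq P) ≤
      k.im * k.im * (Complex.normSq P - Complex.normSq Q) := by
    rw [a4]; apply mul_le_mul_of_nonneg_left _ (by positivity); linarith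
  have a6 : 0 < |k.im| * Complex.normSq P * (|k.im| - η * (|k.im| + 2 * k.re)) :=
    mul_pos (mul_pos hkim hPp) (by linarith)
  have a7 := mul_le_mul_of_nonneg_left a3 (by positivity : 0 ≤ 2 * k.re)
  linarith

lemma msqrt_sq (z : ℂ) : msqrt z ^ 2 = -z := by
  unfold msqrt
  rw [← Complex.cpow_nat_mul]; simp

lemma msqrt_re {z : ℂ} (hz : z.im ≠ 0) : 0 < (msqrt z).re := by
  unfold msqrt
  rw [one_div, Complex.cpow_inv_two_re]
  apply Real.sqrt_pos.2
  have : -(-z).re < ‖-z‖ := by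
    have h1 := Complex.abs_re_lt_norm.2 (by simpa using hz : (-z).im ≠ 0)
    exact (neg_le_abs _).trans_lt h1
  linarith

lemma msqrt_ray {w : ℂ} (hw : w.im ≠ 0) {t : ℝ} (ht : 0 < t) :
    msqrt ((t : ℂ) * w) = (Real.sqrt t : ℂ) * msqrt w := by
  have h1 : msqrt ((t : ℂ) * w) ^ 2 = ((Real.sqrt t : ℂ) * msqrt w) ^ 2 := by
    rw [mul_pow, msqrt_sq, msqrt_sq, ← Complex.ofReal_pow, Real.sq_sqrt ht.le]; ring
  have h2 : 0 < (msqrt ((t : ℂ) * w)).re := msqrt_re (by simp [hw, ht.ne'])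
  have h3 : 0 < ((Real.sqrt t : ℂ) * msqrt w).re := by
    rw [Complex.re_ofReal_mul]; exact mul_pos (Real.sqrt_pos.2 ht) (msqrt_re hw)
  rcases sq_eq_sq_iff_eq_or_eq_neg.1 h1 with h | h
  · exact h
  · rw [h, Complex.neg_re] at h2; linarith

lemma exists_small (hab : a < b)
    (hq : ∀ x ∈ Set.Ioo a b, IntervalIntegrable q volume a x)
    (hs : ∀ x ∈ Set.Ioo a b, IntervalIntegrable s volume a x) {δ : ℝ} (hδ : 0 < δ) :
    ∃ c ∈ Ioo a b, ∫ t in a..c, (|s t| + |q t|) ≤ δ := by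
  obtain ⟨d, hd⟩ := exists_between hab
  have isq : IntervalIntegrable (fun t => |s t| + |q t|) volume a d :=
    (hs d hd).abs.add (hq d hd).abs
  have hc := (isq.absolutelyContinuousOnInterval_intervalIntegral (c := a) (by simp)).continuousOn
  rw [uIcc_of_le hd.1.le] at hc
  have h1 := (hc a ⟨le_rfl, hd.1.le⟩).mono_left
    (nhdsWithin_mono a (Ioc_subset_Icc_self : Ioc a d ⊆ Icc a d))
  beta_reduce at h1
  rw [intervalIntegral.integral_same, nhdsWithin_Ioc_eq_nhdsGT hd.1] at h1
  have h2 := h1.eventually (ge_mem_nhds hδ)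
  obtain ⟨c, hc1, hc2⟩ := (h2.and (Ioo_mem_nhdsGT hd.1)).exists
  exact ⟨c, ⟨hc2.1, hc2.2.trans hd.2⟩, hc1⟩

lemma ratio_small (hab : a < b)
    (hq : ∀ x ∈ Set.Ioo a b, IntervalIntegrable q volume a x)
    (hs : ∀ x ∈ Set.Ioo a b, IntervalIntegrable s volume a x)
    {ψ ψq : ℂ → ℝ → ℂ} {d₁ d₂ : ℂ → ℂ} (h : ∀ z, RegSol a b q s z (ψ z) (ψq z) (d₁ z) (d₂ z))
    (hW : ∀ z : ℂ, z.im ≠ 0 → Tendsto (Wr (ψ z) (ψq z) (fun x => conj (ψ z x))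
      (fun x => conj (ψq z x))) (𝓝[<] b) (𝓝 0))
    {w : ℂ} (hw : w.im ≠ 0) {ε : ℝ} (hε : 0 < ε) (hε1 : ε ≤ 1) :
    ∀ᶠ t : ℝ in atTop, ‖d₂ (t * w) + msqrt (t * w) * d₁ (t * w)‖ ≤
      ε * ‖d₂ (t * w) - msqrt (t * w) * d₁ (t * w)‖ := by
  set k0 := msqrt w with hk0
  have hre0 : 0 < k0.re := msqrt_re hw
  have him0 : 0 < |k0.im| := by
    apply abs_pos.2
    intro h0
    have h1 := congrArg Complex.im (msqrt_sq w)
    rw [← hk0, sq, Complex.mul_im, h0] at h1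
    simp at h1
    exact hw h1
  set η := |k0.im| / (2 * (|k0.im| + 2 * k0.re)) with hη
  have hη0 : 0 < η := by positivity
  have hη1 : η ≤ 1 := by
    rw [hη, div_le_one (by positivity)]; linarith
  have hη2 : η * (|k0.im| + 2 * k0.re) < |k0.im| := by
    have : η * (|k0.im| + 2 * k0.re) = |k0.im| / 2 := by
      rw [hη]; field_simp
    rw [this]; linarith
  obtain ⟨c, hc, hκ⟩ := exists_small hab hq hs (δ := ε * η / 8) (by positivity)
  have lim1 : Tendsto (fun t : ℝ => Real.exp (-(2 * (Real.sqrt t * k0.re) * (c - a)))) atTop (𝓝 0) := by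
    apply Real.tendsto_exp_neg_atTop_nhds_zero.comp
    have h1 : Tendsto (fun t : ℝ => (2 * k0.re * (c - a)) * Real.sqrt t) atTop atTop :=
      Real.tendsto_sqrt_atTop.const_mul_atTop (by have := hc.1; have : 0 < c - a := by linarith
                                                  positivity)
    refine h1.congr fun t => by ring
  have lim2 : Tendsto (fun t : ℝ => Real.sqrt t * ‖k0‖) atTop atTop :=
    Real.tendsto_sqrt_atTop.atTop_mul_const (norm_pos_iff.2 fun h => by simp [h] at hre0)
  filter_upwards [lim1.eventually (ge_mem_nhds (by positivity : 0 < ε * η / 4)),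
    lim2.eventually_ge_atTop 1, eventually_gt_atTop 0] with t h1 h2 h3
  have hk := msqrt_ray hw h3
  have hst := Real.sqrt_pos.2 h3
  have him : ((t : ℂ) * w).im ≠ 0 := by simp [hw, h3.ne']
  have kre : (msqrt (t * w)).re = Real.sqrt t * k0.re := by rw [hk, Complex.re_ofReal_mul]
  have kim : (msqrt (t * w)).im = Real.sqrt t * k0.im := by rw [hk, Complex.im_ofReal_mul]
  by_contra hcon
  push Not at hcon
  have hsol := h (t * w)
  rw [← hsol.val1 hab, ← hsol.val2 hab] at hcon
  obtain ⟨r1, r2⟩ := dich hab hq hs (msqrt_sq (t * w))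
    (by rw [hk, norm_mul, Complex.norm_real, Real.norm_of_nonneg hst.le]; exact h2)
    (msqrt_re him) hsol hc hε hε1 hη0 hη1 hκ (by rw [kre]; exact h1) hcon
  refine sign_contra (msqrt_sq (t * w)) (msqrt_re him) hη0.le hη1 ?_ r1 r2
    (im_sign hab hsol (hW _ him) ⟨hc.1.le, hc.2⟩)
  rw [kre, kim, abs_mul, abs_of_pos hst]
  nlinarith

lemma asym_of_sa (hab : a < b)
    (hq : ∀ x ∈ Set.Ioo a b, IntervalIntegrable q volume a x)
    (hs : ∀ x ∈ Set.Ioo a b, IntervalIntegrable s volume a x)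
    {φa : ℝ} (hφa : φa ∈ Set.Ico 0 Real.pi)
    {θ θq φ φq : ℂ → ℝ → ℂ}
    (hθ : ∀ z : ℂ, RegSol a b q s z (θ z) (θq z) (Real.cos φa) (-(Real.sin φa)))
    (hφ : ∀ z : ℂ, RegSol a b q s z (φ z) (φq z) (Real.sin φa) (Real.cos φa))
    {m : ℂ → ℂ}
    (hW : ∀ z : ℂ, z.im ≠ 0 → 
      Tendsto (Wr (fun x => θ z x + m z * φ z x) (fun x => θq z x + m z * φq z x)
          (fun x => conj (θ z x + m z * φ z x)) (fun x => conj (θq z x + m z * φq z x)))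
        (𝓝[<] b) (𝓝 0))
    {w : ℂ} (hw : w.im ≠ 0) :
    (φa = 0 →
      Tendsto (fun t : ℝ => (m ((t : ℂ) * w) + msqrt ((t : ℂ) * w)) / msqrt ((t : ℂ) * w))
        atTop (𝓝 0)) ∧
    (φa ≠ 0 →
      Tendsto (fun t : ℝ =>
          (m ((t : ℂ) * w) + ((Real.cos φa / Real.sin φa : ℝ) : ℂ)
            - 1 / ((((Real.sin φa) ^ 2 : ℝ) : ℂ) * msqrt ((t : ℂ) * w)))
          * msqrt ((t : ℂ) * w)) atTop (𝓝 0)) := by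
  have key := fun ε (hε : 0 < ε) (hε1 : ε ≤ 1) => ratio_small hab hq hs
    (ψ := fun z x => θ z x + m z * φ z x) (ψq := fun z x => θq z x + m z * φq z x)
    (fun z => (hθ z).comb hab (hφ z) (m z)) hW hw (ε := ε) hε hε1
  have hkpos : ∀ t : ℝ, 0 < t → 0 < ‖msqrt (t * w)‖ := fun t ht => by
    have : 0 < (msqrt (t * w)).re := msqrt_re (by simp [hw, ht.ne'])
    exact norm_pos_iff.2 fun h => by simp [h] at this
  constructor
  · rintro rfl
    rw [NormedAddGroup.tendsto_nhds_zero]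
    intro δ hδ
    set ε := min (1 / 2) (δ / 8) with hε
    have hε0 : 0 < ε := by positivity
    have hε1 : ε ≤ 1 / 2 := min_le_left _ _
    have hε2 : ε ≤ δ / 8 := min_le_right _ _
    filter_upwards [key ε hε0 (by linarith), eventually_gt_atTop 0] with t h1 ht
    have hk := hkpos t ht
    simp only [Real.cos_zero, Real.sin_zero, Complex.ofReal_one, Complex.ofReal_zero, mul_one,
      mul_zero, add_zero, neg_zero, zero_add] at h1
    rw [norm_div, div_lt_iff₀ hk]
    set k := msqrt (t * w)
    have h2 : ‖m (t * w) - k‖ ≤ ‖m (t * w) + k‖ + 2 * ‖k‖ := by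
      have : m (t * w) - k = (m (t * w) + k) - 2 * k := by ring
      rw [this]
      refine (norm_sub_le _ _).trans ?_
      simp
    nlinarith [norm_nonneg (m (t * w) + k)]
  · intro hne
    have hsin : 0 < Real.sin φa :=
      Real.sin_pos_of_pos_of_lt_pi (lt_of_le_of_ne hφa.1 (Ne.symm hne)) hφa.2
    set σ := Real.sin φa with hσ
    set χ := Real.cos φa with hχ
    have hσχ : (σ : ℂ) ^ 2 + (χ : ℂ) ^ 2 = 1 := by
      rw [hσ, hχ]; exact_mod_cast Real.sin_sq_add_cos_sq φa
    have hσ0 : (σ : ℂ) ≠ 0 := by exact_mod_cast hsin.ne'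
    rw [NormedAddGroup.tendsto_nhds_zero]
    intro δ hδ
    set ε := min (1 / 6) (δ * σ ^ 2 / 16) with hε
    have hε0 : 0 < ε := by positivity
    have hε1 : ε ≤ 1 / 6 := min_le_left _ _
    have hε2 : ε ≤ δ * σ ^ 2 / 16 := min_le_right _ _
    have lim2 : Tendsto (fun t : ℝ => Real.sqrt t * ‖msqrt w‖) atTop atTop :=
      Real.tendsto_sqrt_atTop.atTop_mul_const (norm_pos_iff.2 fun h => by
        have := msqrt_re hw
        simp [h] at this)
    filter_upwards [key ε hε0 (by linarith), eventually_gt_atTop 0,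
      lim2.eventually_ge_atTop (1 / (ε * σ))] with t h1 ht h2
    have hk := hkpos t ht
    have hkn : ‖msqrt (t * w)‖ = Real.sqrt t * ‖msqrt w‖ := by
      rw [msqrt_ray hw ht, norm_mul, Complex.norm_real, Real.norm_of_nonneg (Real.sqrt_nonneg t)]
    rw [← hkn] at h2
    set k := msqrt (t * w) with hkd
    set M := m (t * w) with hM
    have hk0 : k ≠ 0 := norm_pos_iff.1 hk
    set A : ℂ := χ + M * σ with hA
    set X : ℂ := k * σ * A with hX
    have hMA : M = (A - χ) / σ := by rw [hA]; field_simp; ring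
    have e1 : (-(σ : ℂ) + M * χ) + k * A = (X - 1 + χ * A) / σ := by
      rw [hMA, hX, eq_div_iff hσ0, ← hσχ]; field_simp; ring
    have e2 : (-(σ : ℂ) + M * χ) - k * A = -(X + 1 - χ * A) / σ := by
      rw [hMA, hX, eq_div_iff hσ0, ← hσχ]; field_simp; ring
    rw [e1, e2, norm_div, norm_div, norm_neg, ← mul_div_assoc] at h1
    have h1' := (div_le_div_iff_of_pos_right (norm_pos_iff.2 hσ0)).1 h1
    have hσn : ‖(σ : ℂ)‖ = σ := by rw [Complex.norm_real, Real.norm_of_nonneg hsin.le]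
    have h3 : ‖χ * A‖ ≤ ε * ‖X‖ := by
      rw [hX, norm_mul, norm_mul, norm_mul, hσn]
      have hc1 : ‖(χ : ℂ)‖ ≤ 1 := by
        rw [Complex.norm_real]; exact Real.abs_cos_le_one φa
      have h4 : 1 ≤ ‖k‖ * (ε * σ) := by
        rw [div_le_iff₀ (by positivity)] at h2; exact h2
      calc ‖(χ : ℂ)‖ * ‖A‖ ≤ 1 * ‖A‖ := by gcongr
        _ ≤ (‖k‖ * (ε * σ)) * ‖A‖ := by gcongr
        _ = _ := by ring
    have h4 : ‖X - 1‖ ≤ ‖X - 1 + χ * A‖ + ‖χ * A‖ := by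
      have : X - 1 = (X - 1 + χ * A) - χ * A := by ring
      conv_lhs => rw [this]
      exact norm_sub_le _ _
    have h5 : ‖X + 1 - χ * A‖ ≤ ‖X‖ + 1 + ‖χ * A‖ := by
      refine (norm_sub_le _ _).trans ?_
      gcongr
      exact (norm_add_le _ _).trans (by simp)
    have h6 : ‖X‖ ≤ ‖X - 1‖ + 1 := by
      have : X = (X - 1) + 1 := by ring
      conv_lhs => rw [this]
      exact (norm_add_le _ _).trans (by simp)
    have h7 : ‖X - 1‖ ≤ 8 * ε := by
      have hX0 := norm_nonneg X
      have : ε * ‖X + 1 - χ * A‖ ≤ ε * (2 * ‖X‖ + 1) := by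
        gcongr; nlinarith
      nlinarith [norm_nonneg (X - 1)]
    have e3 : (M + ((χ / σ : ℝ) : ℂ) - 1 / (((σ ^ 2 : ℝ) : ℂ) * k)) * k = (X - 1) / σ ^ 2 := by
      rw [hMA, hX]; push_cast; field_simp; ring
    rw [e3, norm_div, norm_pow, hσn, div_lt_iff₀ (by positivity)]
    have : 0 < δ * σ ^ 2 := by positivity
    linarith

end asym

/-! ### Zero-free entire functions of minimal exponential type are constant -/

lemma entire_const {F : ℂ → ℂ} (hF : Differentiable ℂ F) (h0 : ∀ z, F z ≠ 0)
    (hg : ∀ ε : ℝ, 0 < ε → ∃ C : ℝ, ∀ z, ‖F z‖ ≤ C * Real.exp (ε * ‖z‖)) (z : ℂ) : F z = F 0 := by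
  have hF' : Differentiable ℂ (deriv F) := by
    have := (hF.contDiff (n := 2)).differentiable_deriv_two
    exact this
  have hd : Differentiable ℂ (fun z => deriv F z / F z) := hF'.div hF h0
  obtain ⟨g, hg0, hgd⟩ := hd.isExactOn_univ.with_val_at 0 0
  have hgd' : ∀ z, HasDerivAt g (deriv F z / F z) z := fun z => hgd z (mem_univ z)
  have hgdiff : Differentiable ℂ g := fun z => (hgd' z).differentiableAt
  have hrep : ∀ z, F z = F 0 * Complex.exp (g z) := by
    have hc : ∀ z w, F z * Complex.exp (-g z) = F w * Complex.exp (-g w) := by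
      apply is_const_of_deriv_eq_zero (f := fun z => F z * Complex.exp (-g z))
        (hF.mul (hgdiff.neg.cexp))
      intro z
      have := ((hF z).hasDerivAt.mul ((hgd' z).neg.cexp)).deriv
      refine this.trans ?_
      field_simp [h0 z]
      ring
    intro z
    have := hc z 0
    rw [hg0, neg_zero, Complex.exp_zero, mul_one] at this
    rw [← this, mul_assoc, ← Complex.exp_add]; simp
  suffices hs : g z = 0 by rw [hrep z, hs]; simp
  have key : ∀ ε : ℝ, 0 < ε → ‖g z‖ ≤ 2 * ε * ‖z‖ := by
    intro ε hε
    obtain ⟨C, hC⟩ := hg ε hε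
    have hF0 : 0 < ‖F 0‖ := norm_pos_iff.2 (h0 0)
    have hCpos : 0 < C := by
      have := hC 0
      simp at this
      linarith
    set D := |Real.log (C / ‖F 0‖)| with hD
    have hre : ∀ w, (g w).re ≤ D + ε * ‖w‖ := by
      intro w
      have h1 := hC w
      rw [hrep w, norm_mul, Complex.norm_exp] at h1
      have h2 : Real.exp (g w).re ≤ C / ‖F 0‖ * Real.exp (ε * ‖w‖) := by
        rw [div_mul_eq_mul_div, le_div_iff₀ hF0]; linarith
      have h3 : Real.exp (g w).re ≤ Real.exp (D + ε * ‖w‖) := by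
        refine h2.trans ?_
        rw [Real.exp_add]
        gcongr
        rw [← Real.log_le_iff_le_exp (by positivity)]
        exact le_abs_self _
      exact Real.exp_le_exp.1 h3
    have hb : ∀ᶠ R : ℝ in atTop, ‖g z‖ ≤ 2 * (D + ε * R) * ‖z‖ / (R - ‖z‖) := by
      filter_upwards [eventually_gt_atTop ‖z‖] with R hR
      have hR0 : 0 < R := (norm_nonneg z).trans_lt hR
      refine Complex.borelCaratheodory_zero (M := D + ε * R) (by positivity)
        hgdiff.differentiableOn ?_ hR0 (by simpa using hR) hg0
      intro w hw
      have hw' : ‖w‖ < R := by simpa using hw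
      exact (hre w).trans (by gcongr)
    have hl : Tendsto (fun R : ℝ => 2 * (D + ε * R) * ‖z‖ / (R - ‖z‖)) atTop
        (𝓝 (2 * ε * ‖z‖)) := by
      have h1 : Tendsto (fun R : ℝ => 2 * ε * ‖z‖ + (2 * (D + ε * ‖z‖) * ‖z‖) / (R - ‖z‖)) atTop
          (𝓝 (2 * ε * ‖z‖ + 0)) := by
        refine tendsto_const_nhds.add (Tendsto.div_atTop tendsto_const_nhds ?_)
        exact tendsto_atTop_add_const_right _ _ tendsto_id
      rw [add_zero] at h1
      refine h1.congr' ?_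
      filter_upwards [eventually_gt_atTop ‖z‖] with R hR
      have : R - ‖z‖ ≠ 0 := by linarith
      field_simp
      ring
    exact ge_of_tendsto hl hb
  have hlim : Tendsto (fun ε : ℝ => 2 * ε * ‖z‖) (𝓝[>] 0) (𝓝 0) := by
    have : Tendsto (fun ε : ℝ => 2 * ε * ‖z‖) (𝓝 0) (𝓝 (2 * 0 * ‖z‖)) :=
      (by fun_prop : Continuous fun ε : ℝ => 2 * ε * ‖z‖).tendsto 0
    simp only [mul_zero, zero_mul] at this
    exact this.mono_left nhdsWithin_le_nhds
  have : ‖g z‖ ≤ 0 := ge_of_tendsto hlim (by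
    filter_upwards [self_mem_nhdsWithin] with ε hε using key ε hε)
  exact norm_le_zero_iff.1 this

/-! ### Variation of constants and square integrability -/

section lc
variable {a b : ℝ} {q s : ℝ → ℝ}

lemma ARep.contOn {f f' : ℝ → ℂ} (h : ARep a b f f') : ContinuousOn f (Ico a b) := by
  intro x hx
  obtain ⟨c, hc⟩ := exists_between hx.2
  have h1 := h.cont (c := c) ⟨hx.1.trans hc.1.le, hc.2⟩ x ⟨hx.1, hc.1.le⟩
  refine h1.mono_of_mem_nhdsWithin ?_
  have : Ico a b ∩ Iio c ∈ 𝓝[Ico a b] x := inter_mem_nhdsWithin _ (Iio_mem_nhds hc.1)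
  exact mem_of_superset this (fun y hy => ⟨hy.1.1, hy.2.le⟩)

lemma plucker (A Aq B Bq C Cq D Dq : ℝ → ℂ) (x : ℝ) :
    Wr A Aq B Bq x * Wr C Cq D Dq x =
      Wr A Aq C Cq x * Wr B Bq D Dq x - Wr A Aq D Dq x * Wr B Bq C Cq x := by
  simp only [Wr]; ring

lemma wr_a (hab : a < b) {z ζ : ℂ} {f fq g gq : ℝ → ℂ} {d₁ d₂ e₁ e₂ : ℂ}
    (hf : RegSol a b q s z f fq d₁ d₂) (hg : RegSol a b q s ζ g gq e₁ e₂) :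
    Wr f fq g gq a = d₁ * e₂ - d₂ * e₁ := by
  rw [Wr, hf.val1 hab, hf.val2 hab, hg.val1 hab, hg.val2 hab]

lemma basis_rep {u uq v vq f fq : ℝ → ℂ} {x : ℝ} (h1 : Wr u uq v vq x = 1) :
    f x = Wr f fq v vq x * u x - Wr f fq u uq x * v x := by
  simp only [Wr] at *
  linear_combination (-f x) * h1

lemma basis_rep2 {u uq v vq f fq : ℝ → ℂ} {x : ℝ} (h1 : Wr u uq v vq x = 1) :
    fq x = Wr f fq v vq x * uq x - Wr f fq u uq x * vq x := by
  simp only [Wr] at *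
  linear_combination (-fq x) * h1

lemma basis_norm {u uq v vq f fq : ℝ → ℂ} {x : ℝ} (h1 : Wr u uq v vq x = 1) :
    ‖f x‖ ≤ (‖Wr f fq v vq x‖ + ‖Wr f fq u uq x‖) * (‖u x‖ + ‖v x‖) := by
  have h2 : ‖f x‖ ≤ ‖Wr f fq v vq x‖ * ‖u x‖ + ‖Wr f fq u uq x‖ * ‖v x‖ := by
    rw [← norm_mul, ← norm_mul]
    have h3 := basis_rep (f := f) (fq := fq) h1
    calc ‖f x‖ = ‖Wr f fq v vq x * u x - Wr f fq u uq x * v x‖ := by rw [← h3]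
      _ ≤ _ := norm_sub_le _ _
  have := mul_nonneg (norm_nonneg (Wr f fq v vq x)) (norm_nonneg (v x))
  have := mul_nonneg (norm_nonneg (Wr f fq u uq x)) (norm_nonneg (u x))
  linarith

lemma var_bound (hab : a < b) {z₀ z : ℂ} {u uq v vq f fq : ℝ → ℂ} {u₁ u₂ v₁ v₂ d₁ d₂ : ℂ}
    (hu : RegSol a b q s z₀ u uq u₁ u₂) (hv : RegSol a b q s z₀ v vq v₁ v₂)
    (huv : u₁ * v₂ - u₂ * v₁ = 1) (hf : RegSol a b q s z f fq d₁ d₂)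
    {c x : ℝ} (hc : c ∈ Ico a b) (hcx : c ≤ x) (hx : x < b) :
    ‖Wr f fq v vq x‖ + ‖Wr f fq u uq x‖ ≤ (‖Wr f fq v vq c‖ + ‖Wr f fq u uq c‖) *
      Real.exp (‖z - z₀‖ * ∫ t in c..x, (‖u t‖ + ‖v t‖) ^ 2) := by
  have hx' : x ∈ Ico a b := ⟨hc.1.trans hcx, hx⟩
  have sub : Icc c x ⊆ Icc a x := Icc_subset_Icc_left hc.1
  have cu := ((hu.rep1 hab).cont hx').mono sub
  have cv := ((hv.rep1 hab).cont hx').mono sub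
  have cf := ((hf.rep1 hab).cont hx').mono sub
  have ra := wr_rep hab hf hv
  have rb := wr_rep hab hf hu
  have ca := (ra.cont hx').mono sub
  have cb := (rb.cont hx').mono sub
  rw [← intervalIntegral.integral_const_mul]
  have ch : ContinuousOn (fun t => ‖z - z₀‖ * (‖u t‖ + ‖v t‖) ^ 2) (Icc c x) :=
    ((cu.norm.add cv.norm).pow 2).const_mul _
  have cN : ContinuousOn (fun t => ‖Wr f fq v vq t‖ + ‖Wr f fq u uq t‖) (Icc c x) :=
    ca.norm.add cb.norm
  refine gronwall_L1 (N := fun t => ‖Wr f fq v vq t‖ + ‖Wr f fq u uq t‖) hcx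
    (fun t => by positivity) (ch.intervalIntegrable_of_Icc hcx) cN ?_
  intro y hy
  have hy' : y ∈ Ico a b := ⟨hc.1.trans hy.1, hy.2.trans_lt hx⟩
  have sub2 : Icc c y ⊆ Icc c x := Icc_subset_Icc_right hy.2
  have ea := (ra.diff hc hy').2
  have eb := (rb.diff hc hy').2
  beta_reduce at ea eb ⊢
  have na : ‖Wr f fq v vq y‖ ≤ ‖Wr f fq v vq c‖ + ∫ t in c..y, ‖z - z₀‖ * (‖f t‖ * ‖v t‖) := by
    rw [ea]
    refine (norm_add_le _ _).trans ?_
    gcongr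
    refine (intervalIntegral.norm_integral_le_integral_norm hy.1).trans (le_of_eq ?_)
    simp only [norm_mul]
  have nb : ‖Wr f fq u uq y‖ ≤ ‖Wr f fq u uq c‖ + ∫ t in c..y, ‖z - z₀‖ * (‖f t‖ * ‖u t‖) := by
    rw [eb]
    refine (norm_add_le _ _).trans ?_
    gcongr
    refine (intervalIntegral.norm_integral_le_integral_norm hy.1).trans (le_of_eq ?_)
    simp only [norm_mul]
  have i1 : IntervalIntegrable (fun t => ‖z - z₀‖ * (‖f t‖ * ‖v t‖)) volume c y :=
    ((cf.norm.mul cv.norm).const_mul _ |>.mono sub2).intervalIntegrable_of_Icc hy.1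
  have i2 : IntervalIntegrable (fun t => ‖z - z₀‖ * (‖f t‖ * ‖u t‖)) volume c y :=
    ((cf.norm.mul cu.norm).const_mul _ |>.mono sub2).intervalIntegrable_of_Icc hy.1
  have i3 := ((ch.mul cN).mono sub2).intervalIntegrable_of_Icc (μ := volume) hy.1
  have mono : (∫ t in c..y, ‖z - z₀‖ * (‖f t‖ * ‖v t‖)) + (∫ t in c..y, ‖z - z₀‖ * (‖f t‖ * ‖u t‖))
      ≤ ∫ t in c..y, ‖z - z₀‖ * (‖u t‖ + ‖v t‖) ^ 2 * (‖Wr f fq v vq t‖ + ‖Wr f fq u uq t‖) := by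
    rw [← intervalIntegral.integral_add i1 i2]
    refine intervalIntegral.integral_mono_on hy.1 (i1.add i2) i3 ?_
    intro t ht
    have ht' : t ∈ Ico a b := ⟨hc.1.trans ht.1, ht.2.trans_lt hy'.2⟩
    have hW1 : Wr u uq v vq t = 1 := (wr_const hab hu hv ht').trans huv
    have hn := basis_norm (f := f) (fq := fq) hW1
    calc ‖z - z₀‖ * (‖f t‖ * ‖v t‖) + ‖z - z₀‖ * (‖f t‖ * ‖u t‖)
        = ‖z - z₀‖ * (‖f t‖ * (‖u t‖ + ‖v t‖)) := by ring
      _ ≤ ‖z - z₀‖ * ((‖Wr f fq v vq t‖ + ‖Wr f fq u uq t‖) * (‖u t‖ + ‖v t‖) *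
          (‖u t‖ + ‖v t‖)) := by gcongr
      _ = _ := by ring
  linarith

lemma RegSol.meas (hab : a < b) {z : ℂ} {f fq : ℝ → ℂ} {d₁ d₂ : ℂ}
    (hf : RegSol a b q s z f fq d₁ d₂) :
    AEStronglyMeasurable f (volume.restrict (Ioo a b)) :=
  ((hf.rep1 hab).contOn.mono Ioo_subset_Ico_self).aestronglyMeasurable measurableSet_Ioo

/-- integral over `[c,x]` bounded by integral over `(a,b)` -/
lemma int_le {h : ℝ → ℝ} (hh : ∀ x, 0 ≤ h x) (hi : IntegrableOn h (Ioo a b))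
    {c x : ℝ} (hc : a ≤ c) (hcx : c ≤ x) (hx : x < b) :
    ∫ t in c..x, h t ≤ ∫ t in Ioo a b, h t := by
  rw [intervalIntegral.integral_of_le hcx]
  refine setIntegral_mono_set hi (Eventually.of_forall hh) ?_
  exact (Ioc_subset_Ioo_right hx |>.trans (Ioo_subset_Ioo_left hc)).eventuallyLE

/-- every solution is dominated by the basis -/
lemma lc_bound (hab : a < b) {z₀ z : ℂ} {u uq v vq f fq : ℝ → ℂ} {u₁ u₂ v₁ v₂ d₁ d₂ : ℂ}
    (hu : RegSol a b q s z₀ u uq u₁ u₂) (hv : RegSol a b q s z₀ v vq v₁ v₂)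
    (huv : u₁ * v₂ - u₂ * v₁ = 1) (hf : RegSol a b q s z f fq d₁ d₂)
    (hi : IntegrableOn (fun t => (‖u t‖ + ‖v t‖) ^ 2) (Ioo a b)) {x : ℝ} (hx : x ∈ Ico a b) :
    ‖Wr f fq v vq x‖ + ‖Wr f fq u uq x‖ ≤ (‖d₁ * v₂ - d₂ * v₁‖ + ‖d₁ * u₂ - d₂ * u₁‖) *
      Real.exp (‖z - z₀‖ * ∫ t in Ioo a b, (‖u t‖ + ‖v t‖) ^ 2) := by
  have h1 := var_bound hab hu hv huv hf ⟨le_rfl, hab⟩ hx.1 hx.2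
  rw [wr_a hab hf hu, wr_a hab hf hv] at h1
  refine h1.trans ?_
  gcongr
  exact int_le (fun t => by positivity) hi le_rfl hx.1 hx.2

lemma lc_bound' (hab : a < b) {z₀ z : ℂ} {u uq v vq f fq : ℝ → ℂ} {u₁ u₂ v₁ v₂ d₁ d₂ : ℂ}
    (hu : RegSol a b q s z₀ u uq u₁ u₂) (hv : RegSol a b q s z₀ v vq v₁ v₂)
    (huv : u₁ * v₂ - u₂ * v₁ = 1) (hf : RegSol a b q s z f fq d₁ d₂)
    (hi : IntegrableOn (fun t => (‖u t‖ + ‖v t‖) ^ 2) (Ioo a b)) {x : ℝ} (hx : x ∈ Ico a b) :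
    ‖f x‖ ≤ ((‖d₁ * v₂ - d₂ * v₁‖ + ‖d₁ * u₂ - d₂ * u₁‖) *
      Real.exp (‖z - z₀‖ * ∫ t in Ioo a b, (‖u t‖ + ‖v t‖) ^ 2)) * (‖u x‖ + ‖v x‖) := by
  have hW1 : Wr u uq v vq x = 1 := (wr_const hab hu hv hx).trans huv
  refine (basis_norm (f := f) (fq := fq) hW1).trans ?_
  gcongr
  exact lc_bound hab hu hv huv hf hi hx

lemma prod_int (hab : a < b) {z ζ : ℂ} {f fq g gq : ℝ → ℂ} {d₁ d₂ e₁ e₂ : ℂ}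
    (hf : RegSol a b q s z f fq d₁ d₂) (hg : RegSol a b q s ζ g gq e₁ e₂)
    (hfi : IntegrableOn (fun t => ‖f t‖ ^ 2) (Ioo a b))
    (hgi : IntegrableOn (fun t => ‖g t‖ ^ 2) (Ioo a b)) :
    IntegrableOn (fun t => f t * g t) (Ioo a b) := by
  refine Integrable.mono' (hfi.add hgi) ((hf.meas hab).mul (hg.meas hab)) ?_
  refine Eventually.of_forall fun t => ?_
  simp only [Pi.add_apply, norm_mul]
  nlinarith [sq_nonneg (‖f t‖ - ‖g t‖), sq_nonneg (‖f t‖), sq_nonneg ‖g t‖]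

lemma sq_int (hab : a < b) {z : ℂ} {f fq : ℝ → ℂ} {d₁ d₂ : ℂ}
    (hf : RegSol a b q s z f fq d₁ d₂) {h : ℝ → ℝ} {C : ℝ}
    (hi : IntegrableOn (fun t => h t ^ 2) (Ioo a b))
    (hb : ∀ x ∈ Ioo a b, ‖f x‖ ≤ C * h x) : IntegrableOn (fun t => ‖f t‖ ^ 2) (Ioo a b) := by
  refine Integrable.mono' (hi.const_mul (C ^ 2)) ((hf.meas hab).norm.pow 2) ?_
  refine (ae_restrict_iff' measurableSet_Ioo).2 (Eventually.of_forall fun t ht => ?_)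
  rw [norm_pow, norm_norm, ← mul_pow]
  gcongr
  exact hb t ht

lemma sum_int (hab : a < b) {z ζ : ℂ} {f fq g gq : ℝ → ℂ} {d₁ d₂ e₁ e₂ : ℂ}
    (hf : RegSol a b q s z f fq d₁ d₂) (hg : RegSol a b q s ζ g gq e₁ e₂)
    (hfi : IntegrableOn (fun t => ‖f t‖ ^ 2) (Ioo a b))
    (hgi : IntegrableOn (fun t => ‖g t‖ ^ 2) (Ioo a b)) :
    IntegrableOn (fun t => (‖f t‖ + ‖g t‖) ^ 2) (Ioo a b) := by
  refine Integrable.mono' ((hfi.add hgi).const_mul 2)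
    (((hf.meas hab).norm.add (hg.meas hab).norm).pow 2) ?_
  refine Eventually.of_forall fun t => ?_
  simp only [Pi.add_apply]
  rw [Real.norm_of_nonneg (by positivity)]
  nlinarith [sq_nonneg (‖f t‖ - ‖g t‖)]

lemma wr_lim (hab : a < b) {z ζ : ℂ} {f fq g gq : ℝ → ℂ} {d₁ d₂ e₁ e₂ : ℂ}
    (hf : RegSol a b q s z f fq d₁ d₂) (hg : RegSol a b q s ζ g gq e₁ e₂)
    (hfi : IntegrableOn (fun t => ‖f t‖ ^ 2) (Ioo a b))
    (hgi : IntegrableOn (fun t => ‖g t‖ ^ 2) (Ioo a b)) :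
    Tendsto (Wr f fq g gq) (𝓝[<] b)
      (𝓝 (d₁ * e₂ - d₂ * e₁ + (z - ζ) * ∫ t in Ioo a b, f t * g t)) := by
  have hi := prod_int hab hf hg hfi hgi
  have hI : IntervalIntegrable (fun t => f t * g t) volume a b := by
    rw [intervalIntegrable_iff_integrableOn_Ioo_of_le hab.le]; exact hi
  have hc := intervalIntegral.continuousOn_primitive_interval' hI left_mem_uIcc
  have h1 := hc b right_mem_uIcc
  rw [uIcc_of_le hab.le] at h1
  have h2 := h1.mono_left (nhdsWithin_mono b (Ico_subset_Icc_self : Ico a b ⊆ Icc a b))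
  rw [nhdsWithin_Ico_eq_nhdsLT hab] at h2
  have h3 := (h2.const_mul (z - ζ)).const_add (d₁ * e₂ - d₂ * e₁)
  beta_reduce at h3
  rw [intervalIntegral.integral_of_le hab.le, integral_Ioc_eq_integral_Ioo] at h3
  refine h3.congr' ?_
  filter_upwards [Ioo_mem_nhdsLT hab] with x hx
  have e := ((wr_rep hab hf hg) x ⟨hx.1.le, hx.2⟩).2
  rw [e, Wr, hf.val1 hab, hf.val2 hab, hg.val1 hab, hg.val2 hab,
    intervalIntegral.integral_const_mul]

end lc

/-! ### The characteristic function at the singular endpoint -/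

section charF
variable {a b : ℝ} {q s : ℝ → ℝ}

lemma growth_c (hab : a < b)
    (hq : ∀ x ∈ Set.Ioo a b, IntervalIntegrable q volume a x)
    (hs : ∀ x ∈ Set.Ioo a b, IntervalIntegrable s volume a x) (d₁ d₂ : ℂ)
    {c : ℝ} (hc : c ∈ Ioo a b) {ε : ℝ} (hε : 0 < ε) :
    ∃ C : ℝ, 0 ≤ C ∧ ∀ (z : ℂ) (f fq : ℝ → ℂ), RegSol a b q s z f fq d₁ d₂ →
      ‖f c‖ + ‖fq c‖ ≤ C * Real.exp (ε * ‖z‖) := by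
  have hc' : c ∈ Ico a b := ⟨hc.1.le, hc.2⟩
  have hac : 0 < c - a := sub_pos.2 hc.1
  set K := max 1 ((c - a) / ε) with hK
  have hK1 : 1 ≤ K := le_max_left _ _
  have hK2 : (c - a) / K ≤ ε := by
    rw [div_le_iff₀ (by linarith), ← div_le_iff₀' hε]; exact le_max_right _ _
  have hK0 : 0 < K := by linarith
  have isq : IntervalIntegrable (fun t => |s t| + |q t|) volume a c :=
    (hs c hc).abs.add (hq c hc).abs
  refine ⟨(K * ‖d₁‖ + ‖d₂‖) * Real.exp (K * (c - a) + ∫ t in a..c, (|s t| + |q t|)),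
    by positivity, ?_⟩
  intro z f fq hf
  have cf := (hf.rep1 hab).cont hc'
  have cfq := (hf.rep2 hab).cont hc'
  have cE : ContinuousOn (fun t => K * ‖f t‖ + ‖fq t‖) (Icc a c) :=
    (cf.norm.const_mul K).add cfq.norm
  have ik : IntervalIntegrable (fun t => (K + ‖z‖ / K) + (|s t| + |q t|)) volume a c :=
    intervalIntegrable_const.add isq
  have hG := gronwall_L1 (A := K * ‖d₁‖ + ‖d₂‖) (N := fun t => K * ‖f t‖ + ‖fq t‖) hc.1.le
    (fun t => by positivity) ik cE (by
      intro x hx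
      have hxb : x ∈ Ico a b := ⟨hx.1, hx.2.trans_lt hc.2⟩
      have h1 := hf.fst x hxb
      have h2 := hf.snd x hxb
      have ss : uIcc a x ⊆ uIcc a c := by
        rw [uIcc_of_le hx.1, uIcc_of_le hc.1.le]; exact Icc_subset_Icc_right hx.2
      have n1 : ‖f x‖ ≤ ‖d₁‖ + ∫ t in a..x, ‖fq t - (s t : ℂ) * f t‖ := by
        rw [h1.2]
        refine (norm_add_le _ _).trans ?_
        gcongr
        exact intervalIntegral.norm_integral_le_integral_norm hx.1
      have n2 : ‖fq x‖ ≤ ‖d₂‖ + ∫ t in a..x, ‖(s t : ℂ) * fq t + ((q t : ℂ) - z) * f t‖ := by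
        rw [h2.2]
        refine (norm_add_le _ _).trans ?_
        gcongr
        exact intervalIntegral.norm_integral_le_integral_norm hx.1
      have i1 := (h1.1.norm.const_mul K).add h2.1.norm
      have i2 : IntervalIntegrable (fun t => ((K + ‖z‖ / K) + (|s t| + |q t|)) *
          (K * ‖f t‖ + ‖fq t‖)) volume a x := by
        refine IntervalIntegrable.mono_set (ik.mul_continuousOn ?_) ss
        rw [uIcc_of_le hc.1.le]; exact cE
      have mono : K * (∫ t in a..x, ‖fq t - (s t : ℂ) * f t‖) +
          ∫ t in a..x, ‖(s t : ℂ) * fq t + ((q t : ℂ) - z) * f t‖ ≤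
          ∫ t in a..x, ((K + ‖z‖ / K) + (|s t| + |q t|)) * (K * ‖f t‖ + ‖fq t‖) := by
        rw [← intervalIntegral.integral_const_mul,
          ← intervalIntegral.integral_add (h1.1.norm.const_mul K) h2.1.norm]
        refine intervalIntegral.integral_mono_on hx.1 i1 i2 ?_
        intro t _
        have b1 : ‖fq t - (s t : ℂ) * f t‖ ≤ ‖fq t‖ + |s t| * ‖f t‖ := by
          refine (norm_sub_le _ _).trans ?_
          simp [norm_mul]
        have b2 : ‖(s t : ℂ) * fq t + ((q t : ℂ) - z) * f t‖ ≤
            |s t| * ‖fq t‖ + (|q t| + ‖z‖) * ‖f t‖ := by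
          refine (norm_add_le _ _).trans ?_
          rw [norm_mul, norm_mul]
          gcongr
          · simp
          · refine (norm_sub_le _ _).trans ?_
            simp
        have b3 := mul_le_mul_of_nonneg_left b1 hK0.le
        have e1 : ‖z‖ / K * (K * ‖f t‖) = ‖z‖ * ‖f t‖ := by field_simp
        have p1 : 0 ≤ ‖z‖ / K * ‖fq t‖ := by positivity
        have p2 : 0 ≤ K * (K * ‖f t‖) := by positivity
        have p3 : 0 ≤ |q t| * ‖fq t‖ := by positivity
        have p4 : |q t| * ‖f t‖ ≤ |q t| * (K * ‖f t‖) := by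
          gcongr; nlinarith [norm_nonneg (f t)]
        nlinarith
      beta_reduce
      nlinarith [mul_le_mul_of_nonneg_left n1 hK0.le])
  beta_reduce at hG
  have h1 : ‖f c‖ + ‖fq c‖ ≤ K * ‖f c‖ + ‖fq c‖ := by nlinarith [norm_nonneg (f c)]
  refine h1.trans (hG.trans ?_)
  rw [mul_assoc, ← Real.exp_add]
  gcongr
  rw [intervalIntegral.integral_add intervalIntegrable_const isq, intervalIntegral.integral_const,
    smul_eq_mul]
  have : (c - a) * (‖z‖ / K) = (c - a) / K * ‖z‖ := by ring
  have := mul_le_mul_of_nonneg_right hK2 (norm_nonneg z)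
  nlinarith

variable {θ θq φ φq : ℂ → ℝ → ℂ} {t₁ t₂ p₁ p₂ : ℂ}

lemma sq_left {f g : ℝ → ℂ} (hm : AEStronglyMeasurable f (volume.restrict (Ioo a b)))
    (hi : IntegrableOn (fun t => (‖f t‖ + ‖g t‖) ^ 2) (Ioo a b)) :
    IntegrableOn (fun t => ‖f t‖ ^ 2) (Ioo a b) := by
  refine Integrable.mono' hi (hm.norm.pow 2) (Eventually.of_forall fun t => ?_)
  rw [Real.norm_of_nonneg (by positivity)]
  gcongr
  linarith [norm_nonneg (g t)]

lemma all_sq (hab : a < b)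
    (hθ : ∀ z : ℂ, RegSol a b q s z (θ z) (θq z) t₁ t₂)
    (hφ : ∀ z : ℂ, RegSol a b q s z (φ z) (φq z) p₁ p₂) (h1 : t₁ * p₂ - t₂ * p₁ = 1)
    {z₀ : ℂ} (hi : IntegrableOn (fun t => (‖θ z₀ t‖ + ‖φ z₀ t‖) ^ 2) (Ioo a b))
    {z : ℂ} {f fq : ℝ → ℂ} {d₁ d₂ : ℂ} (hf : RegSol a b q s z f fq d₁ d₂) :
    IntegrableOn (fun t => ‖f t‖ ^ 2) (Ioo a b) :=
  sq_int hab hf hi (fun x hx => lc_bound' hab (hθ z₀) (hφ z₀) h1 hf hi ⟨hx.1.le, hx.2⟩)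

lemma charF_growth (hab : a < b)
    (hq : ∀ x ∈ Set.Ioo a b, IntervalIntegrable q volume a x)
    (hs : ∀ x ∈ Set.Ioo a b, IntervalIntegrable s volume a x)
    (hθ : ∀ z : ℂ, RegSol a b q s z (θ z) (θq z) t₁ t₂)
    (hφ : ∀ z : ℂ, RegSol a b q s z (φ z) (φq z) p₁ p₂) (h1 : t₁ * p₂ - t₂ * p₁ = 1)
    {z₀ : ℂ} (hi : IntegrableOn (fun t => (‖θ z₀ t‖ + ‖φ z₀ t‖) ^ 2) (Ioo a b))
    (m₀ : ℂ) {F : ℂ → ℂ}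
    (hF : ∀ z, Tendsto (Wr (φ z) (φq z) (fun x => θ z₀ x + m₀ * φ z₀ x)
      (fun x => θq z₀ x + m₀ * φq z₀ x)) (𝓝[<] b) (𝓝 (F z)))
    {ε : ℝ} (hε : 0 < ε) : ∃ C : ℝ, ∀ z, ‖F z‖ ≤ C * Real.exp (ε * ‖z‖) := by
  set h : ℝ → ℝ := fun t => (‖θ z₀ t‖ + ‖φ z₀ t‖) ^ 2 with hh
  have hh0 : ∀ t, 0 ≤ h t := fun t => by positivity
  have hI : IntervalIntegrable h volume a b := by
    rw [intervalIntegrable_iff_integrableOn_Ioo_of_le hab.le]; exact hi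
  -- choice of c
  obtain ⟨c, hc, hcε⟩ : ∃ c ∈ Ioo a b, ∀ x, c ≤ x → x < b → ∫ t in c..x, h t ≤ ε / 2 := by
    have hcont := intervalIntegral.continuousOn_primitive_interval' hI left_mem_uIcc
    have l1 := hcont b right_mem_uIcc
    rw [uIcc_of_le hab.le] at l1
    have l2 := l1.mono_left (nhdsWithin_mono b (Ico_subset_Icc_self : Ico a b ⊆ Icc a b))
    rw [nhdsWithin_Ico_eq_nhdsLT hab] at l2
    beta_reduce at l2
    have l3 := l2.eventually (lt_mem_nhds (by linarith : (∫ t in a..b, h t) - ε / 2 < _))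
    obtain ⟨c, hc1, hc2⟩ := (l3.and (Ioo_mem_nhdsLT hab)).exists
    refine ⟨c, hc2, fun x hx hxb => ?_⟩
    have s1 : uIcc a c ⊆ uIcc a b := by
      rw [uIcc_of_le hab.le, uIcc_of_le hc2.1.le]; exact Icc_subset_Icc_right hc2.2.le
    have s2 : uIcc c b ⊆ uIcc a b := by
      rw [uIcc_of_le hab.le, uIcc_of_le hc2.2.le]; exact Icc_subset_Icc_left hc2.1.le
    have e := intervalIntegral.integral_add_adjacent_intervals (hI.mono_set s1) (hI.mono_set s2)
    have e2 : ∫ t in c..x, h t ≤ ∫ t in c..b, h t :=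
      intervalIntegral.integral_mono_interval le_rfl hx hxb.le
        (Eventually.of_forall hh0) (hI.mono_set s2)
    linarith
  obtain ⟨C, hC0, hC⟩ := growth_c hab hq hs p₁ p₂ hc (half_pos hε)
  set M := ‖θ z₀ c‖ + ‖θq z₀ c‖ + ‖φ z₀ c‖ + ‖φq z₀ c‖ with hM
  refine ⟨(1 + ‖m₀‖) * (C * (2 * M) * Real.exp (ε / 2 * ‖z₀‖)), fun z => ?_⟩
  have hc' : c ∈ Ico a b := ⟨hc.1.le, hc.2⟩
  refine le_of_tendsto (hF z).norm ?_
  filter_upwards [Ioo_mem_nhdsLT hc.2] with x hx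
  have e : Wr (φ z) (φq z) (fun x => θ z₀ x + m₀ * φ z₀ x) (fun x => θq z₀ x + m₀ * φq z₀ x) x =
      Wr (φ z) (φq z) (θ z₀) (θq z₀) x + m₀ * Wr (φ z) (φq z) (φ z₀) (φq z₀) x := by
    simp only [Wr]; ring
  have vb := var_bound hab (hθ z₀) (hφ z₀) h1 (hφ z) hc' hx.1.le hx.2
  set α := ‖Wr (φ z) (φq z) (φ z₀) (φq z₀) x‖
  set β := ‖Wr (φ z) (φq z) (θ z₀) (θq z₀) x‖
  have hα : 0 ≤ α := norm_nonneg _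
  have hβ : 0 ≤ β := norm_nonneg _
  have s1 : ‖Wr (φ z) (φq z) (fun x => θ z₀ x + m₀ * φ z₀ x)
      (fun x => θq z₀ x + m₀ * φq z₀ x) x‖ ≤ (1 + ‖m₀‖) * (α + β) := by
    rw [e]
    refine (norm_add_le _ _).trans ?_
    rw [norm_mul]
    nlinarith [norm_nonneg m₀]
  have s2 : ‖Wr (φ z) (φq z) (φ z₀) (φq z₀) c‖ + ‖Wr (φ z) (φq z) (θ z₀) (θq z₀) c‖ ≤
      C * Real.exp (ε / 2 * ‖z‖) * (2 * M) := by
    have g := hC z _ _ (hφ z)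
    have w1 : ‖Wr (φ z) (φq z) (φ z₀) (φq z₀) c‖ ≤ (‖φ z c‖ + ‖φq z c‖) * M := by
      refine (norm_sub_le _ _).trans ?_
      rw [norm_mul, norm_mul, add_mul]
      gcongr <;> simp only [hM] <;> linarith [norm_nonneg (θ z₀ c), norm_nonneg (θq z₀ c),
        norm_nonneg (φ z₀ c), norm_nonneg (φq z₀ c)]
    have w2 : ‖Wr (φ z) (φq z) (θ z₀) (θq z₀) c‖ ≤ (‖φ z c‖ + ‖φq z c‖) * M := by
      refine (norm_sub_le _ _).trans ?_
      rw [norm_mul, norm_mul, add_mul]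
      gcongr <;> simp only [hM] <;> linarith [norm_nonneg (θ z₀ c), norm_nonneg (θq z₀ c),
        norm_nonneg (φ z₀ c), norm_nonneg (φq z₀ c)]
    have hM0 : 0 ≤ M := by positivity
    nlinarith [mul_le_mul_of_nonneg_right g hM0]
  have s3 : Real.exp (‖z - z₀‖ * ∫ t in c..x, h t) ≤
      Real.exp (ε / 2 * ‖z₀‖) * Real.exp (ε / 2 * ‖z‖) := by
    rw [← Real.exp_add]
    apply Real.exp_le_exp.2
    have := hcε x hx.1.le hx.2
    have h2 := norm_sub_le z z₀
    nlinarith [mul_le_mul_of_nonneg_left this (norm_nonneg (z - z₀))]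
  have hM0 : 0 ≤ M := by positivity
  calc _ ≤ (1 + ‖m₀‖) * (α + β) := s1
    _ ≤ (1 + ‖m₀‖) * ((C * Real.exp (ε / 2 * ‖z‖) * (2 * M)) *
        (Real.exp (ε / 2 * ‖z₀‖) * Real.exp (ε / 2 * ‖z‖))) := by
      gcongr
      refine vb.trans ?_
      gcongr
    _ = (1 + ‖m₀‖) * (C * (2 * M) * Real.exp (ε / 2 * ‖z₀‖)) *
        (Real.exp (ε / 2 * ‖z‖) * Real.exp (ε / 2 * ‖z‖)) := by ring
    _ = _ := by rw [← Real.exp_add]; ring_nf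

end charF

section charF2
variable {a b : ℝ} {q s : ℝ → ℝ} {θ θq φ φq : ℂ → ℝ → ℂ} {t₁ t₂ p₁ p₂ : ℂ}

lemma phi_diff (hab : a < b)
    (hθ : ∀ z : ℂ, RegSol a b q s z (θ z) (θq z) t₁ t₂)
    (hφ : ∀ z : ℂ, RegSol a b q s z (φ z) (φq z) p₁ p₂) (h1 : t₁ * p₂ - t₂ * p₁ = 1)
    {ζ : ℂ} (hi : IntegrableOn (fun t => (‖θ ζ t‖ + ‖φ ζ t‖) ^ 2) (Ioo a b))
    (z : ℂ) {x : ℝ} (hx : x ∈ Ico a b) :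
    ‖φ z x - φ ζ x‖ ≤ ‖z - ζ‖ * (Real.exp (‖z - ζ‖ * ∫ t in Ioo a b, (‖θ ζ t‖ + ‖φ ζ t‖) ^ 2) *
      ∫ t in Ioo a b, (‖θ ζ t‖ + ‖φ ζ t‖) ^ 2) * (‖θ ζ x‖ + ‖φ ζ x‖) := by
  set J := ∫ t in Ioo a b, (‖θ ζ t‖ + ‖φ ζ t‖) ^ 2 with hJ
  set E := Real.exp (‖z - ζ‖ * J) with hE
  have h0 : p₁ * p₂ - p₂ * p₁ = 0 := by ring
  have h1' : p₁ * t₂ - p₂ * t₁ = -1 := by linear_combination -h1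
  have hb : ∀ t ∈ Ico a b, ‖φ z t‖ ≤ E * (‖θ ζ t‖ + ‖φ ζ t‖) := by
    intro t ht
    have := lc_bound' hab (hθ ζ) (hφ ζ) h1 (hφ z) hi ht
    rw [h0, h1', norm_neg, norm_zero, norm_one, zero_add, one_mul] at this
    exact this
  have key : ∀ g : ℝ → ℂ, ContinuousOn g (Icc a x) → (∀ t, ‖g t‖ ≤ ‖θ ζ t‖ + ‖φ ζ t‖) →
      ‖∫ t in a..x, (z - ζ) * (φ z t * g t)‖ ≤ ‖z - ζ‖ * (E * J) := by
    intro g hg hgb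
    have cθ := ((hθ ζ).rep1 hab).cont hx
    have cφ := ((hφ ζ).rep1 hab).cont hx
    have ci : IntervalIntegrable (fun t => (‖θ ζ t‖ + ‖φ ζ t‖) ^ 2) volume a x :=
      ((cθ.norm.add cφ.norm).pow 2).intervalIntegrable_of_Icc hx.1
    rw [intervalIntegral.integral_const_mul, norm_mul]
    gcongr
    have s1 : ‖∫ t in a..x, φ z t * g t‖ ≤ ∫ t in a..x, E * (‖θ ζ t‖ + ‖φ ζ t‖) ^ 2 := by
      refine intervalIntegral.norm_integral_le_of_norm_le hx.1 ?_ (ci.const_mul E)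
      refine Eventually.of_forall fun t ht => ?_
      rw [norm_mul, sq, ← mul_assoc]
      gcongr
      · exact hb t ⟨ht.1.le, ht.2.trans_lt hx.2⟩
      · exact hgb t
    refine s1.trans ?_
    rw [intervalIntegral.integral_const_mul]
    gcongr
    exact int_le (fun t => by positivity) hi le_rfl hx.1 hx.2
  have ea := (wr_rep hab (hφ z) (hφ ζ) x hx).2
  have eb := (wr_rep hab (hφ z) (hθ ζ) x hx).2
  beta_reduce at ea eb
  rw [wr_a hab (hφ z) (hφ ζ), h0, zero_add] at ea
  rw [wr_a hab (hφ z) (hθ ζ), h1'] at eb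
  have ka := key (φ ζ) (((hφ ζ).rep1 hab).cont hx) (fun t => by linarith [norm_nonneg (θ ζ t)])
  have kb := key (θ ζ) (((hθ ζ).rep1 hab).cont hx) (fun t => by linarith [norm_nonneg (φ ζ t)])
  have hW1 : Wr (θ ζ) (θq ζ) (φ ζ) (φq ζ) x = 1 := (wr_const hab (hθ ζ) (hφ ζ) hx).trans h1
  have hr := basis_rep (f := φ z) (fq := φq z) hW1
  rw [ea, eb] at hr
  set A := ∫ t in a..x, (z - ζ) * (φ z t * φ ζ t)
  set B := ∫ t in a..x, (z - ζ) * (φ z t * θ ζ t)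
  have e : φ z x - φ ζ x = A * θ ζ x - B * φ ζ x := by rw [hr]; ring
  rw [e]
  refine (norm_sub_le _ _).trans ?_
  rw [norm_mul, norm_mul, mul_add]
  gcongr

lemma int_tendsto (hab : a < b)
    (hθ : ∀ z : ℂ, RegSol a b q s z (θ z) (θq z) t₁ t₂)
    (hφ : ∀ z : ℂ, RegSol a b q s z (φ z) (φq z) p₁ p₂) (h1 : t₁ * p₂ - t₂ * p₁ = 1)
    {ζ ξ : ℂ} (hi : IntegrableOn (fun t => (‖θ ζ t‖ + ‖φ ζ t‖) ^ 2) (Ioo a b))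
    {g gq : ℝ → ℂ} {e₁ e₂ : ℂ} (hg : RegSol a b q s ξ g gq e₁ e₂)
    (hgb : ∀ t, ‖g t‖ ≤ ‖θ ζ t‖ + ‖φ ζ t‖) :
    Tendsto (fun z => ∫ t in Ioo a b, φ z t * g t) (𝓝 ζ) (𝓝 (∫ t in Ioo a b, φ ζ t * g t)) := by
  set J := ∫ t in Ioo a b, (‖θ ζ t‖ + ‖φ ζ t‖) ^ 2 with hJ
  have hl : Tendsto (fun z : ℂ => ‖z - ζ‖ * (Real.exp (‖z - ζ‖ * J) * J) * J) (𝓝 ζ) (𝓝 0) := by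
    have : Continuous (fun z : ℂ => ‖z - ζ‖ * (Real.exp (‖z - ζ‖ * J) * J) * J) := by fun_prop
    have := this.tendsto ζ
    simpa using this
  rw [tendsto_iff_norm_sub_tendsto_zero]
  refine squeeze_zero (fun z => norm_nonneg _) (fun z => ?_) hl
  have hgi := all_sq hab hθ hφ h1 hi hg
  have i1 := prod_int hab (hφ z) hg (all_sq hab hθ hφ h1 hi (hφ z)) hgi
  have i2 := prod_int hab (hφ ζ) hg (all_sq hab hθ hφ h1 hi (hφ ζ)) hgi
  rw [← integral_sub i1 i2]
  have : ∫ t in Ioo a b, ‖z - ζ‖ * (Real.exp (‖z - ζ‖ * J) * J) * (‖θ ζ t‖ + ‖φ ζ t‖) ^ 2 =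
      ‖z - ζ‖ * (Real.exp (‖z - ζ‖ * J) * J) * J := by
    rw [integral_const_mul]
  rw [← this]
  refine norm_integral_le_of_norm_le (hi.const_mul _) ?_
  refine (ae_restrict_iff' measurableSet_Ioo).2 (Eventually.of_forall fun t ht => ?_)
  have := phi_diff hab hθ hφ h1 hi z ⟨ht.1.le, ht.2⟩
  rw [← sub_mul, norm_mul, sq, ← mul_assoc]
  have hJ0 : 0 ≤ J := integral_nonneg fun t => by positivity
  gcongr
  exact hgb t

lemma charF_diff (hab : a < b)
    (hθ : ∀ z : ℂ, RegSol a b q s z (θ z) (θq z) t₁ t₂)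
    (hφ : ∀ z : ℂ, RegSol a b q s z (φ z) (φq z) p₁ p₂) (h1 : t₁ * p₂ - t₂ * p₁ = 1)
    {z₀ : ℂ} (hi : IntegrableOn (fun t => (‖θ z₀ t‖ + ‖φ z₀ t‖) ^ 2) (Ioo a b))
    {ψ ψq : ℝ → ℂ} {e₁ e₂ : ℂ} (hψ : RegSol a b q s z₀ ψ ψq e₁ e₂) {F : ℂ → ℂ}
    (hF : ∀ z, Tendsto (Wr (φ z) (φq z) ψ ψq) (𝓝[<] b) (𝓝 (F z))) : Differentiable ℂ F := by
  intro ζ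
  have sq {z : ℂ} {f fq : ℝ → ℂ} {d₁ d₂ : ℂ} (hf : RegSol a b q s z f fq d₁ d₂) :=
    all_sq hab hθ hφ h1 hi hf
  have hiζ := sum_int hab (hθ ζ) (hφ ζ) (sq (hθ ζ)) (sq (hφ ζ))
  set P := e₁ * t₂ - e₂ * t₁ + (z₀ - ζ) * ∫ t in Ioo a b, ψ t * θ ζ t with hP
  have lP := wr_lim hab hψ (hθ ζ) (sq hψ) (sq (hθ ζ))
  rw [← hP] at lP
  have hrep : ∀ z, F z = F ζ + (z - ζ) * (-F ζ * (∫ t in Ioo a b, φ z t * θ ζ t) -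
      P * ∫ t in Ioo a b, φ z t * φ ζ t) := by
    intro z
    have l1 := wr_lim hab (hφ z) (hθ ζ) (sq (hφ z)) (sq (hθ ζ))
    have l2 := wr_lim hab (hφ z) (hφ ζ) (sq (hφ z)) (sq (hφ ζ))
    have l3 : Tendsto (Wr ψ ψq (φ ζ) (φq ζ)) (𝓝[<] b) (𝓝 (-F ζ)) := by
      refine (hF ζ).neg.congr fun x => ?_
      simp only [Wr]; ring
    have l4 := (l1.mul l3).sub (l2.mul lP)
    have l5 : Tendsto (Wr (φ z) (φq z) ψ ψq) (𝓝[<] b) _ := l4.congr' (by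
      filter_upwards [Ioo_mem_nhdsLT hab] with x hx
      have hW1 : Wr (θ ζ) (θq ζ) (φ ζ) (φq ζ) x = 1 :=
        (wr_const hab (hθ ζ) (hφ ζ) ⟨hx.1.le, hx.2⟩).trans h1
      have := plucker (φ z) (φq z) ψ ψq (θ ζ) (θq ζ) (φ ζ) (φq ζ) x
      rw [hW1, mul_one] at this
      rw [this])
    rw [tendsto_nhds_unique (hF z) l5]
    linear_combination (F ζ) * h1
  have hl : Tendsto (fun z => -F ζ * (∫ t in Ioo a b, φ z t * θ ζ t) -
      P * ∫ t in Ioo a b, φ z t * φ ζ t) (𝓝 ζ) (𝓝 (-F ζ * (∫ t in Ioo a b, φ ζ t * θ ζ t) -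
      P * ∫ t in Ioo a b, φ ζ t * φ ζ t)) :=
    ((int_tendsto hab hθ hφ h1 hiζ (hθ ζ) (fun t => by linarith [norm_nonneg (φ ζ t)])).const_mul
      _).sub ((int_tendsto hab hθ hφ h1 hiζ (hφ ζ)
        (fun t => by linarith [norm_nonneg (θ ζ t)])).const_mul _)
  have hd := hasDerivAt_iff_tendsto_slope.2 ((hl.mono_left
    (nhdsWithin_le_nhds (s := {ζ}ᶜ))).congr' (f₂ := slope F ζ) (by
      filter_upwards [self_mem_nhdsWithin] with z hz
      have hz' : z - ζ ≠ 0 := sub_ne_zero.2 hz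
      rw [slope_def_field, hrep z]
      field_simp
      ring))
  exact hd.differentiableAt

end charF2

/-! ### Reality of the boundary condition at the singular endpoint -/

section selfadj
variable {a b : ℝ} {q s : ℝ → ℝ}

lemma sol_unique (hab : a < b) {z : ℂ} {u uq v vq f fq g gq : ℝ → ℂ} {u₁ u₂ v₁ v₂ d₁ d₂ : ℂ}
    (hu : RegSol a b q s z u uq u₁ u₂) (hv : RegSol a b q s z v vq v₁ v₂)
    (huv : u₁ * v₂ - u₂ * v₁ = 1) (hf : RegSol a b q s z f fq d₁ d₂)
    (hg : RegSol a b q s z g gq d₁ d₂) {x : ℝ} (hx : x ∈ Ico a b) :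
    f x = g x ∧ fq x = gq x := by
  have hW1 : Wr u uq v vq x = 1 := (wr_const hab hu hv hx).trans huv
  constructor
  · rw [basis_rep (f := f) (fq := fq) hW1, basis_rep (f := g) (fq := gq) hW1,
      wr_const hab hf hv hx, wr_const hab hf hu hx, wr_const hab hg hv hx, wr_const hab hg hu hx]
  · rw [basis_rep2 (f := f) (fq := fq) hW1, basis_rep2 (f := g) (fq := gq) hW1,
      wr_const hab hf hv hx, wr_const hab hf hu hx, wr_const hab hg hv hx, wr_const hab hg hu hx]

lemma sq_full (hab : a < b) {z : ℂ} {f fq : ℝ → ℂ} {d₁ d₂ : ℂ}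
    (hf : RegSol a b q s z f fq d₁ d₂)
    (h : ∀ c ∈ Ioo a b, IntegrableOn (fun x => ‖f x‖ ^ 2) (Ioo c b)) :
    IntegrableOn (fun x => ‖f x‖ ^ 2) (Ioo a b) := by
  obtain ⟨c, hc⟩ := exists_between hab
  have h1 : IntegrableOn (fun x => ‖f x‖ ^ 2) (Icc a c) :=
    (((hf.rep1 hab).cont ⟨hc.1.le, hc.2⟩).norm.pow 2).integrableOn_Icc
  refine (h1.union (h c hc)).mono_set ?_
  intro x hx
  rcases le_or_gt x c with hxc | hxc
  · exact Or.inl ⟨hx.1.le, hxc⟩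
  · exact Or.inr ⟨hxc, hx.2⟩

lemma int_ne_zero (hab : a < b) {z : ℂ} {u uq f fq : ℝ → ℂ} {u₁ u₂ d₁ d₂ : ℂ}
    (hu : RegSol a b q s z u uq u₁ u₂) (hf : RegSol a b q s z f fq d₁ d₂)
    (hW : u₁ * d₂ - u₂ * d₁ = 1)
    (hfi : IntegrableOn (fun x => ‖f x‖ ^ 2) (Ioo a b)) : ∫ x in Ioo a b, ‖f x‖ ^ 2 ≠ 0 := by
  intro h0
  have h1 := (integral_eq_zero_iff_of_nonneg (fun x => by positivity) hfi).1 h0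
  have h2 : f =ᵐ[volume.restrict (Ioo a b)] fun _ => 0 := by
    filter_upwards [h1] with x hx
    simpa using hx
  have h3 : EqOn f (fun _ => 0) (Ioo a b) :=
    Measure.eqOn_open_of_ae_eq h2 isOpen_Ioo
      ((hf.rep1 hab).contOn.mono Ioo_subset_Ico_self) continuousOn_const
  obtain ⟨c, hc⟩ := exists_between hab
  have hc' : c ∈ Ico a b := ⟨hc.1.le, hc.2⟩
  have cq : ContinuousOn fq (Ioo a b) := (hf.rep2 hab).contOn.mono Ioo_subset_Ico_self
  have hd := intervalIntegral.integral_hasDerivAt_right (f := fq) (a := c) (b := c)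
    (IntervalIntegrable.refl) (cq.stronglyMeasurableAtFilter isOpen_Ioo c hc)
    (cq.continuousAt (Ioo_mem_nhds hc.1 hc.2))
  have he : (fun x => ∫ t in c..x, fq t) =ᶠ[𝓝 c] fun _ => 0 := by
    filter_upwards [Ioo_mem_nhds hc.1 hc.2] with x hx
    have e := ((hf.rep1 hab).diff hc' ⟨hx.1.le, hx.2⟩).2
    rw [h3 hx, h3 hc, zero_add] at e
    refine Eq.trans ?_ e.symm
    refine intervalIntegral.integral_congr fun t ht => ?_
    have ht' : t ∈ Ioo a b := (ordConnected_Ioo.uIcc_subset hc hx) ht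
    beta_reduce
    rw [h3 ht', mul_zero, sub_zero]
  have e1 := (hd.congr_of_eventuallyEq he.symm).unique (hasDerivAt_const c (0 : ℂ))
  have e2 := wr_const hab hu hf hc'
  rw [hW, Wr, h3 hc, e1] at e2
  simp at e2

theorem self_adj (hab : a < b)
    (hq : ∀ x ∈ Set.Ioo a b, IntervalIntegrable q volume a x)
    (hs : ∀ x ∈ Set.Ioo a b, IntervalIntegrable s volume a x)
    {φa : ℝ} {θ θq φ φq : ℂ → ℝ → ℂ}
    (hθ : ∀ z : ℂ, RegSol a b q s z (θ z) (θq z) (Real.cos φa) (-(Real.sin φa)))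
    (hφ : ∀ z : ℂ, RegSol a b q s z (φ z) (φq z) (Real.sin φa) (Real.cos φa))
    {m : ℂ → ℂ}
    (hL2 : ∀ z : ℂ, z.im ≠ 0 → ∀ c ∈ Set.Ioo a b,
      IntegrableOn (fun x => ‖θ z x + m z * φ z x‖ ^ 2) (Set.Ioo c b))
    (hbcb : ∀ z ζ : ℂ, z.im ≠ 0 → ζ.im ≠ 0 →
      Tendsto (Wr (fun x => θ z x + m z * φ z x) (fun x => θq z x + m z * φq z x)
          (fun x => θ ζ x + m ζ * φ ζ x) (fun x => θq ζ x + m ζ * φq ζ x))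
        (𝓝[<] b) (𝓝 0))
    {z₀ : ℂ} (hz₀ : z₀.im ≠ 0) :
    Tendsto (Wr (fun x => θ z₀ x + m z₀ * φ z₀ x) (fun x => θq z₀ x + m z₀ * φq z₀ x)
          (fun x => conj (θ z₀ x + m z₀ * φ z₀ x)) (fun x => conj (θq z₀ x + m z₀ * φq z₀ x)))
        (𝓝[<] b) (𝓝 0) := by
  have h1 : (Real.cos φa : ℂ) * (Real.cos φa : ℂ) - -(Real.sin φa : ℂ) * (Real.sin φa : ℂ) = 1 := by
    have := Real.cos_sq_add_sin_sq φa
    have h : ((Real.cos φa ^ 2 + Real.sin φa ^ 2 : ℝ) : ℂ) = 1 := by rw [this]; simp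
    push_cast at h ⊢
    linear_combination h
  set C : ℂ := (Real.cos φa : ℂ) with hC
  set S : ℂ := (Real.sin φa : ℂ) with hS
  have cC : conj C = C := Complex.conj_ofReal _
  have cS : conj S = S := Complex.conj_ofReal _
  have hcφ : ∀ z, ∀ x ∈ Ico a b, conj (φ z x) = φ (conj z) x ∧ conj (φq z x) = φq (conj z) x := by
    intro z x hx
    have h := (hφ z).conj hab
    rw [cC, cS] at h
    exact sol_unique hab (hθ (conj z)) (hφ (conj z)) h1 h (hφ (conj z)) hx
  have hcθ : ∀ z, ∀ x ∈ Ico a b, conj (θ z x) = θ (conj z) x ∧ conj (θq z x) = θq (conj z) x := by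
    intro z x hx
    have h := (hθ z).conj hab
    rw [map_neg, cC, cS] at h
    exact sol_unique hab (hθ (conj z)) (hφ (conj z)) h1 h (hθ (conj z)) hx
  have hψ := fun z => (hθ z).comb hab (hφ z) (m z)
  have hψi : ∀ z : ℂ, z.im ≠ 0 → IntegrableOn (fun x => ‖θ z x + m z * φ z x‖ ^ 2) (Ioo a b) :=
    fun z hz => sq_full hab (hψ z) (hL2 z hz)
  have hc0 : (conj z₀).im ≠ 0 := by simpa using hz₀
  have hψc := (hψ z₀).conj hab
  have hψci : IntegrableOn (fun x => ‖conj (θ z₀ x + m z₀ * φ z₀ x)‖ ^ 2) (Ioo a b) := by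
    simpa only [Complex.norm_conj] using hψi z₀ hz₀
  have hL := wr_lim hab (hψ z₀) hψc (hψi z₀ hz₀) hψci
  generalize hLd : (C + m z₀ * S) * conj (-S + m z₀ * C) - (-S + m z₀ * C) * conj (C + m z₀ * S) +
    (z₀ - conj z₀) * (∫ t in Ioo a b, (θ z₀ t + m z₀ * φ z₀ t) *
      conj (θ z₀ t + m z₀ * φ z₀ t)) = L at hL
  suffices hL0 : L = 0 by rwa [hL0] at hL
  by_contra hL0
  -- limit circle case
  have hm : conj (m z₀) - m (conj z₀) ≠ 0 := by
    intro hm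
    have hm' : conj (m z₀) = m (conj z₀) := sub_eq_zero.1 hm
    apply hL0
    refine tendsto_nhds_unique hL ((hbcb z₀ (conj z₀) hz₀ hc0).congr' ?_)
    filter_upwards [Ioo_mem_nhdsLT hab] with x hx
    have hx' : x ∈ Ico a b := ⟨hx.1.le, hx.2⟩
    simp only [Wr, map_add, map_mul, (hcφ z₀ x hx').1, (hcφ z₀ x hx').2, (hcθ z₀ x hx').1,
      (hcθ z₀ x hx').2, hm']
  have hsum := sum_int hab hψc (hψ (conj z₀)) hψci (hψi _ hc0)
  have hφi : IntegrableOn (fun x => ‖φ (conj z₀) x‖ ^ 2) (Ioo a b) := by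
    refine sq_int hab (hφ (conj z₀)) hsum (C := ‖conj (m z₀) - m (conj z₀)‖⁻¹) ?_
    intro x hx
    have hx' : x ∈ Ico a b := ⟨hx.1.le, hx.2⟩
    have e : (conj (m z₀) - m (conj z₀)) * φ (conj z₀) x =
        conj (θ z₀ x + m z₀ * φ z₀ x) - (θ (conj z₀) x + m (conj z₀) * φ (conj z₀) x) := by
      rw [map_add, map_mul, (hcφ z₀ x hx').1, (hcθ z₀ x hx').1]; ring
    have e2 := norm_sub_le (conj (θ z₀ x + m z₀ * φ z₀ x))
      (θ (conj z₀) x + m (conj z₀) * φ (conj z₀) x)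
    rw [← e, norm_mul] at e2
    rwa [le_inv_mul_iff₀ (norm_pos_iff.2 hm)]
  have hθi : IntegrableOn (fun x => ‖θ (conj z₀) x‖ ^ 2) (Ioo a b) := by
    have hsum2 := sum_int hab (hψ (conj z₀)) (hφ (conj z₀)) (hψi _ hc0) hφi
    refine sq_int hab (hθ (conj z₀)) hsum2 (C := 1 + ‖m (conj z₀)‖) ?_
    intro x hx
    have e : θ (conj z₀) x = (θ (conj z₀) x + m (conj z₀) * φ (conj z₀) x) -
      m (conj z₀) * φ (conj z₀) x := by ring
    have e2 := norm_sub_le (θ (conj z₀) x + m (conj z₀) * φ (conj z₀) x)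
      (m (conj z₀) * φ (conj z₀) x)
    rw [← e, norm_mul] at e2
    have := norm_nonneg (θ (conj z₀) x + m (conj z₀) * φ (conj z₀) x)
    have := norm_nonneg (m (conj z₀))
    have := norm_nonneg (φ (conj z₀) x)
    nlinarith
  have hic := sum_int hab (hθ (conj z₀)) (hφ (conj z₀)) hθi hφi
  have sq {z : ℂ} {f fq : ℝ → ℂ} {d₁ d₂ : ℂ} (hf : RegSol a b q s z f fq d₁ d₂) :=
    all_sq hab hθ hφ h1 hic hf
  have hi := sum_int hab (hθ z₀) (hφ z₀) (sq (hθ z₀)) (sq (hφ z₀))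
  -- the characteristic function
  set F : ℂ → ℂ := fun z => S * (-S + m z₀ * C) - C * (C + m z₀ * S) +
    (z - z₀) * ∫ t in Ioo a b, φ z t * (θ z₀ t + m z₀ * φ z₀ t) with hFd
  have hF : ∀ z, Tendsto (Wr (φ z) (φq z) (fun x => θ z₀ x + m z₀ * φ z₀ x)
      (fun x => θq z₀ x + m z₀ * φq z₀ x)) (𝓝[<] b) (𝓝 (F z)) :=
    fun z => wr_lim hab (hφ z) (hψ z₀) (sq (hφ z)) (sq (hψ z₀))
  have hFz₀ : F z₀ = -1 := by
    simp only [hFd, sub_self, zero_mul, add_zero]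
    linear_combination -h1
  have hFc : ∀ z, Tendsto (Wr (φ z) (φq z) (fun x => conj (θ z₀ x + m z₀ * φ z₀ x))
      (fun x => conj (θq z₀ x + m z₀ * φq z₀ x))) (𝓝[<] b) (𝓝 (conj (F (conj z)))) := by
    intro z
    have h := (Complex.continuous_conj.tendsto _).comp (hF (conj z))
    refine h.congr' ?_
    filter_upwards [Ioo_mem_nhdsLT hab] with x hx
    have hx' : x ∈ Ico a b := ⟨hx.1.le, hx.2⟩
    simp only [Function.comp, Wr, ← (hcφ z x hx').1, ← (hcφ z x hx').2, map_sub, map_mul,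
      Complex.conj_conj]
  have lim_of {z : ℂ} {f fq : ℝ → ℂ} {d₁ d₂ : ℂ} (hf : RegSol a b q s z f fq d₁ d₂)
      {ζ : ℂ} {g gq : ℝ → ℂ} {e₁ e₂ : ℂ} (hg : RegSol a b q s ζ g gq e₁ e₂) :=
    wr_lim hab hf hg (sq hf) (sq hg)
  have pl {A Aq B Bq D Dq E Eq : ℝ → ℂ} {l₁ l₂ l₃ l₄ l₅ l₆ : ℂ}
      (q₁ : Tendsto (Wr A Aq B Bq) (𝓝[<] b) (𝓝 l₁)) (q₂ : Tendsto (Wr D Dq E Eq) (𝓝[<] b) (𝓝 l₂))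
      (q₃ : Tendsto (Wr A Aq D Dq) (𝓝[<] b) (𝓝 l₃)) (q₄ : Tendsto (Wr B Bq E Eq) (𝓝[<] b) (𝓝 l₄))
      (q₅ : Tendsto (Wr A Aq E Eq) (𝓝[<] b) (𝓝 l₅)) (q₆ : Tendsto (Wr B Bq D Dq) (𝓝[<] b) (𝓝 l₆)) :
      l₁ * l₂ = l₃ * l₄ - l₅ * l₆ :=
    tendsto_nhds_unique (q₁.mul q₂) (((q₃.mul q₄).sub (q₅.mul q₆)).congr
      fun x => (plucker A Aq B Bq D Dq E Eq x).symm)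
  have hF0 : ∀ z, F z ≠ 0 := by
    intro z hz
    by_cases him : z.im = 0
    · have hcz : conj z = z := Complex.conj_eq_iff_im.2 him
      have hFc' := hFc z
      rw [hcz, hz, map_zero] at hFc'
      have hFz := hF z
      rw [hz] at hFz
      have := pl (lim_of (hφ z) (hθ z)) hL hFz (lim_of (hθ z) hψc) hFc' (lim_of (hθ z) (hψ z₀))
      apply hL0
      rw [sub_self, zero_mul, zero_mul, zero_mul] at this
      linear_combination -this - L * h1
    · have hFz := hF z
      rw [hz] at hFz
      have := pl (lim_of (hφ z) (hψ z)) hL hFz (lim_of (hψ z) hψc) (hFc z) (hbcb z z₀ him hz₀)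
      apply hL0
      rw [sub_self, zero_mul, zero_mul] at this
      linear_combination -this - L * h1
  have hFdiff := charF_diff hab hθ hφ h1 hi (hψ z₀) hF
  have hconst := entire_const hFdiff hF0
    (fun ε hε => charF_growth hab hq hs hθ hφ h1 hi (m z₀) hF hε)
  have hF1 : ∀ z, F z = -1 := fun z => by rw [hconst z, ← hconst z₀, hFz₀]
  have hfin := pl (lim_of (hφ z₀) (hφ (conj z₀))) hL (hF z₀) (hFc (conj z₀)) (hFc z₀)
    (hF (conj z₀))
  simp only [hF1, map_neg, map_one] at hfin
  have hI : ∫ t in Ioo a b, φ z₀ t * φ (conj z₀) t =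
      ((∫ t in Ioo a b, ‖φ z₀ t‖ ^ 2 : ℝ) : ℂ) := by
    rw [← integral_complex_ofReal]
    refine setIntegral_congr_fun measurableSet_Ioo fun t ht => ?_
    beta_reduce
    rw [← (hcφ z₀ t ⟨ht.1.le, ht.2⟩).1, Complex.mul_conj, Complex.normSq_eq_norm_sq]
  rw [hI] at hfin
  have hne := int_ne_zero hab (hθ z₀) (hφ z₀) h1 (sq (hφ z₀))
  have hzz : z₀ - conj z₀ ≠ 0 := by
    rw [Complex.sub_conj]
    simp [hz₀]
  have hprod : (z₀ - conj z₀) * ((∫ t in Ioo a b, ‖φ z₀ t‖ ^ 2 : ℝ) : ℂ) * L = 0 := by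
    linear_combination hfin
  have hne' : ((∫ t in Ioo a b, ‖φ z₀ t‖ ^ 2 : ℝ) : ℂ) ≠ 0 := by exact_mod_cast hne
  exact (mul_ne_zero (mul_ne_zero hzz hne') hL0) hprod

end selfadj

/-- High-energy asymptotics of the regular Weyl--Titchmarsh function `m` for a
Schrödinger operator with distributional potential, regular at `a` with boundary
condition parameter `φ_a ∈ [0,π)`: along any nonreal ray,
`m(z) = -√(-z) + o(z^{1/2})` if `φ_a = 0`, and
`m(z) = -cot φ_a + (sin²(φ_a) √(-z))⁻¹ + o(z^{-1/2})` if `φ_a ≠ 0`.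
Here `m` is characterized by the property that `ψ_z = θ_z + m(z) φ_z` lies in the
domain of `S` near `b` (square integrable near `b` and satisfying the boundary
condition at `b`, encoded through vanishing mutual Wronskians at `b`). -/
theorem weyl_m_asymptotics {a b : ℝ} (hab : a < b) {q s : ℝ → ℝ}
    (hq : ∀ x ∈ Set.Ioo a b, IntervalIntegrable q volume a x)
    (hs : ∀ x ∈ Set.Ioo a b, IntervalIntegrable s volume a x)
    {φa : ℝ} (hφa : φa ∈ Set.Ico 0 Real.pi)
    {θ θq φ φq : ℂ → ℝ → ℂ}
    (hθ : ∀ z : ℂ, RegSol a b q s z (θ z) (θq z) (Real.cos φa) (-(Real.sin φa)))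
    (hφ : ∀ z : ℂ, RegSol a b q s z (φ z) (φq z) (Real.sin φa) (Real.cos φa))
    {m : ℂ → ℂ}
    (hL2 : ∀ z : ℂ, z.im ≠ 0 → ∀ c ∈ Set.Ioo a b,
      IntegrableOn (fun x => ‖θ z x + m z * φ z x‖ ^ 2) (Set.Ioo c b))
    (hbcb : ∀ z ζ : ℂ, z.im ≠ 0 → ζ.im ≠ 0 →
      Tendsto (Wr (fun x => θ z x + m z * φ z x) (fun x => θq z x + m z * φq z x)
          (fun x => θ ζ x + m ζ * φ ζ x) (fun x => θq ζ x + m ζ * φq ζ x))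
        (𝓝[<] b) (𝓝 0))
    {w : ℂ} (hw : w.im ≠ 0) :
    (φa = 0 →
      Tendsto (fun t : ℝ => (m ((t : ℂ) * w) + msqrt ((t : ℂ) * w)) / msqrt ((t : ℂ) * w))
        atTop (𝓝 0)) ∧
    (φa ≠ 0 →
      Tendsto (fun t : ℝ =>
          (m ((t : ℂ) * w) + ((Real.cos φa / Real.sin φa : ℝ) : ℂ)
            - 1 / ((((Real.sin φa) ^ 2 : ℝ) : ℂ) * msqrt ((t : ℂ) * w)))
          * msqrt ((t : ℂ) * w)) atTop (𝓝 0)) := by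
  exact asym_of_sa hab hq hs hφa hθ hφ
    (fun z hz => self_adj hab hq hs hθ hφ hL2 hbcb hz) hw
end
end

section
/- Let $S$ be a self-adjoint realization, regular at $a$, with boundary condition parameter $\varphi_a\in(0,\pi)$ (non-Dirichlet), and let $\mu$ be the spectral measure associated with the regular fundamental system normalized at $a$. Then $\int_{\mathbb{R}} (1+|\lambda|)^{-1}\,d\mu(\lambda) < \infty$ and the Weyl--Titchmarsh function has the representation $m(z) = -\cot\varphi_a + \int_{\mathbb{R}} \frac{d\mu(\lambda)}{\lambda - z}$ for $z\in\mathbb{C}\setminus\mathbb{R}$; in particular $m(z)\to -\cot\varphi_a$ as $|z|\to\infty$ along any nonreal ray. If $\varphi_a=0$ (Dirichlet/Friedrichs case), then $\int_{\mathbb{R}} (1+|\lambda|)^{-1} d\mu(\lambda) = \infty$. -/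
open MeasureTheory Set Filter Complex Topology ComplexConjugate

noncomputable section

/-- `(u, uq)` solves the system equivalent to `(τ - z) u = 0` on `[a,b)` with the initial
conditions `u(a) = d₁`, `u^{[1]}(a) = d₂` at the regular endpoint `a`. -/
structure RegSolG (a b : ℝ) (p q r s : ℝ → ℝ) (z : ℂ) (u uq : ℝ → ℂ) (d₁ d₂ : ℂ) :
    Prop where
  fst : ∀ x ∈ Set.Ico a b,
    IntervalIntegrable (fun t => uq t / (p t : ℂ) - (s t : ℂ) * u t) volume a x ∧
    u x = d₁ + ∫ t in a..x, (uq t / (p t : ℂ) - (s t : ℂ) * u t)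
  snd : ∀ x ∈ Set.Ico a b,
    IntervalIntegrable (fun t => (s t : ℂ) * uq t + ((q t : ℂ) - z * (r t : ℂ)) * u t)
      volume a x ∧
    uq x = d₂ + ∫ t in a..x, ((s t : ℂ) * uq t + ((q t : ℂ) - z * (r t : ℂ)) * u t)

/-! ### Elementary sums -/

lemma aux_sum_low (v σ : ℝ) (hv : 0 ≤ v) (hσ : 0 ≤ σ) (N : ℕ) :
    (∑ n ∈ Finset.range N, (if 2 ^ n * v ≤ σ then 2 ^ n * v else 0)) ≤ 2 ^ N * v ∧
    (∑ n ∈ Finset.range N, (if 2 ^ n * v ≤ σ then 2 ^ n * v else 0)) ≤ 2 * σ := by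
  induction N with
  | zero => simp; exact ⟨hv, hσ⟩
  | succ N ih =>
    rw [Finset.sum_range_succ]
    obtain ⟨h1, h2⟩ := ih
    have h3 : 0 ≤ 2 ^ N * v := by positivity
    have h4 : (2:ℝ) ^ (N+1) * v = 2 * (2 ^ N * v) := by ring
    split_ifs with h
    · constructor <;> linarith
    · constructor <;> linarith

lemma aux_sum_high (Y : ℝ) (N : ℕ) :
    (∑ k ∈ Finset.range N, (if Y < 2 ^ k then Y / 2 ^ k else 0)) ≤
      2 - 2 * min 1 (Y / 2 ^ N) := by
  induction N with
  | zero =>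
    have := min_le_left (1:ℝ) (Y / 2 ^ 0)
    simp only [Finset.range_zero, Finset.sum_empty]
    linarith
  | succ N ih =>
    rw [Finset.sum_range_succ]
    have h0 : (0:ℝ) < 2 ^ N := by positivity
    have h4 : Y / (2:ℝ) ^ (N+1) = (Y / 2 ^ N) / 2 := by rw [pow_succ]; field_simp
    split_ifs with h
    · have h5 : Y / 2 ^ N < 1 := by rw [div_lt_one h0]; exact h
      rw [min_eq_right h5.le] at ih
      have := min_le_right (1:ℝ) (Y / 2 ^ (N+1))
      rw [h4] at this ⊢
      linarith
    · have h5 : 1 ≤ Y / 2 ^ N := by rw [le_div_iff₀ h0]; linarith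
      rw [min_eq_left h5] at ih
      have := min_le_left (1:ℝ) (Y / 2 ^ (N+1))
      linarith

lemma aux_sum_min (Y : ℝ) (hY : 0 < Y) (N : ℕ) :
    (∑ k ∈ Finset.range N, min (2 ^ k / Y) (Y / 2 ^ k)) ≤ 4 := by
  have h1 := (aux_sum_low (1 / Y) 1 (by positivity) (by norm_num) N).2
  have h2 := aux_sum_high Y N
  have h3 : 0 ≤ min 1 (Y / 2 ^ N) := by positivity
  calc _ ≤ ∑ k ∈ Finset.range N, ((if 2 ^ k * (1 / Y) ≤ 1 then 2 ^ k * (1 / Y) else 0)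
            + (if Y < 2 ^ k then Y / 2 ^ k else 0)) := by
        apply Finset.sum_le_sum
        intro k _
        have h0 : (0:ℝ) < 2 ^ k := by positivity
        by_cases h : Y < 2 ^ k
        · have : ¬ ((2:ℝ) ^ k * (1 / Y) ≤ 1) := by
            rw [mul_one_div, div_le_one hY]; linarith
          rw [if_neg this, if_pos h, zero_add]; exact min_le_right _ _
        · have : ((2:ℝ) ^ k * (1 / Y) ≤ 1) := by
            rw [mul_one_div, div_le_one hY]; linarith
          rw [if_pos this, if_neg h, add_zero, mul_one_div]; exact min_le_left _ _
    _ ≤ 4 := by rw [Finset.sum_add_distrib]; linarith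

/-- The key summation argument. -/
lemma aux_summable (D : ℝ → ℝ) (C : ℝ) (hC : 0 ≤ C) (hD0 : ∀ y, 0 < y → 0 ≤ D y)
    (α : ℕ → ℝ) (hα : ∀ n, 0 < α n) (hs : Summable α)
    (hD : ∀ n y, 0 < y → D y ≤ C * (4 ^ n / y + y * α n ^ 2 / 4 ^ n)) :
    ∃ η > 0, Summable (fun k : ℕ => D (2 ^ k * η)) := by
  set Y : ℕ → ℝ := fun n => 4 ^ n / α n with hY
  have hYpos : ∀ n, 0 < Y n := fun n => div_pos (by positivity) (hα n)
  have hYtop : ∀ y, ∃ n, y < Y n := by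
    intro y
    obtain ⟨M, hM⟩ : ∃ M, ∀ n, α n ≤ M := ⟨∑' n, α n, fun n => hs.le_tsum n (fun j _ => (hα j).le)⟩
    have hM0 : 0 < M := (hα 0).trans_le (hM 0)
    obtain ⟨n, hn⟩ := pow_unbounded_of_one_lt (y * M) (by norm_num : (1:ℝ) < 4)
    refine ⟨n, ?_⟩
    rw [hY]; simp only
    rw [lt_div_iff₀ (hα n)]
    rcases le_or_gt y 0 with h | h
    · have : y * α n ≤ 0 := mul_nonpos_of_nonpos_of_nonneg h (hα n).le
      have : (0:ℝ) < 4 ^ n := by positivity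
      linarith
    · nlinarith [hM n]
  have key : ∀ y, Y 0 ≤ y → ∃ n, D y ≤ 4 * C * (α n * min (y / Y n) (Y n / y)
      + α (n+1) * min (y / Y (n+1)) (Y (n+1) / y)) := by
    intro y hy
    have hex := hYtop y
    classical
    have hy0 : 0 < y := (hYpos 0).trans_le hy
    set N := Nat.find hex with hN
    have hN1 : y < Y N := Nat.find_spec hex
    have hNpos : N ≠ 0 := by
      intro h; rw [h] at hN1; linarith
    obtain ⟨n, hn⟩ := Nat.exists_eq_succ_of_ne_zero hNpos
    have hn2 : ¬ y < Y n := Nat.find_min hex (by omega)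
    rw [hn] at hN1
    push Not at hn2
    refine ⟨n, (hD (n+1) y hy0).trans ?_⟩
    have e1 : min (y / Y n) (Y n / y) = Y n / y := by
      apply min_eq_right
      have : Y n / y ≤ 1 := by rw [div_le_one hy0]; exact hn2
      have : 1 ≤ y / Y n := by rw [le_div_iff₀ (hYpos n)]; linarith
      linarith
    have e2 : min (y / Y (n+1)) (Y (n+1) / y) = y / Y (n+1) := by
      apply min_eq_left
      have : y / Y (n+1) ≤ 1 := by rw [div_le_one (hYpos _)]; exact hN1.le
      have : 1 ≤ Y (n+1) / y := by rw [le_div_iff₀ hy0, one_mul]; exact le_of_lt hN1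
      linarith
    rw [e1, e2]
    have e3 : (4:ℝ) ^ (n+1) / y = 4 * (α n * (Y n / y)) := by
      rw [hY]; simp only; have := (hα n).ne'; field_simp; ring
    have e4 : y * α (n+1) ^ 2 / 4 ^ (n+1) = α (n+1) * (y / Y (n+1)) := by
      rw [hY]; simp only; have := (hα (n+1)).ne'; field_simp
    rw [e3, e4]
    have : 0 ≤ α (n+1) * (y / Y (n+1)) := mul_nonneg (hα _).le (div_pos hy0 (hYpos _)).le
    nlinarith
  have hterm : ∀ y n, 0 < y → 0 ≤ α n * min (y / Y n) (Y n / y) := fun y n hy =>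
    mul_nonneg (hα n).le (le_min (div_pos hy (hYpos n)).le (div_pos (hYpos n) hy).le)
  have hsum : ∀ y, 0 < y → Summable (fun n => α n * min (y / Y n) (Y n / y)) := by
    intro y hy
    refine Summable.of_nonneg_of_le (fun n => hterm y n hy) (fun n => ?_) hs
    have : min (y / Y n) (Y n / y) ≤ 1 := by
      rcases le_total y (Y n) with h | h
      · exact (min_le_left _ _).trans ((div_le_one (hYpos n)).2 h)
      · exact (min_le_right _ _).trans ((div_le_one hy).2 h)
    nlinarith [hα n]
  have key2 : ∀ y, Y 0 ≤ y → D y ≤ 4 * C * ∑' n, α n * min (y / Y n) (Y n / y) := by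
    intro y hy
    have hy0 : 0 < y := (hYpos 0).trans_le hy
    obtain ⟨n, hn⟩ := key y hy
    refine hn.trans ?_
    apply mul_le_mul_of_nonneg_left _ (by positivity)
    have := (hsum y hy0).sum_le_tsum {n, n+1} (fun j _ => hterm y j hy0)
    rwa [Finset.sum_pair (by omega)] at this
  refine ⟨Y 0, hYpos 0, ?_⟩
  apply summable_of_sum_range_le (c := 4 * C * (4 * ∑' n, α n))
  · intro k
    exact hD0 _ (mul_pos (by positivity) (hYpos 0))
  intro N
  have hyk : ∀ k : ℕ, Y 0 ≤ 2 ^ k * Y 0 := fun k => by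
    have : (1:ℝ) ≤ 2 ^ k := one_le_pow₀ (by norm_num)
    nlinarith [hYpos 0]
  calc _ ≤ ∑ k ∈ Finset.range N, 4 * C * ∑' n, α n * min (2 ^ k * Y 0 / Y n) (Y n / (2 ^ k * Y 0)) :=
        Finset.sum_le_sum fun k _ => key2 _ (hyk k)
    _ = 4 * C * ∑' n, ∑ k ∈ Finset.range N, α n * min (2 ^ k * Y 0 / Y n) (Y n / (2 ^ k * Y 0)) := by
        rw [← Finset.mul_sum, Summable.tsum_finsetSum]
        intro k _
        exact hsum _ ((hYpos 0).trans_le (hyk k))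
    _ ≤ 4 * C * ∑' n, α n * 4 := by
        apply mul_le_mul_of_nonneg_left _ (by positivity)
        apply Summable.tsum_le_tsum
        · intro n
          rw [← Finset.mul_sum]
          apply mul_le_mul_of_nonneg_left _ (hα n).le
          have := aux_sum_min (Y n / Y 0) (div_pos (hYpos n) (hYpos 0)) N
          refine le_trans (le_of_eq (Finset.sum_congr rfl fun k _ => ?_)) this
          have := (hYpos 0).ne'
          have := (hYpos n).ne'
          congr 1 <;> field_simp
        · exact summable_sum fun k _ => hsum _ ((hYpos 0).trans_le (hyk k))
        · exact hs.mul_right 4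
    _ = _ := by rw [tsum_mul_right]; ring

/-! ### Herglotz part -/

lemma aux_int_sq {μ : Measure ℝ}
    (hfin : (∫⁻ t : ℝ, ENNReal.ofReal ((1 + t ^ 2)⁻¹) ∂μ) < ⊤) :
    Integrable (fun t : ℝ => (1 + t ^ 2)⁻¹) μ := by
  refine ⟨(by fun_prop : Measurable _).aestronglyMeasurable, ?_⟩
  rw [hasFiniteIntegral_iff_ofReal (Eventually.of_forall fun t => by positivity)]
  exact hfin

lemma aux_im_le (t : ℝ) (z : ℂ) : |z.im| ≤ ‖(t:ℂ) - z‖ := by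
  have := abs_im_le_norm ((t:ℂ) - z)
  simpa using this

lemma aux_ne (t : ℝ) {z : ℂ} (hz : z.im ≠ 0) : (t:ℂ) - z ≠ 0 := by
  intro h
  have := aux_im_le t z
  rw [h, norm_zero] at this
  exact hz (abs_eq_zero.1 (le_antisymm this (abs_nonneg _)))

lemma aux_one_add (t : ℝ) : (1 + (t:ℂ) ^ 2) ≠ 0 := by
  have : (1 + (t:ℂ)^2) = ((1 + t^2 : ℝ) : ℂ) := by push_cast; ring
  rw [this]
  exact_mod_cast (by positivity : (1 + t^2 : ℝ) ≠ 0)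

lemma aux_int_kernel {μ : Measure ℝ}
    (hfin : (∫⁻ t : ℝ, ENNReal.ofReal ((1 + t ^ 2)⁻¹) ∂μ) < ⊤) {z : ℂ} (hz : z.im ≠ 0) :
    Integrable (fun t : ℝ => (1 / ((t : ℂ) - z) - (t : ℂ) / (1 + (t : ℂ) ^ 2))) μ := by
  refine ((aux_int_sq hfin).const_mul (‖z‖ + (1 + ‖z‖ ^ 2) / |z.im|)).mono'
    (by fun_prop : Measurable _).aestronglyMeasurable (Eventually.of_forall fun t => ?_)
  have h1 := aux_ne t hz
  have h2 := aux_one_add t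
  have h3 := aux_im_le t z
  have hz' : 0 < |z.im| := abs_pos.2 hz
  have h4 : 0 < ‖(t:ℂ) - z‖ := norm_pos_iff.2 h1
  have e : (1 / ((t : ℂ) - z) - (t : ℂ) / (1 + (t : ℂ) ^ 2)) =
      (z * (t - z) + (1 + z ^ 2)) / ((t - z) * (1 + (t:ℂ) ^ 2)) := by
    field_simp; ring
  have e2 : ‖1 + (t:ℂ) ^ 2‖ = 1 + t ^ 2 := by
    have : (1 + (t:ℂ)^2) = ((1 + t^2 : ℝ) : ℂ) := by push_cast; ring
    rw [this, norm_real, Real.norm_of_nonneg (by positivity)]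
  rw [e, norm_div, norm_mul, e2, ← div_div, div_eq_mul_inv _ (1 + t ^ 2)]
  apply mul_le_mul_of_nonneg_right _ (by positivity)
  rw [div_le_iff₀ h4, add_mul]
  refine (norm_add_le _ _).trans ?_
  rw [norm_mul]
  gcongr
  calc ‖1 + z ^ 2‖ ≤ 1 + ‖z‖ ^ 2 := by
        refine (norm_add_le _ _).trans ?_
        simp
    _ = (1 + ‖z‖ ^ 2) / |z.im| * |z.im| := by field_simp
    _ ≤ _ := by gcongr

section herglotz
variable {m : ℂ → ℂ} {μ : Measure ℝ}

lemma aux_conj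
    (hrep : ∀ z : ℂ, z.im ≠ 0 → m z = (((m Complex.I).re : ℝ) : ℂ) +
      ∫ t : ℝ, (1 / ((t : ℂ) - z) - (t : ℂ) / (1 + (t : ℂ) ^ 2)) ∂μ) {z : ℂ} (hz : z.im ≠ 0) :
    m (conj z) = conj (m z) := by
  rw [hrep z hz, hrep (conj z) (by simpa using hz), map_add, conj_ofReal, ← integral_conj]
  congr 1
  apply integral_congr_ae
  exact Eventually.of_forall fun t => by simp

lemma aux_im
    (hfin : (∫⁻ t : ℝ, ENNReal.ofReal ((1 + t ^ 2)⁻¹) ∂μ) < ⊤)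
    (hrep : ∀ z : ℂ, z.im ≠ 0 → m z = (((m Complex.I).re : ℝ) : ℂ) +
      ∫ t : ℝ, (1 / ((t : ℂ) - z) - (t : ℂ) / (1 + (t : ℂ) ^ 2)) ∂μ) {y : ℝ} (hy : 0 < y) :
    0 ≤ (m (y * I)).im ∧ ENNReal.ofReal (m (y * I)).im =
      ∫⁻ t : ℝ, ENNReal.ofReal (y / (t ^ 2 + y ^ 2)) ∂μ := by
  have hz : ((y:ℂ) * I).im ≠ 0 := by simpa using hy.ne'
  have hi := aux_int_kernel hfin hz
  have e : ∀ t : ℝ, (1 / ((t : ℂ) - y * I) - (t : ℂ) / (1 + (t : ℂ) ^ 2)).im = y / (t ^ 2 + y ^ 2) := by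
    intro t
    have h1 : ((t:ℂ) / (1 + (t:ℂ) ^ 2)).im = 0 := by
      have : (t:ℂ) / (1 + (t:ℂ)^2) = ((t / (1 + t^2) : ℝ) : ℂ) := by push_cast; ring
      rw [this, ofReal_im]
    rw [sub_im, h1, sub_zero, one_div, inv_im]
    simp [normSq_apply]
    ring
  have hi2 : Integrable (fun t : ℝ => y / (t ^ 2 + y ^ 2)) μ := by
    refine (Complex.imCLM.integrable_comp hi).congr (Eventually.of_forall fun t => ?_)
    exact e t
  have e3 : (m (y * I)).im = ∫ t : ℝ, y / (t ^ 2 + y ^ 2) ∂μ := by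
    rw [hrep _ hz, add_im, ofReal_im, zero_add]
    have := Complex.imCLM.integral_comp_comm hi
    simp only [imCLM_apply] at this
    rw [← this]
    exact integral_congr_ae (Eventually.of_forall e)
  have hn : ∀ t : ℝ, 0 ≤ y / (t ^ 2 + y ^ 2) := fun t => by positivity
  refine ⟨?_, ?_⟩
  · rw [e3]; exact integral_nonneg hn
  · rw [e3, ofReal_integral_eq_lintegral_ofReal hi2 (Eventually.of_forall hn)]

lemma aux_finite
    (hfin : (∫⁻ t : ℝ, ENNReal.ofReal ((1 + t ^ 2)⁻¹) ∂μ) < ⊤)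
    (hrep : ∀ z : ℂ, z.im ≠ 0 → m z = (((m Complex.I).re : ℝ) : ℂ) +
      ∫ t : ℝ, (1 / ((t : ℂ) - z) - (t : ℂ) / (1 + (t : ℂ) ^ 2)) ∂μ)
    {η : ℝ} (hη : 0 < η) (hs : Summable (fun k : ℕ => (m (((2 ^ k * η : ℝ) : ℂ) * I)).im)) :
    (∫⁻ t : ℝ, ENNReal.ofReal ((1 + |t|)⁻¹) ∂μ) < ⊤ := by
  have hpt : ∀ t : ℝ, ENNReal.ofReal ((1 + |t|)⁻¹) ≤
      ENNReal.ofReal (1 + η ^ 2) * ENNReal.ofReal ((1 + t ^ 2)⁻¹) +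
      ENNReal.ofReal 5 * ∑' k : ℕ, ENNReal.ofReal ((2 ^ k * η) / (t ^ 2 + (2 ^ k * η) ^ 2)) := by
    intro t
    have ha := abs_nonneg t
    rcases lt_or_ge |t| η with h | h
    · refine le_trans ?_ le_self_add
      rw [← ENNReal.ofReal_mul (by positivity)]
      apply ENNReal.ofReal_le_ofReal
      have h1 : (1 + |t|)⁻¹ ≤ 1 := inv_le_one_of_one_le₀ (by linarith)
      refine h1.trans ?_
      rw [← div_eq_mul_inv, le_div_iff₀ (by positivity)]
      have : t ^ 2 = |t| ^ 2 := (sq_abs t).symm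
      nlinarith
    · refine le_trans ?_ le_add_self
      obtain ⟨k, hk1, hk2⟩ := exists_nat_pow_near (x := |t| / η) (y := 2)
        ((one_le_div hη).2 h) (by norm_num)
      rw [le_div_iff₀ hη] at hk1
      rw [div_lt_iff₀ hη, pow_succ] at hk2
      refine le_trans ?_ (mul_le_mul_right (ENNReal.le_tsum k) _)
      rw [← ENNReal.ofReal_mul (by positivity)]
      apply ENNReal.ofReal_le_ofReal
      have hp : 0 < 2 ^ k * η := by positivity
      set Y := 2 ^ k * η
      have hk2' : |t| < 2 * Y := by linarith [show 2 ^ k * 2 * η = 2 * Y by ring]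
      have : t ^ 2 = |t| ^ 2 := (sq_abs t).symm
      rw [this, inv_eq_one_div, ← mul_div_assoc, div_le_div_iff₀ (by positivity) (by positivity)]
      nlinarith
  refine (lintegral_mono hpt).trans_lt ?_
  rw [lintegral_add_left (by fun_prop), lintegral_const_mul _ (by fun_prop),
    lintegral_const_mul _ (by fun_prop), lintegral_tsum (fun k => by fun_prop)]
  refine ENNReal.add_lt_top.2 ⟨ENNReal.mul_lt_top ENNReal.ofReal_lt_top hfin,
    ENNReal.mul_lt_top ENNReal.ofReal_lt_top ?_⟩
  have e : ∀ k : ℕ, ∫⁻ t : ℝ, ENNReal.ofReal ((2 ^ k * η) / (t ^ 2 + (2 ^ k * η) ^ 2)) ∂μ =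
      ENNReal.ofReal (m (((2 ^ k * η : ℝ) : ℂ) * I)).im := fun k =>
    ((aux_im hfin hrep (by positivity : 0 < 2 ^ k * η)).2).symm
  simp_rw [e]
  exact hs.tsum_ofReal_lt_top

lemma aux_bound {w : ℂ} (hw : w.im ≠ 0) {τ : ℝ} (hτ : 1 ≤ τ) (t : ℝ) :
    ‖1 / ((t : ℂ) - τ * w)‖ ≤ (1 + (‖w‖ + 1) / |w.im|) * (1 + |t|)⁻¹ := by
  have hw' : 0 < |w.im| := abs_pos.2 hw
  have h1 := aux_im_le t (τ * w)
  have e1 : |((τ:ℂ) * w).im| = τ * |w.im| := by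
    rw [im_ofReal_mul, abs_mul, abs_of_pos (by linarith)]
  rw [e1] at h1
  have h2 : |t| ≤ ‖(t:ℂ) - τ * w‖ + τ * ‖w‖ := by
    have := norm_add_le ((t:ℂ) - τ * w) (τ * w)
    rw [sub_add_cancel, norm_mul, norm_real, norm_real, Real.norm_eq_abs, Real.norm_eq_abs,
      abs_of_pos (by linarith : 0 < τ)] at this
    exact this
  have h3 : 0 < ‖(t:ℂ) - τ * w‖ := lt_of_lt_of_le (by positivity) h1
  set n := ‖(t:ℂ) - τ * w‖
  have h4 : τ ≤ n / |w.im| := by rw [le_div_iff₀ hw']; exact h1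
  have ha := abs_nonneg t
  rw [norm_div, norm_one, ← div_eq_mul_inv, div_le_div_iff₀ h3 (by positivity)]
  have h5 : τ * ‖w‖ ≤ n / |w.im| * ‖w‖ := by gcongr
  calc 1 * (1 + |t|) ≤ n / |w.im| + (n + n / |w.im| * ‖w‖) := by linarith
    _ = _ := by field_simp; ring

lemma aux_limit
    (hfin : (∫⁻ t : ℝ, ENNReal.ofReal ((1 + t ^ 2)⁻¹) ∂μ) < ⊤)
    (hrep : ∀ z : ℂ, z.im ≠ 0 → m z = (((m Complex.I).re : ℝ) : ℂ) +
      ∫ t : ℝ, (1 / ((t : ℂ) - z) - (t : ℂ) / (1 + (t : ℂ) ^ 2)) ∂μ)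
    (hf1 : (∫⁻ t : ℝ, ENNReal.ofReal ((1 + |t|)⁻¹) ∂μ) < ⊤) :
    ∃ c : ℝ, (∀ z : ℂ, z.im ≠ 0 → m z = (c : ℂ) + ∫ t : ℝ, (1 / ((t : ℂ) - z)) ∂μ) ∧
      (∀ w : ℂ, w.im ≠ 0 → Tendsto (fun t : ℝ => m ((t : ℂ) * w)) atTop (𝓝 (c : ℂ))) := by
  have hi1 : Integrable (fun t : ℝ => (1 + |t|)⁻¹) μ := by
    refine ⟨(by fun_prop : Measurable _).aestronglyMeasurable, ?_⟩
    rw [hasFiniteIntegral_iff_ofReal (Eventually.of_forall fun t => by positivity)]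
    exact hf1
  have hi2 : ∀ z : ℂ, z.im ≠ 0 → Integrable (fun t : ℝ => 1 / ((t:ℂ) - z)) μ := by
    intro z hz
    refine (hi1.const_mul (1 + (‖z‖ + 1) / |z.im|)).mono' (by fun_prop : Measurable _).aestronglyMeasurable
      (Eventually.of_forall fun t => ?_)
    simpa using aux_bound hz le_rfl t
  have hi3 : Integrable (fun t : ℝ => (t : ℂ) / (1 + (t : ℂ) ^ 2)) μ := by
    have := (hi2 I (by simp)).sub (aux_int_kernel hfin (z := I) (by simp))
    refine this.congr (Eventually.of_forall fun t => ?_)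
    simp
  have hrep2 : ∀ z : ℂ, z.im ≠ 0 → m z = (((m I).re - ∫ t : ℝ, t / (1 + t ^ 2) ∂μ : ℝ) : ℂ) +
      ∫ t : ℝ, (1 / ((t : ℂ) - z)) ∂μ := by
    intro z hz
    rw [hrep z hz, integral_sub (hi2 z hz) hi3]
    have : ∫ t : ℝ, (t : ℂ) / (1 + (t : ℂ) ^ 2) ∂μ = ((∫ t : ℝ, t / (1 + t ^ 2) ∂μ : ℝ) : ℂ) := by
      rw [← integral_complex_ofReal]
      apply integral_congr_ae
      exact Eventually.of_forall fun t => by simp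
    rw [this, ofReal_sub]; ring
  refine ⟨_, hrep2, fun w hw => ?_⟩
  have hlim : Tendsto (fun τ : ℝ => ∫ t : ℝ, (1 / ((t : ℂ) - τ * w)) ∂μ) atTop
      (𝓝 (∫ _t : ℝ, (0:ℂ) ∂μ)) := by
    apply tendsto_integral_filter_of_dominated_convergence
      (fun t => (1 + (‖w‖ + 1) / |w.im|) * (1 + |t|)⁻¹)
    · exact Eventually.of_forall fun τ => (by fun_prop : Measurable _).aestronglyMeasurable
    · filter_upwards [eventually_ge_atTop 1] with τ hτ
      exact Eventually.of_forall fun t => aux_bound hw hτ t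
    · exact hi1.const_mul _
    · refine Eventually.of_forall fun t => ?_
      have hw' : 0 < |w.im| := abs_pos.2 hw
      apply squeeze_zero_norm' (a := fun τ : ℝ => (τ * |w.im|)⁻¹)
      · filter_upwards [eventually_ge_atTop 1] with τ hτ
        have h1 := aux_im_le t (τ * w)
        have e1 : |((τ:ℂ) * w).im| = τ * |w.im| := by
          rw [im_ofReal_mul, abs_mul, abs_of_pos (by linarith)]
        rw [e1] at h1
        rw [norm_div, norm_one, one_div]
        exact inv_anti₀ (by positivity) h1
      · exact tendsto_inv_atTop_zero.comp (tendsto_id.atTop_mul_const hw')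
  rw [integral_zero] at hlim
  have := hlim.const_add ((((m I).re - ∫ t : ℝ, t / (1 + t ^ 2) ∂μ : ℝ) : ℂ))
  rw [add_zero] at this
  refine this.congr' ?_
  filter_upwards [eventually_gt_atTop 0] with τ hτ
  rw [hrep2 (τ * w) (by rw [im_ofReal_mul]; exact mul_ne_zero hτ.ne' hw)]

end herglotz
/-! ### Absolutely continuous functions -/

lemma ac_const (A : ℂ) (a x : ℝ) : AbsolutelyContinuousOnInterval (fun _ => A) a x :=
  (LipschitzWith.const A).lipschitzOnWith.absolutelyContinuousOnInterval

lemma ac_prim {f : ℝ → ℂ} {a x : ℝ} (hf : IntervalIntegrable f volume a x) :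
    AbsolutelyContinuousOnInterval (fun t => ∫ v in a..t, f v) a x := by
  have hre : IntervalIntegrable (fun t => (f t).re) volume a x :=
    ⟨hf.1.re, hf.2.re⟩
  have him : IntervalIntegrable (fun t => (f t).im) volume a x :=
    ⟨hf.1.im, hf.2.im⟩
  have h1 := (hre.absolutelyContinuousOnInterval_intervalIntegral (c := a) (by simp)).fun_smul
    (ac_const 1 a x)
  have h2 := (him.absolutelyContinuousOnInterval_intervalIntegral (c := a) (by simp)).fun_smul
    (ac_const I a x)
  have h3 := h1.fun_add h2
  have e : ∀ t ∈ uIcc a x, (∫ v in a..t, f v) =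
      (∫ v in a..t, (f v).re) • (1:ℂ) + (∫ v in a..t, (f v).im) • I := by
    intro t ht
    have hft : IntervalIntegrable f volume a t := hf.mono_set (uIcc_subset_uIcc_left ht)
    have hre' : IntervalIntegrable (fun t => ((f t).re : ℂ)) volume a t :=
      ⟨hft.1.re.ofReal, hft.2.re.ofReal⟩
    have him' : IntervalIntegrable (fun t => ((f t).im : ℂ) * I) volume a t :=
      ⟨(hft.1.im.ofReal (𝕜 := ℂ)).mul_const I, (hft.2.im.ofReal (𝕜 := ℂ)).mul_const I⟩
    rw [real_smul, real_smul, mul_one, ← intervalIntegral.integral_ofReal,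
      ← intervalIntegral.integral_ofReal, ← intervalIntegral.integral_mul_const,
      ← intervalIntegral.integral_add hre' him']
    simp [re_add_im]
  rw [absolutelyContinuousOnInterval_iff] at h3 ⊢
  intro ε hε
  obtain ⟨δ, hδ, h⟩ := h3 ε hε
  refine ⟨δ, hδ, fun E hE hE2 => ?_⟩
  refine lt_of_le_of_lt (le_of_eq ?_) (h E hE hE2)
  refine Finset.sum_congr rfl fun i hi => ?_
  have := hE.1 i hi
  rw [e _ this.1, e _ this.2]

lemma prod_rule {f g f' g' : ℝ → ℂ} {a x : ℝ} {A B : ℂ} (hax : a ≤ x)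
    (hf' : IntervalIntegrable f' volume a x) (hg' : IntervalIntegrable g' volume a x)
    (hf : ∀ t ∈ Icc a x, f t = A + ∫ v in a..t, f' v)
    (hg : ∀ t ∈ Icc a x, g t = B + ∫ v in a..t, g' v) :
    IntervalIntegrable (fun t => f' t * g t + f t * g' t) volume a x ∧
    f x * g x = A * B + ∫ t in a..x, (f' t * g t + f t * g' t) := by
  set F : ℝ → ℂ := fun t => A + ∫ v in a..t, f' v with hF
  set G : ℝ → ℂ := fun t => B + ∫ v in a..t, g' v with hG
  have hFac : AbsolutelyContinuousOnInterval F a x := (ac_const A a x).fun_add (ac_prim hf')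
  have hGac : AbsolutelyContinuousOnInterval G a x := (ac_const B a x).fun_add (ac_prim hg')
  have hI : IntervalIntegrable (fun t => f' t * G t + F t * g' t) volume a x :=
    (hf'.mul_continuousOn hGac.continuousOn).add (hg'.continuousOn_mul hFac.continuousOn)
  have hEq : ∀ t ∈ Icc a x, f' t * g t + f t * g' t = f' t * G t + F t * g' t := by
    intro t ht; rw [hf t ht, hg t ht]
  have hac := (hFac.fun_smul hGac).fun_sub (ac_prim hI)
  have hz : ∀ᵐ t, t ∈ uIcc a x → HasDerivAt
      (fun t => F t • G t - ∫ v in a..t, (f' v * G v + F v * g' v)) 0 t := by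
    filter_upwards [hf'.ae_hasDerivAt_integral, hg'.ae_hasDerivAt_integral,
      hI.ae_hasDerivAt_integral] with t h1 h2 h3 ht
    have d1 := (h1 ht a (by simp)).const_add A
    have d2 := (h2 ht a (by simp)).const_add B
    have d3 := h3 ht a (by simp)
    have d4 := (d1.mul d2).sub d3
    rw [sub_self] at d4
    exact d4
  obtain ⟨C, hC⟩ := hac.const_of_ae_hasDerivAt_zero hz
  have ha := hC a (by simp)
  have hx := hC x (by simp)
  have hcong : EqOn (fun t => f' t * G t + F t * g' t) (fun t => f' t * g t + f t * g' t)
      (uIcc a x) := by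
    intro t ht
    rw [uIcc_of_le hax] at ht
    exact (hEq t ht).symm
  refine ⟨(intervalIntegrable_congr (hcong.mono uIoc_subset_uIcc)).1 hI, ?_⟩
  rw [← intervalIntegral.integral_congr hcong, hf x ⟨hax, le_rfl⟩, hg x ⟨hax, le_rfl⟩]
  have e1 : F a = A := by simp [hF]
  have e2 : G a = B := by simp [hG]
  simp only [intervalIntegral.integral_same, e1, e2, smul_eq_mul] at ha hx
  change F x * G x = _
  linear_combination hx - ha

/-! ### Solutions of the inhomogeneous system -/

/-- `(u, uq)` solves the system with inhomogeneity `-r g`. -/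
structure Sol (a b : ℝ) (p q r s : ℝ → ℝ) (u uq g : ℝ → ℂ) (A B : ℂ) : Prop where
  i1 : ∀ x ∈ Ico a b, IntervalIntegrable (fun t => uq t / (p t : ℂ) - (s t : ℂ) * u t) volume a x
  e1 : ∀ x ∈ Ico a b, u x = A + ∫ t in a..x, (uq t / (p t : ℂ) - (s t : ℂ) * u t)
  i2 : ∀ x ∈ Ico a b, IntervalIntegrable
    (fun t => (s t : ℂ) * uq t + (q t : ℂ) * u t - (r t : ℂ) * g t) volume a x
  e2 : ∀ x ∈ Ico a b, uq x = B +
    ∫ t in a..x, ((s t : ℂ) * uq t + (q t : ℂ) * u t - (r t : ℂ) * g t)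

section sol
variable {a b : ℝ} {p q r s : ℝ → ℝ} {u uq g v vq h : ℝ → ℂ} {A B A' B' : ℂ}

lemma RegSolG.toSol {z : ℂ} (hu : RegSolG a b p q r s z u uq A B) :
    Sol a b p q r s u uq (fun t => z * u t) A B := by
  have e : (fun t => (s t : ℂ) * uq t + ((q t : ℂ) - z * (r t : ℂ)) * u t) =
      (fun t => (s t : ℂ) * uq t + (q t : ℂ) * u t - (r t : ℂ) * (z * u t)) := by
    funext t; ring
  have h2 := hu.snd
  rw [e] at h2
  exact ⟨fun x hx => (hu.fst x hx).1, fun x hx => (hu.fst x hx).2,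
    fun x hx => (h2 x hx).1, fun x hx => (h2 x hx).2⟩

lemma Sol.lin (hu : Sol a b p q r s u uq g A B) (hv : Sol a b p q r s v vq h A' B') (c : ℂ) :
    Sol a b p q r s (fun t => u t + c * v t) (fun t => uq t + c * vq t)
      (fun t => g t + c * h t) (A + c * A') (B + c * B') := by
  have f1 : (fun t => (uq t + c * vq t) / (p t : ℂ) - (s t : ℂ) * (u t + c * v t)) =
      fun t => (uq t / (p t : ℂ) - (s t : ℂ) * u t) + c * (vq t / (p t : ℂ) - (s t : ℂ) * v t) := by
    funext t; ring
  have f2 : (fun t => (s t : ℂ) * (uq t + c * vq t) + (q t : ℂ) * (u t + c * v t)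
        - (r t : ℂ) * (g t + c * h t)) =
      fun t => ((s t : ℂ) * uq t + (q t : ℂ) * u t - (r t : ℂ) * g t) +
        c * ((s t : ℂ) * vq t + (q t : ℂ) * v t - (r t : ℂ) * h t) := by
    funext t; ring
  constructor
  · intro x hx
    rw [f1]; exact (hu.i1 x hx).add ((hv.i1 x hx).const_mul c)
  · intro x hx
    rw [f1, intervalIntegral.integral_add (hu.i1 x hx) ((hv.i1 x hx).const_mul c),
      intervalIntegral.integral_const_mul, hu.e1 x hx, hv.e1 x hx]
    ring
  · intro x hx
    rw [f2]; exact (hu.i2 x hx).add ((hv.i2 x hx).const_mul c)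
  · intro x hx
    rw [f2, intervalIntegral.integral_add (hu.i2 x hx) ((hv.i2 x hx).const_mul c),
      intervalIntegral.integral_const_mul, hu.e2 x hx, hv.e2 x hx]
    ring

lemma ii_conj {f : ℝ → ℂ} {a x : ℝ} (hf : IntervalIntegrable f volume a x) :
    IntervalIntegrable (fun t => conj (f t)) volume a x := by
  constructor
  · exact (Complex.conjCLE.toContinuousLinearMap).integrable_comp hf.1
  · exact (Complex.conjCLE.toContinuousLinearMap).integrable_comp hf.2

lemma int_conj (f : ℝ → ℂ) (a x : ℝ) :
    ∫ t in a..x, conj (f t) = conj (∫ t in a..x, f t) := by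
  simp only [intervalIntegral, integral_conj, map_sub]

lemma Sol.conj (hu : Sol a b p q r s u uq g A B) :
    Sol a b p q r s (fun t => conj (u t)) (fun t => conj (uq t))
      (fun t => conj (g t)) (conj A) (conj B) := by
  have f1 : (fun t => (conj (uq t)) / (p t : ℂ) - (s t : ℂ) * conj (u t)) =
      fun t => conj (uq t / (p t : ℂ) - (s t : ℂ) * u t) := by
    funext t; simp
  have f2 : (fun t => (s t : ℂ) * (conj (uq t)) + (q t : ℂ) * (conj (u t))
        - (r t : ℂ) * (conj (g t))) =
      fun t => conj ((s t : ℂ) * uq t + (q t : ℂ) * u t - (r t : ℂ) * g t) := by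
    funext t; simp
  constructor
  · intro x hx
    rw [f1]; exact ii_conj (hu.i1 x hx)
  · intro x hx
    rw [f1, int_conj, hu.e1 x hx, map_add]
  · intro x hx
    rw [f2]; exact ii_conj (hu.i2 x hx)
  · intro x hx
    rw [f2, int_conj, hu.e2 x hx, map_add]

lemma Sol.cont (hu : Sol a b p q r s u uq g A B) {x : ℝ} (hx : x ∈ Ico a b) :
    ContinuousOn u (Icc a x) := by
  have h1 := (intervalIntegral.continuousOn_primitive_interval' (hu.i1 x hx) left_mem_uIcc)
  rw [uIcc_of_le hx.1] at h1
  refine ((continuousOn_const (c := A)).add h1).congr fun t ht => ?_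
  exact hu.e1 t ⟨ht.1, ht.2.trans_lt hx.2⟩

lemma Sol.contq (hu : Sol a b p q r s u uq g A B) {x : ℝ} (hx : x ∈ Ico a b) :
    ContinuousOn uq (Icc a x) := by
  have h1 := (intervalIntegral.continuousOn_primitive_interval' (hu.i2 x hx) left_mem_uIcc)
  rw [uIcc_of_le hx.1] at h1
  refine ((continuousOn_const (c := B)).add h1).congr fun t ht => ?_
  exact hu.e2 t ⟨ht.1, ht.2.trans_lt hx.2⟩

lemma Sol.lagrange (hu : Sol a b p q r s u uq g A B) (hv : Sol a b p q r s v vq h A' B')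
    {x : ℝ} (hx : x ∈ Ico a b) :
    u x * vq x - uq x * v x = (A * B' - B * A') +
      ∫ t in a..x, (r t : ℂ) * (g t * v t - u t * h t) := by
  have mem : ∀ t ∈ Icc a x, t ∈ Ico a b := fun t ht => ⟨ht.1, ht.2.trans_lt hx.2⟩
  obtain ⟨i1, e1⟩ := prod_rule hx.1 (hu.i1 x hx) (hv.i2 x hx) (fun t ht => hu.e1 t (mem t ht))
    (fun t ht => hv.e2 t (mem t ht))
  obtain ⟨i2, e2⟩ := prod_rule hx.1 (hu.i2 x hx) (hv.i1 x hx) (fun t ht => hu.e2 t (mem t ht))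
    (fun t ht => hv.e1 t (mem t ht))
  rw [e1, e2, add_sub_add_comm, ← intervalIntegral.integral_sub i1 i2]
  congr 1
  apply intervalIntegral.integral_congr
  intro t _
  simp only
  ring

/-- Uniqueness, through Wronskians with a fundamental system. -/
lemma Sol.unique {z : ℂ} {f fq k kq : ℝ → ℂ} {c d : ℂ} (hcd : c * c + d * d = 1)
    (hu : Sol a b p q r s u uq g 0 0) (hg : ∀ t ∈ Ico a b, g t = z * u t)
    (hf : Sol a b p q r s f fq (fun t => z * f t) c (-d))
    (hk : Sol a b p q r s k kq (fun t => z * k t) d c) {x : ℝ} (hx : x ∈ Ico a b) :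
    u x = 0 ∧ uq x = 0 := by
  have w1 := hu.lagrange hf hx
  have w2 := hu.lagrange hk hx
  have w3 := hf.lagrange hk hx
  have mem : ∀ t ∈ uIcc a x, t ∈ Ico a b := fun t ht => by
    rw [uIcc_of_le hx.1] at ht; exact ⟨ht.1, ht.2.trans_lt hx.2⟩
  have z1 : ∫ t in a..x, (r t : ℂ) * (g t * f t - u t * (z * f t)) = ∫ t in a..x, (0:ℂ) :=
    intervalIntegral.integral_congr fun t ht => by
      rw [hg t (mem t ht)]; ring
  have z2 : ∫ t in a..x, (r t : ℂ) * (g t * k t - u t * (z * k t)) = ∫ t in a..x, (0:ℂ) :=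
    intervalIntegral.integral_congr fun t ht => by
      rw [hg t (mem t ht)]; ring
  have z3 : ∫ t in a..x, (r t : ℂ) * (z * f t * k t - f t * (z * k t)) = ∫ t in a..x, (0:ℂ) :=
    intervalIntegral.integral_congr fun t ht => by
      ring
  rw [z1] at w1
  rw [z2] at w2
  rw [z3] at w3
  simp only [intervalIntegral.integral_zero] at w1 w2 w3
  constructor
  · linear_combination f x * w2 - k x * w1 - u x * w3 - u x * hcd
  · linear_combination fq x * w2 - kq x * w1 - uq x * w3 - uq x * hcd

end sol
/-! ### Estimates near the regular endpoint -/

lemma le_of_sq_le_sq_aux {x y : ℝ} (h : x ^ 2 ≤ y ^ 2) (hy : 0 ≤ y) : x ≤ y :=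
  (le_abs_self x).trans (abs_le_of_sq_le_sq h hy)

/-- The primitive of `|r|`. -/
def RR (r : ℝ → ℝ) (a t : ℝ) : ℝ := ∫ v in a..t, |r v|

/-- The weighted primitive of `|1/p|`. -/
def KK (p r : ℝ → ℝ) (a x : ℝ) : ℝ := ∫ v in a..x, |(p v)⁻¹| * √(RR r a v)

lemma ii_mono {E : Type*} [NormedAddCommGroup E] {f : ℝ → E} {a t x : ℝ} (h : IntervalIntegrable f volume a x) (ht : t ∈ Icc a x) :
    IntervalIntegrable f volume a t :=
  h.mono_set (uIcc_subset_uIcc_left (by rw [uIcc_of_le (ht.1.trans ht.2)]; exact ht))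

lemma prim_abs_mono {f : ℝ → ℝ} {a t x : ℝ} (h : IntervalIntegrable f volume a x)
    (ht : t ∈ Icc a x) : ∫ v in a..t, |f v| ≤ ∫ v in a..x, |f v| := by
  apply intervalIntegral.integral_mono_interval le_rfl ht.1 ht.2
  · exact Eventually.of_forall fun v => abs_nonneg _
  · exact h.abs

lemma RR_nonneg {r : ℝ → ℝ} {a t : ℝ} (h : a ≤ t) : 0 ≤ RR r a t :=
  intervalIntegral.integral_nonneg h fun _ _ => abs_nonneg _

lemma RR_cont {r : ℝ → ℝ} {a x : ℝ} (hax : a ≤ x) (h : IntervalIntegrable r volume a x) :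
    ContinuousOn (RR r a) (Icc a x) := by
  have := intervalIntegral.continuousOn_primitive_interval' h.abs left_mem_uIcc
  rwa [uIcc_of_le hax] at this

lemma KK_ii {p r : ℝ → ℝ} {a x : ℝ} (hax : a ≤ x) (h : IntervalIntegrable r volume a x)
    (hp : IntervalIntegrable (fun t => (p t)⁻¹) volume a x) :
    IntervalIntegrable (fun v => |(p v)⁻¹| * √(RR r a v)) volume a x := by
  apply hp.abs.mul_continuousOn
  rw [uIcc_of_le hax]
  exact (RR_cont hax h).sqrt

lemma KK_nonneg {p r : ℝ → ℝ} {a t : ℝ} (h : a ≤ t) : 0 ≤ KK p r a t :=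
  intervalIntegral.integral_nonneg h fun _ _ => by positivity

lemma KK_le {p r : ℝ → ℝ} {a x ε : ℝ} (hax : a ≤ x) (h : IntervalIntegrable r volume a x)
    (hp : IntervalIntegrable (fun t => (p t)⁻¹) volume a x)
    (hε : ∫ v in a..x, |(p v)⁻¹| ≤ ε) : KK p r a x ≤ ε * √(RR r a x) := by
  calc KK p r a x ≤ ∫ v in a..x, |(p v)⁻¹| * √(RR r a x) := by
        apply intervalIntegral.integral_mono_on hax (KK_ii hax h hp) (hp.abs.mul_const _)
        intro v hv
        gcongr
        exact prim_abs_mono h hv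
    _ = (∫ v in a..x, |(p v)⁻¹|) * √(RR r a x) := intervalIntegral.integral_mul_const _ _
    _ ≤ _ := by gcongr

lemma cs_ineq {r f : ℝ → ℝ} {a x E : ℝ} (hax : a ≤ x) (h : IntervalIntegrable r volume a x)
    (hf : ContinuousOn f (Icc a x)) (hE : ∫ v in a..x, |r v| * f v ^ 2 ≤ E ^ 2) (hE0 : 0 ≤ E) :
    ∫ v in a..x, |r v| * f v ≤ E * √(RR r a x) := by
  have hf' : ContinuousOn f (uIcc a x) := by rwa [uIcc_of_le hax]
  have i1 : IntervalIntegrable (fun v => |r v| * f v) volume a x := h.abs.mul_continuousOn hf'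
  have i2 : IntervalIntegrable (fun v => |r v| * f v ^ 2) volume a x :=
    h.abs.mul_continuousOn (hf'.pow 2)
  have key : ∀ l : ℝ, 0 ≤ RR r a x * (l * l) + (-2 * ∫ v in a..x, |r v| * f v) * l +
      ∫ v in a..x, |r v| * f v ^ 2 := by
    intro l
    have h0 : 0 ≤ ∫ v in a..x, |r v| * (f v - l) ^ 2 :=
      intervalIntegral.integral_nonneg hax fun _ _ => by positivity
    have e : (fun v => |r v| * (f v - l) ^ 2) =
        fun v => (|r v| * (l * l) + (-2 * (|r v| * f v)) * l) + |r v| * f v ^ 2 := by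
      funext v; ring
    rw [e, intervalIntegral.integral_add ((h.abs.mul_const _).add ((i1.const_mul _).mul_const _)) i2,
      intervalIntegral.integral_add (h.abs.mul_const _) ((i1.const_mul _).mul_const _),
      intervalIntegral.integral_mul_const, intervalIntegral.integral_mul_const,
      intervalIntegral.integral_const_mul] at h0
    exact h0
  have hd := discrim_le_zero key
  rw [discrim] at hd
  have hR := RR_nonneg (r := r) hax
  have : (∫ v in a..x, |r v| * f v) ^ 2 ≤ (E * √(RR r a x)) ^ 2 := by
    rw [mul_pow, Real.sq_sqrt hR]
    nlinarith
  exact le_of_sq_le_sq_aux this (by positivity)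

lemma wt_bound {s : ℝ → ℝ} {f : ℝ → ℂ} {a t x ε Q : ℝ} (hs : IntervalIntegrable s volume a x)
    (ht : t ∈ Icc a x) (hε : ∫ v in a..x, |s v| ≤ ε) (hQ0 : 0 ≤ Q)
    (hQ : ∀ v ∈ Icc a t, ‖f v‖ ≤ Q) : ‖∫ v in a..t, (s v : ℂ) * f v‖ ≤ ε * Q := by
  have hst := ii_mono hs ht
  calc ‖∫ v in a..t, (s v : ℂ) * f v‖ ≤ ∫ v in a..t, |s v| * Q := by
        apply intervalIntegral.norm_integral_le_of_norm_le ht.1 _ (hst.abs.mul_const _)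
        refine Eventually.of_forall fun v hv => ?_
        rw [norm_mul, norm_real, Real.norm_eq_abs]
        gcongr
        exact hQ v ⟨hv.1.le, hv.2⟩
    _ = (∫ v in a..t, |s v|) * Q := intervalIntegral.integral_mul_const _ _
    _ ≤ ε * Q := by
        gcongr
        exact (prim_abs_mono hs ht).trans hε

lemma ii_mul {s : ℝ → ℝ} {f : ℝ → ℂ} {a t : ℝ} (hat : a ≤ t)
    (hs : IntervalIntegrable s volume a t)
    (hf : ContinuousOn f (Icc a t)) : IntervalIntegrable (fun v => (s v : ℂ) * f v) volume a t := by
  have h1 : IntervalIntegrable (fun v => (s v : ℂ)) volume a t := ⟨hs.1.ofReal, hs.2.ofReal⟩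
  apply h1.mul_continuousOn
  rwa [uIcc_of_le hat]

lemma Sol.est {a b : ℝ} {p q r s : ℝ → ℝ} {u uq g : ℝ → ℂ} {A B : ℂ}
    (hu : Sol a b p q r s u uq g A B) {x ε c : ℝ} (hx : x ∈ Ico a b)
    (ip : IntervalIntegrable (fun t => (p t)⁻¹) volume a x)
    (iq : IntervalIntegrable q volume a x)
    (ir : IntervalIntegrable r volume a x)
    (is : IntervalIntegrable s volume a x)
    (hp : ∫ v in a..x, |(p v)⁻¹| ≤ ε) (hq : ∫ v in a..x, |q v| ≤ ε)
    (hs : ∫ v in a..x, |s v| ≤ ε) (hε : ε ≤ 1 / 8) (hc : 0 ≤ c)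
    (hg : ∀ t ∈ Icc a x, ‖∫ v in a..t, (r v : ℂ) * g v‖ ≤ c * √(RR r a t)) :
    ∀ t ∈ Icc a x, ‖u t - A‖ ≤ 4 * ε * (‖A‖ + ‖B‖) + 4 * c * KK p r a x := by
  have hε0 : 0 ≤ ε := le_trans (intervalIntegral.integral_nonneg hx.1 fun _ _ => abs_nonneg _) hp
  have mem : ∀ t ∈ Icc a x, t ∈ Ico a b := fun t ht => ⟨ht.1, ht.2.trans_lt hx.2⟩
  obtain ⟨t0, ht0, hmax⟩ := isCompact_Icc.exists_isMaxOn (nonempty_Icc.2 hx.1) (hu.cont hx).norm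
  set N := ‖u t0‖ with hN
  have hN' : ∀ t ∈ Icc a x, ‖u t‖ ≤ N := fun t ht => hmax ht
  have hN0 : 0 ≤ N := norm_nonneg _
  -- bound for the quasi-derivative
  have hQ : ∀ t ∈ Icc a x, ‖uq t‖ ≤ 2 * (‖B‖ + ε * N + c * √(RR r a t)) := by
    intro t ht
    obtain ⟨t1, ht1, hmax1⟩ := isCompact_Icc.exists_isMaxOn (nonempty_Icc.2 ht.1)
      (hu.contq (mem t ht)).norm
    have hQ' : ∀ v ∈ Icc a t, ‖uq v‖ ≤ ‖uq t1‖ := fun v hv => hmax1 hv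
    have ht1x : t1 ∈ Icc a x := ⟨ht1.1, ht1.2.trans ht.2⟩
    have j1 := ii_mul ht1.1 (ii_mono is ht1x) (hu.contq (mem t1 ht1x))
    have j2 := ii_mul ht1.1 (ii_mono iq ht1x) (hu.cont (mem t1 ht1x))
    have j3 : IntervalIntegrable (fun v => (r v : ℂ) * g v) volume a t1 := by
      have := (j1.add j2).sub (hu.i2 t1 (mem t1 ht1x))
      refine this.congr_ae (Eventually.of_forall fun v => ?_)
      simp
    have e := hu.e2 t1 (mem t1 ht1x)
    rw [intervalIntegral.integral_sub (j1.add j2) j3, intervalIntegral.integral_add j1 j2] at e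
    have b1 := wt_bound (f := uq) is ht1x hs (norm_nonneg (uq t1))
      (fun v hv => hQ' v ⟨hv.1, hv.2.trans ht1.2⟩)
    have b2 := wt_bound (f := u) iq ht1x hq hN0
      (fun v hv => hN' v ⟨hv.1, hv.2.trans ht1x.2⟩)
    have b3 := hg t1 ht1x
    have b4 : √(RR r a t1) ≤ √(RR r a t) := Real.sqrt_le_sqrt (prim_abs_mono (ii_mono ir ht) ht1)
    have b5 : ‖uq t1‖ ≤ ‖B‖ + ((ε * ‖uq t1‖ + ε * N) + c * √(RR r a t)) := by
      conv_lhs => rw [e]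
      refine (norm_add_le _ _).trans (add_le_add le_rfl ((norm_sub_le _ _).trans (add_le_add
        ((norm_add_le _ _).trans (add_le_add b1 b2)) (b3.trans ?_))))
      gcongr
    have b6 : ‖uq t‖ ≤ ‖uq t1‖ := hQ' t ⟨ht.1, le_rfl⟩
    have b7 : ε * ‖uq t1‖ ≤ 1 / 8 * ‖uq t1‖ := by gcongr
    have b8 := norm_nonneg (uq t1)
    linarith
  have hK0 : 0 ≤ KK p r a x := KK_nonneg hx.1
  have hdiff : ∀ t ∈ Icc a x, ‖u t - A‖ ≤ (2 * (‖B‖ + ε * N) * ε + 2 * c * KK p r a x) + ε * N := by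
    intro t ht
    have j1 := ii_mul ht.1 (ii_mono is ht) (hu.cont (mem t ht))
    have j2 : IntervalIntegrable (fun v => uq v / (p v : ℂ)) volume a t := by
      have := (hu.i1 t (mem t ht)).add j1
      refine this.congr_ae (Eventually.of_forall fun v => ?_)
      simp
    have e := hu.e1 t (mem t ht)
    rw [intervalIntegral.integral_sub j2 j1] at e
    have e' : u t - A = (∫ v in a..t, uq v / (p v : ℂ)) - ∫ v in a..t, (s v : ℂ) * u v := by
      rw [e]; ring
    rw [e']
    refine (norm_sub_le _ _).trans (add_le_add ?_ ?_)
    · have k1 := (ip.abs.mul_const (2 * (‖B‖ + ε * N)))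
      have k2 := ((KK_ii hx.1 ir ip).const_mul (2 * c))
      have k12 := k1.add k2
      calc ‖∫ v in a..t, uq v / (p v : ℂ)‖
          ≤ ∫ v in a..t, (|(p v)⁻¹| * (2 * (‖B‖ + ε * N)) + 2 * c * (|(p v)⁻¹| * √(RR r a v))) := by
            apply intervalIntegral.norm_integral_le_of_norm_le ht.1 _ (ii_mono k12 ht)
            refine Eventually.of_forall fun v hv => ?_
            rw [norm_div, norm_real, Real.norm_eq_abs, div_eq_mul_inv, abs_inv]
            have := hQ v ⟨hv.1.le, hv.2.trans ht.2⟩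
            have h0 : 0 ≤ |p v|⁻¹ := by positivity
            calc _ ≤ 2 * (‖B‖ + ε * N + c * √(RR r a v)) * |p v|⁻¹ := by gcongr
              _ = _ := by ring
        _ ≤ ∫ v in a..x, (|(p v)⁻¹| * (2 * (‖B‖ + ε * N)) + 2 * c * (|(p v)⁻¹| * √(RR r a v))) := by
            apply intervalIntegral.integral_mono_interval le_rfl ht.1 ht.2 _ k12
            exact Eventually.of_forall fun v => by
              simp only [Pi.zero_apply]
              positivity
        _ = (∫ v in a..x, |(p v)⁻¹|) * (2 * (‖B‖ + ε * N)) + 2 * c * KK p r a x := by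
            rw [intervalIntegral.integral_add k1 k2, intervalIntegral.integral_mul_const,
              intervalIntegral.integral_const_mul, KK]
        _ ≤ ε * (2 * (‖B‖ + ε * N)) + 2 * c * KK p r a x := by gcongr
        _ = _ := by ring
    · exact wt_bound is ht hs hN0 (fun v hv => hN' v ⟨hv.1, hv.2.trans ht.2⟩)
  have hcK : 0 ≤ c * KK p r a x := mul_nonneg hc hK0
  have hA := norm_nonneg A
  have hB := norm_nonneg B
  have hNle : N ≤ ‖A‖ + ((2 * (‖B‖ + ε * N) * ε + 2 * c * KK p r a x) + ε * N) := by
    have h1 := hdiff t0 ht0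
    have h2 : ‖u t0‖ ≤ ‖A‖ + ‖u t0 - A‖ := by
      have := norm_add_le A (u t0 - A)
      rwa [add_sub_cancel] at this
    linarith
  have t1 : ε * N ≤ 1 / 8 * N := by gcongr
  have t2 : ε * ‖B‖ ≤ 1 / 8 * ‖B‖ := by gcongr
  have t3 : ε * (ε * N) ≤ 1 / 8 * (1 / 8 * N) := by gcongr
  have t5 : ε * (ε * N) ≤ 1 / 8 * (ε * N) := by gcongr
  have hN2 : N ≤ 2 * (‖A‖ + 1 / 4 * ‖B‖ + 2 * (c * KK p r a x)) := by nlinarith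
  have t4 : ε * N ≤ ε * (2 * (‖A‖ + 1 / 4 * ‖B‖ + 2 * (c * KK p r a x))) := by gcongr
  have t6 : ε * (c * KK p r a x) ≤ 1 / 8 * (c * KK p r a x) := by gcongr
  have t7 : 0 ≤ ε * ‖A‖ := by positivity
  have t8 : 0 ≤ ε * ‖B‖ := by positivity
  intro t ht
  refine (hdiff t ht).trans ?_
  nlinarith

lemma Sol.est2 {a b : ℝ} {p q r s : ℝ → ℝ} {u uq g : ℝ → ℂ} {A B : ℂ}
    (hu : Sol a b p q r s u uq g A B) {x ε c E : ℝ} (hx : x ∈ Ico a b)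
    (ip : IntervalIntegrable (fun t => (p t)⁻¹) volume a x)
    (iq : IntervalIntegrable q volume a x)
    (ir : IntervalIntegrable r volume a x)
    (is : IntervalIntegrable s volume a x)
    (hp : ∫ v in a..x, |(p v)⁻¹| ≤ ε) (hq : ∫ v in a..x, |q v| ≤ ε)
    (hs : ∫ v in a..x, |s v| ≤ ε) (hε : ε ≤ 1 / 8) (hc : 0 ≤ c)
    (hg : ∀ t ∈ Icc a x, ‖∫ v in a..t, (r v : ℂ) * g v‖ ≤ c * √(RR r a t))
    (hE0 : 0 ≤ E) (hE : ∫ v in a..x, |r v| * ‖u v‖ ^ 2 ≤ E ^ 2) :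
    ‖A‖ * √(RR r a x) ≤ E + √(RR r a x) * (4 * ε * (‖A‖ + ‖B‖) + 4 * c * KK p r a x) := by
  have h := hu.est hx ip iq ir is hp hq hs hε hc hg
  set δ := 4 * ε * (‖A‖ + ‖B‖) + 4 * c * KK p r a x
  have hR := RR_nonneg (r := r) hx.1
  have hsR := Real.sqrt_nonneg (RR r a x)
  rcases le_total ‖A‖ δ with hA | hA
  · nlinarith
  have h1 : (‖A‖ - δ) ^ 2 * RR r a x ≤ E ^ 2 := by
    refine le_trans ?_ hE
    rw [RR, ← intervalIntegral.integral_const_mul]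
    apply intervalIntegral.integral_mono_on hx.1 (ir.abs.const_mul _)
    · apply ir.abs.mul_continuousOn
      rw [uIcc_of_le hx.1]
      exact (hu.cont hx).norm.pow 2
    · intro t ht
      rw [mul_comm]
      have h2 : ‖A‖ - δ ≤ ‖u t‖ := by
        have h3 := h t ht
        have h4 := norm_sub_norm_le A (u t)
        rw [norm_sub_rev] at h4
        linarith
      have : 0 ≤ ‖A‖ - δ := by linarith
      gcongr
  have h2 : ((‖A‖ - δ) * √(RR r a x)) ^ 2 ≤ E ^ 2 := by rwa [mul_pow, Real.sq_sqrt hR]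
  have h3 := le_of_sq_le_sq_aux h2 hE0
  linarith
/-! ### Energy identity and its consequences -/

section energy
variable {a b : ℝ} {p q r s : ℝ → ℝ} {ψ ψq : ℝ → ℂ} {A B : ℂ} {y D : ℝ}

lemma Sol.energy (hψ : Sol a b p q r s ψ ψq (fun t => ((y : ℂ) * I) * ψ t) A B) (hy : 0 < y)
    (hab : a < b)
    (ir : ∀ x ∈ Ico a b, IntervalIntegrable r volume a x)
    (hr : ∀ᵐ t ∂(volume.restrict (Ioo a b)), 0 < r t)
    (hW : Tendsto (fun x => ψ x * conj (ψq x) - ψq x * conj (ψ x)) (𝓝[<] b) (𝓝 0))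
    (hD : A * conj B - B * conj A = -(2 * I * D)) :
    ∀ x ∈ Ico a b, ∫ v in a..x, |r v| * ‖ψ v‖ ^ 2 ≤ D / y := by
  have key : ∀ x ∈ Ico a b, ψ x * conj (ψq x) - ψq x * conj (ψ x) =
      -(2 * I * D) + 2 * I * y * ((∫ v in a..x, |r v| * ‖ψ v‖ ^ 2 : ℝ) : ℂ) := by
    intro x hx
    have h1 := hψ.lagrange hψ.conj hx
    rw [h1, hD, ← intervalIntegral.integral_ofReal, ← intervalIntegral.integral_const_mul]
    congr 1
    apply intervalIntegral.integral_congr_ae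
    have hr' : ∀ᵐ t, t ∈ Ioo a b → 0 < r t := (ae_restrict_iff' measurableSet_Ioo).1 hr
    filter_upwards [hr'] with t ht htx
    rw [uIoc_of_le hx.1] at htx
    rw [abs_of_pos (ht ⟨htx.1, htx.2.trans_lt hx.2⟩)]
    have h3 : ψ t * conj (ψ t) = ((‖ψ t‖ ^ 2 : ℝ) : ℂ) := by
      rw [mul_conj, normSq_eq_norm_sq]
    simp only [map_mul, conj_ofReal, conj_I]
    push_cast at h3 ⊢
    linear_combination (2 * I * y * (r t : ℂ)) * h3
  have hmono : ∀ x ∈ Ico a b, ∀ x' ∈ Ico a b, x ≤ x' →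
      ∫ v in a..x, |r v| * ‖ψ v‖ ^ 2 ≤ ∫ v in a..x', |r v| * ‖ψ v‖ ^ 2 := by
    intro x hx x' hx' hxx
    apply intervalIntegral.integral_mono_interval le_rfl hx.1 hxx
    · exact Eventually.of_forall fun v => by simp only [Pi.zero_apply]; positivity
    · apply (ir x' hx').abs.mul_continuousOn
      rw [uIcc_of_le hx'.1]
      exact (hψ.cont hx').norm.pow 2
  have hval : ∀ x ∈ Ico a b, ∫ v in a..x, |r v| * ‖ψ v‖ ^ 2 =
      D / y + (ψ x * conj (ψq x) - ψq x * conj (ψ x)).im / (2 * y) := by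
    intro x hx
    rw [key x hx]
    have : (-(2 * I * (D:ℂ)) + 2 * I * y * ((∫ v in a..x, |r v| * ‖ψ v‖ ^ 2 : ℝ) : ℂ)).im =
        -(2 * D) + 2 * y * (∫ v in a..x, |r v| * ‖ψ v‖ ^ 2) := by
      generalize (∫ v in a..x, |r v| * ‖ψ v‖ ^ 2) = J
      simp
    rw [this]
    field_simp
    ring
  intro x hx
  have hlim : Tendsto (fun x => D / y + (ψ x * conj (ψq x) - ψq x * conj (ψ x)).im / (2 * y))
      (𝓝[<] b) (𝓝 (D / y + (0:ℂ).im / (2 * y))) :=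
    (((continuous_im.tendsto _).comp hW).div_const _).const_add _
  rw [zero_im, zero_div, add_zero] at hlim
  refine ge_of_tendsto hlim ?_
  filter_upwards [Ioo_mem_nhdsLT hx.2] with x' hx'
  have hx'' : x' ∈ Ico a b := ⟨hx.1.trans hx'.1.le, hx'.2⟩
  rw [← hval x' hx'']
  exact hmono x hx x' hx'' hx'.1.le

lemma Sol.forcing (hψ : Sol a b p q r s ψ ψq (fun t => ((y : ℂ) * I) * ψ t) A B) (hy : 0 < y)
    (hD0 : 0 ≤ D)
    (ir : ∀ x ∈ Ico a b, IntervalIntegrable r volume a x)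
    (hen : ∀ x ∈ Ico a b, ∫ v in a..x, |r v| * ‖ψ v‖ ^ 2 ≤ D / y) {g : ℝ → ℂ} {C : ℝ} (hC : 0 ≤ C)
    (hg : ∀ v, ‖g v‖ ≤ C * ‖ψ v‖) :
    ∀ x ∈ Ico a b, ‖∫ v in a..x, (r v : ℂ) * g v‖ ≤ C * √(D / y) * √(RR r a x) := by
  intro x hx
  have h1 := cs_ineq (f := fun v => ‖ψ v‖) (E := √(D / y)) hx.1 (ir x hx) (hψ.cont hx).norm
    (by rw [Real.sq_sqrt (by positivity)]; exact hen x hx) (by positivity)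
  have i1 : IntervalIntegrable (fun v => |r v| * ‖ψ v‖) volume a x := by
    apply (ir x hx).abs.mul_continuousOn
    rw [uIcc_of_le hx.1]
    exact (hψ.cont hx).norm
  calc ‖∫ v in a..x, (r v : ℂ) * g v‖ ≤ ∫ v in a..x, C * (|r v| * ‖ψ v‖) := by
        apply intervalIntegral.norm_integral_le_of_norm_le hx.1 _ (i1.const_mul C)
        refine Eventually.of_forall fun v _ => ?_
        rw [norm_mul, norm_real, Real.norm_eq_abs]
        calc |r v| * ‖g v‖ ≤ |r v| * (C * ‖ψ v‖) := by gcongr; exact hg v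
          _ = _ := by ring
    _ = C * ∫ v in a..x, |r v| * ‖ψ v‖ := intervalIntegral.integral_const_mul _ _
    _ ≤ C * (√(D / y) * √(RR r a x)) := by gcongr
    _ = _ := by ring

/-- Algebraic core of the bound for the imaginary part. -/
lemma alg_bound {σ w y R K : ℝ} (hσ : 0 < σ) (hw : 0 ≤ w) (hy : 0 < y) (hR : 0 < R) (hK : 0 ≤ K)
    (h : σ * (y * w ^ 2) * √R ≤ 2 * w + 8 * y * w * K * √R) :
    y * w ^ 2 ≤ 128 / σ ^ 2 * (1 / (y * R) + y * K ^ 2) := by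
  rcases hw.eq_or_lt with hw0 | hw0
  · rw [← hw0]; simp; positivity
  have hsR : 0 < √R := Real.sqrt_pos.2 hR
  have h1 : σ * y * w * √R ≤ 2 + 8 * y * K * √R := by
    have : w * (σ * y * w * √R) ≤ w * (2 + 8 * y * K * √R) := by nlinarith
    exact le_of_mul_le_mul_left this hw0
  have h2 : (σ * y * w * √R) ^ 2 ≤ (2 + 8 * y * K * √R) ^ 2 := by gcongr
  have h3 : (2 + 8 * y * K * √R) ^ 2 ≤ 128 * (1 + (y * K * √R) ^ 2) := by
    nlinarith [sq_nonneg (2 - 8 * y * K * √R), sq_nonneg (y * K * √R)]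
  have h4 := h2.trans h3
  have e1 : (σ * y * w * √R) ^ 2 = σ ^ 2 * y * R * (y * w ^ 2) := by
    rw [mul_pow, Real.sq_sqrt hR.le]; ring
  have e2 : (y * K * √R) ^ 2 = y ^ 2 * K ^ 2 * R := by
    rw [mul_pow, Real.sq_sqrt hR.le]; ring
  rw [e1, e2] at h4
  have e3 : 128 / σ ^ 2 * (1 / (y * R) + y * K ^ 2) =
      128 * (1 + y ^ 2 * K ^ 2 * R) / (σ ^ 2 * y * R) := by field_simp
  rw [e3, le_div_iff₀ (by positivity)]
  linarith

lemma Sol.im_bound {φa : ℝ} {M : ℂ} (hσ : 0 < Real.sin φa)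
    (hψ : Sol a b p q r s ψ ψq (fun t => ((y : ℂ) * I) * ψ t)
      (Real.cos φa + M * Real.sin φa) (-(Real.sin φa) + M * Real.cos φa)) (hy : 0 < y)
    (hM : 0 ≤ M.im)
    (ir : ∀ x ∈ Ico a b, IntervalIntegrable r volume a x)
    (hen : ∀ x ∈ Ico a b, ∫ v in a..x, |r v| * ‖ψ v‖ ^ 2 ≤ M.im / y)
    {x ε : ℝ} (hx : x ∈ Ico a b)
    (ip : IntervalIntegrable (fun t => (p t)⁻¹) volume a x)
    (iq : IntervalIntegrable q volume a x)
    (is : IntervalIntegrable s volume a x)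
    (hp : ∫ v in a..x, |(p v)⁻¹| ≤ ε) (hq : ∫ v in a..x, |q v| ≤ ε)
    (hs : ∫ v in a..x, |s v| ≤ ε) (hε : ε ≤ 1 / 8) (hε2 : ε ≤ Real.sin φa / 16)
    (hR : 0 < RR r a x) :
    M.im ≤ 128 / Real.sin φa ^ 2 * (1 / (y * RR r a x) + y * KK p r a x ^ 2) := by
  have hF := hψ.lin hψ.conj (-1)
  have hsub : ∀ w : ℂ, ‖w + -1 * conj w‖ ≤ 2 * ‖w‖ := by
    intro w
    refine (norm_add_le _ _).trans ?_
    rw [norm_mul, norm_neg, norm_one, one_mul, RCLike.norm_conj]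
    linarith
  have hε0 : 0 ≤ ε := le_trans (intervalIntegral.integral_nonneg hx.1 fun _ _ => abs_nonneg _) hp
  have hforce := hψ.forcing (g := fun t => ((y : ℂ) * I) * ψ t + -1 * conj (((y : ℂ) * I) * ψ t))
    (C := 2 * y) hy hM ir hen (by positivity) (fun v => by
      refine (hsub _).trans (le_of_eq ?_)
      rw [norm_mul, norm_mul, norm_I, norm_real, Real.norm_of_nonneg hy.le]; ring)
  have hEn : ∫ v in a..x, |r v| * ‖ψ v + -1 * conj (ψ v)‖ ^ 2 ≤ (2 * √(M.im / y)) ^ 2 := by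
    rw [mul_pow, Real.sq_sqrt (by positivity)]
    calc _ ≤ ∫ v in a..x, 2 ^ 2 * (|r v| * ‖ψ v‖ ^ 2) := by
          apply intervalIntegral.integral_mono_on hx.1
          · apply (ir x hx).abs.mul_continuousOn
            rw [uIcc_of_le hx.1]
            exact (hF.cont hx).norm.pow 2
          · apply IntervalIntegrable.const_mul
            apply (ir x hx).abs.mul_continuousOn
            rw [uIcc_of_le hx.1]
            exact (hψ.cont hx).norm.pow 2
          · intro v _
            have := hsub (ψ v)
            calc _ ≤ |r v| * (2 * ‖ψ v‖) ^ 2 := by gcongr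
              _ = _ := by ring
      _ = 2 ^ 2 * ∫ v in a..x, |r v| * ‖ψ v‖ ^ 2 := intervalIntegral.integral_const_mul _ _
      _ ≤ _ := by gcongr; exact hen x hx
  have h := hF.est2 (c := 2 * y * √(M.im / y)) (E := 2 * √(M.im / y)) hx ip iq (ir x hx) is hp hq hs
    hε (by positivity) (fun t ht => hforce t ⟨ht.1, ht.2.trans_lt hx.2⟩) (by positivity) hEn
  have nA : ‖((Real.cos φa : ℂ) + M * Real.sin φa) + -1 * conj ((Real.cos φa : ℂ) + M * Real.sin φa)‖
      = 2 * M.im * Real.sin φa := by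
    have : ((Real.cos φa : ℂ) + M * Real.sin φa) + -1 * conj ((Real.cos φa : ℂ) + M * Real.sin φa)
        = ((2 * M.im * Real.sin φa : ℝ) : ℂ) * I := by
      rw [map_add, map_mul, conj_ofReal, conj_ofReal]
      have := sub_conj M
      push_cast at this ⊢
      linear_combination (Complex.sin φa) * this
    rw [this, norm_mul, norm_I, mul_one, norm_real, Real.norm_of_nonneg (by positivity)]
  have nB : ‖(-(Real.sin φa : ℂ) + M * Real.cos φa) + -1 * conj (-(Real.sin φa : ℂ) + M * Real.cos φa)‖
      ≤ 2 * M.im := by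
    have : (-(Real.sin φa : ℂ) + M * Real.cos φa) + -1 * conj (-(Real.sin φa : ℂ) + M * Real.cos φa)
        = ((2 * M.im * Real.cos φa : ℝ) : ℂ) * I := by
      rw [map_add, map_mul, map_neg, conj_ofReal, conj_ofReal]
      have := sub_conj M
      push_cast at this ⊢
      linear_combination (Complex.cos φa) * this
    rw [this, norm_mul, norm_I, mul_one, norm_real, norm_mul, Real.norm_of_nonneg (by positivity)]
    have := Real.abs_cos_le_one φa
    rw [Real.norm_eq_abs]
    nlinarith
  rw [nA] at h
  have hw : M.im = y * √(M.im / y) ^ 2 := by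
    rw [Real.sq_sqrt (by positivity)]; field_simp
  set w := √(M.im / y)
  have hw0 : 0 ≤ w := Real.sqrt_nonneg _
  have hK := KK_nonneg (p := p) (r := r) hx.1
  have hsR := Real.sqrt_nonneg (RR r a x)
  have hσ1 := Real.sin_le_one φa
  conv_lhs => rw [hw]
  apply alg_bound hσ hw0 hy hR hK
  rw [← hw]
  set nb := ‖(-(Real.sin φa : ℂ) + M * Real.cos φa) + -1 * conj (-(Real.sin φa : ℂ) + M * Real.cos φa)‖
  have h5 : 4 * ε * (2 * M.im * Real.sin φa + nb) ≤ Real.sin φa * M.im := by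
    have : 2 * M.im * Real.sin φa + nb ≤ 4 * M.im := by nlinarith
    calc _ ≤ 4 * (Real.sin φa / 16) * (4 * M.im) := by gcongr
      _ = _ := by ring
  have h6 : √(RR r a x) * (4 * ε * (2 * M.im * Real.sin φa + nb)) ≤
      √(RR r a x) * (Real.sin φa * M.im) := by gcongr
  nlinarith

lemma Sol.lim_bound
    (hψ : Sol a b p q r s ψ ψq (fun t => ((y : ℂ) * I) * ψ t) A B) (hy : 0 < y)
    (hD : 0 ≤ D)
    (ir : ∀ x ∈ Ico a b, IntervalIntegrable r volume a x)
    (hen : ∀ x ∈ Ico a b, ∫ v in a..x, |r v| * ‖ψ v‖ ^ 2 ≤ D / y)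
    {x ε : ℝ} (hx : x ∈ Ico a b)
    (ip : IntervalIntegrable (fun t => (p t)⁻¹) volume a x)
    (iq : IntervalIntegrable q volume a x)
    (is : IntervalIntegrable s volume a x)
    (hp : ∫ v in a..x, |(p v)⁻¹| ≤ ε) (hq : ∫ v in a..x, |q v| ≤ ε)
    (hs : ∫ v in a..x, |s v| ≤ ε) (hε : ε ≤ 1 / 8)
    (hR : RR r a x = 1 / y) :
    ‖A‖ ≤ 2 * √D + 4 * ε * (‖A‖ + ‖B‖) := by
  have hforce := hψ.forcing (g := fun t => ((y : ℂ) * I) * ψ t)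
    (C := y) hy hD ir hen (by positivity) (fun v => by
      refine (le_of_eq ?_)
      rw [norm_mul, norm_mul, norm_I, norm_real, Real.norm_of_nonneg hy.le]; ring)
  have h := hψ.est2 (c := y * √(D / y)) (E := √(D / y)) hx ip iq (ir x hx) is hp hq hs
    hε (by positivity) (fun t ht => hforce t ⟨ht.1, ht.2.trans_lt hx.2⟩) (by positivity)
    (by rw [Real.sq_sqrt (by positivity)]; exact hen x hx)
  have hK := KK_le hx.1 (ir x hx) ip hp
  rw [hR] at h hK
  have hsy : 0 < √y := Real.sqrt_pos.2 hy
  have e1 : √(1 / y) = 1 / √y := by rw [Real.sqrt_div zero_le_one, Real.sqrt_one]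
  have e2 : √(D / y) = √D / √y := Real.sqrt_div hD y
  have e3 : y = √y * √y := (Real.mul_self_sqrt hy.le).symm
  rw [e1, e2] at h
  rw [e1] at hK
  set S := √y
  have hd := Real.sqrt_nonneg D
  set d := √D
  have e4 : 4 * (y * (d / S)) * KK p r a x ≤ d := by
    have : 4 * (y * (d / S)) * KK p r a x ≤ 4 * (y * (d / S)) * (ε * (1 / S)) := by gcongr
    refine this.trans ?_
    have : 4 * (y * (d / S)) * (ε * (1 / S)) = 4 * ε * d := by
      rw [e3]; field_simp
    rw [this]; nlinarith
  have h2 : ‖A‖ * (1 / S) * S ≤ (d / S + 1 / S * (4 * ε * (‖A‖ + ‖B‖) +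
      4 * (y * (d / S)) * KK p r a x)) * S := by gcongr
  have e5 : ‖A‖ * (1 / S) * S = ‖A‖ := by field_simp
  have e6 : (d / S + 1 / S * (4 * ε * (‖A‖ + ‖B‖) +
      4 * (y * (d / S)) * KK p r a x)) * S = d + (4 * ε * (‖A‖ + ‖B‖) +
      4 * (y * (d / S)) * KK p r a x) := by
    generalize 4 * ε * (‖A‖ + ‖B‖) + 4 * (y * (d / S)) * KK p r a x = q
    field_simp
  rw [e5, e6] at h2
  linarith

end energy

/-! ### Choice of small intervals -/

lemma exists_small_s18 {f : ℝ → ℝ} {a b : ℝ} (hab : a < b)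
    (hf : ∀ x ∈ Ioo a b, IntervalIntegrable f volume a x) {ε : ℝ} (hε : 0 < ε) :
    ∃ x ∈ Ioo a b, ∫ v in a..x, |f v| ≤ ε := by
  set c := (a + b) / 2 with hc
  have hcm : c ∈ Ioo a b := ⟨by linarith, by linarith⟩
  have h1 := intervalIntegral.continuousOn_primitive_interval' (hf c hcm).abs left_mem_uIcc
  rw [uIcc_of_le hcm.1.le] at h1
  have h2 := (h1 a ⟨le_rfl, hcm.1.le⟩).mono Ioc_subset_Icc_self
  have h3 : ∀ᶠ x in 𝓝[Ioc a c] a, ∫ v in a..x, |f v| < ε := by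
    apply h2.eventually_lt continuousWithinAt_const
    simpa using hε
  rw [nhdsWithin_Ioc_eq_nhdsGT hcm.1] at h3
  obtain ⟨x, hx1, hx2⟩ := (h3.and (Ioo_mem_nhdsGT hcm.1)).exists
  exact ⟨x, ⟨hx2.1, hx2.2.trans hcm.2⟩, hx1.le⟩

lemma exists_level {r : ℝ → ℝ} {a x v : ℝ} (hax : a < x) (ir : IntervalIntegrable r volume a x)
    (hv : 0 < v) (hvx : v ≤ RR r a x) : ∃ t ∈ Ioc a x, RR r a t = v := by
  have h0 : RR r a a = 0 := by simp [RR]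
  obtain ⟨t, ht, hte⟩ := intermediate_value_Icc hax.le (RR_cont hax.le ir)
    (show v ∈ Icc (RR r a a) (RR r a x) from ⟨by rw [h0]; exact hv.le, hvx⟩)
  refine ⟨t, ⟨lt_of_le_of_ne ht.1 ?_, ht.2⟩, hte⟩
  rintro rfl
  linarith

lemma RR_pos {r : ℝ → ℝ} {a b x : ℝ} (hx : x ∈ Ioo a b) (ir : IntervalIntegrable r volume a x)
    (hr : ∀ᵐ t ∂(volume.restrict (Ioo a b)), 0 < r t) : 0 < RR r a x := by
  rw [RR, intervalIntegral.integral_of_le hx.1.le]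
  rw [setIntegral_pos_iff_support_of_nonneg_ae (Eventually.of_forall fun _ => abs_nonneg _)
    ir.abs.1]
  have hr' : ∀ᵐ t, t ∈ Ioo a b → 0 < r t := (ae_restrict_iff' measurableSet_Ioo).1 hr
  have hsub : (Ioc a x : Set ℝ) ≤ᵐ[volume] (Function.support (fun v => |r v|) ∩ Ioc a x : Set ℝ) := by
    filter_upwards [hr'] with t ht htx
    refine ⟨?_, htx⟩
    have := ht ⟨htx.1, lt_of_le_of_lt htx.2 hx.2⟩
    simp [this.ne']
  refine lt_of_lt_of_le ?_ (measure_mono_ae hsub)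
  rw [Real.volume_Ioc]
  simpa using hx.1

lemma KK_summable {p r : ℝ → ℝ} {a x : ℝ} (hax : a < x)
    (ip : IntervalIntegrable (fun t => (p t)⁻¹) volume a x)
    (ir : IntervalIntegrable r volume a x) {X : ℕ → ℝ} (hX : ∀ n, X n ∈ Ioc a x)
    {ρ : ℝ} (hρ : 0 ≤ ρ)
    (hRX : ∀ n, RR r a (X n) = ρ / 4 ^ n) : Summable (fun n => 2 ^ n * KK p r a (X n)) := by
  apply summable_of_sum_range_le (c := ∫ v in Ioc a x, |(p v)⁻¹| * (2 * √ρ))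
  · intro n; have := KK_nonneg (p := p) (r := r) (hX n).1.le; positivity
  intro N
  have hk := (KK_ii hax.le ir ip).1
  set k := fun v => |(p v)⁻¹| * √(RR r a v) with hkdef
  have e : ∀ n, KK p r a (X n) = ∫ v in Ioc a x, (Ioc a (X n)).indicator k v := by
    intro n
    rw [KK, intervalIntegral.integral_of_le (hX n).1.le, setIntegral_indicator measurableSet_Ioc,
      inter_eq_right.2 (Ioc_subset_Ioc_right (hX n).2)]
  have hi : ∀ n, IntegrableOn ((Ioc a (X n)).indicator k) (Ioc a x) := fun n =>
    hk.indicator measurableSet_Ioc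
  simp_rw [e]
  calc _ = ∫ v in Ioc a x, ∑ n ∈ Finset.range N, 2 ^ n * (Ioc a (X n)).indicator k v := by
        rw [integral_finsetSum _ (fun n _ => (hi n).const_mul _)]
        simp_rw [integral_const_mul]
    _ ≤ _ := by
        apply setIntegral_mono_on (integrable_finsetSum _ fun n _ => (hi n).const_mul _)
          (ip.abs.1.mul_const _) measurableSet_Ioc
        intro v hv
        have h1 := (aux_sum_low (√(RR r a v)) (√ρ) (Real.sqrt_nonneg _) (Real.sqrt_nonneg _) N).2
        refine le_trans ?_ (mul_le_mul_of_nonneg_left h1 (abs_nonneg _))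
        rw [Finset.mul_sum]
        apply Finset.sum_le_sum
        intro n _
        by_cases hvn : v ∈ Ioc a (X n)
        · rw [indicator_of_mem hvn]
          have hc : 2 ^ n * √(RR r a v) ≤ √ρ := by
            have h2 : RR r a v ≤ ρ / 4 ^ n := by
              rw [← hRX n]
              exact prim_abs_mono (ii_mono ir ⟨(hX n).1.le, (hX n).2⟩) ⟨hvn.1.le, hvn.2⟩
            apply Real.le_sqrt_of_sq_le
            rw [mul_pow, Real.sq_sqrt (RR_nonneg hvn.1.le)]
            have : ((2:ℝ) ^ n) ^ 2 = 4 ^ n := by rw [← pow_mul, mul_comm, pow_mul]; norm_num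
            rw [this]
            rw [le_div_iff₀ (by positivity)] at h2
            linarith
          rw [if_pos hc, hkdef]
          apply le_of_eq; ring
        · rw [indicator_of_notMem hvn, mul_zero]
          split_ifs <;> positivity
/-- For a Sturm--Liouville operator regular at `a` with boundary condition parameter
`φ_a`: if `φ_a ≠ 0` then `∫ (1+|λ|)⁻¹ dμ(λ) < ∞`, the Weyl--Titchmarsh function has the
representation `m(z) = -cot φ_a + ∫ (λ-z)⁻¹ dμ(λ)` and `m(z) → -cot φ_a` along nonreal
rays; if `φ_a = 0` (Friedrichs case) then `∫ (1+|λ|)⁻¹ dμ(λ) = ∞`. -/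
theorem weyl_m_representation_regular {a b : ℝ} {p q r s : ℝ → ℝ}
    (hyp : SLHyp a b p q r s)
    (hreg : ∀ x ∈ Set.Ioo a b,
      IntervalIntegrable (fun t => (p t)⁻¹) volume a x ∧ IntervalIntegrable q volume a x ∧
      IntervalIntegrable r volume a x ∧ IntervalIntegrable s volume a x)
    {φa : ℝ} (hφa : φa ∈ Set.Ico 0 Real.pi)
    {θ θq φ φq : ℂ → ℝ → ℂ}
    (hθ : ∀ z : ℂ, RegSolG a b p q r s z (θ z) (θq z) (Real.cos φa) (-(Real.sin φa)))
    (hφ : ∀ z : ℂ, RegSolG a b p q r s z (φ z) (φq z) (Real.sin φa) (Real.cos φa))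
    {m : ℂ → ℂ}
    (hL2 : ∀ z : ℂ, z.im ≠ 0 → ∀ c ∈ Set.Ioo a b,
      IntegrableOn (fun x => ‖θ z x + m z * φ z x‖ ^ 2 * r x) (Set.Ioo c b))
    (hbcb : ∀ z ζ : ℂ, z.im ≠ 0 → ζ.im ≠ 0 →
      Tendsto (Wr (fun x => θ z x + m z * φ z x) (fun x => θq z x + m z * φq z x)
          (fun x => θ ζ x + m ζ * φ ζ x) (fun x => θq ζ x + m ζ * φq ζ x))
        (𝓝[<] b) (𝓝 0))
    {μ : Measure ℝ}
    (hfin : (∫⁻ t : ℝ, ENNReal.ofReal ((1 + t ^ 2)⁻¹) ∂μ) < ⊤)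
    (hrep : ∀ z : ℂ, z.im ≠ 0 → m z = (((m Complex.I).re : ℝ) : ℂ) +
      ∫ t : ℝ, (1 / ((t : ℂ) - z) - (t : ℂ) / (1 + (t : ℂ) ^ 2)) ∂μ) :
    (φa ≠ 0 →
      (∫⁻ t : ℝ, ENNReal.ofReal ((1 + |t|)⁻¹) ∂μ) < ⊤ ∧
      (∀ z : ℂ, z.im ≠ 0 →
        m z = -((Real.cos φa / Real.sin φa : ℝ) : ℂ) + ∫ t : ℝ, (1 / ((t : ℂ) - z)) ∂μ) ∧
      (∀ w : ℂ, w.im ≠ 0 →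
        Tendsto (fun t : ℝ => m ((t : ℂ) * w)) atTop
          (𝓝 (-((Real.cos φa / Real.sin φa : ℝ) : ℂ))))) ∧
    (φa = 0 → (∫⁻ t : ℝ, ENNReal.ofReal ((1 + |t|)⁻¹) ∂μ) = ⊤) := by
  have hab : a < b := hyp.lt
  have ir : ∀ x ∈ Ico a b, IntervalIntegrable r volume a x := fun x hx => by
    rcases eq_or_lt_of_le hx.1 with h | h
    · rw [← h]
    · exact (hreg x ⟨h, hx.2⟩).2.2.1
  -- the Weyl solutions
  have hS : ∀ z : ℂ, Sol a b p q r s (fun t => θ z t + m z * φ z t)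
      (fun t => θq z t + m z * φq z t) (fun t => z * (θ z t + m z * φ z t))
      (Real.cos φa + m z * Real.sin φa) (-(Real.sin φa) + m z * Real.cos φa) := by
    intro z
    have h := ((hθ z).toSol).lin ((hφ z).toSol) (m z)
    have e : (fun t => z * θ z t + m z * (z * φ z t)) =
        fun t => z * (θ z t + m z * φ z t) := by
      funext t; ring
    rw [e] at h
    exact h
  have hcs : (Real.cos φa : ℂ) * Real.cos φa + (Real.sin φa : ℂ) * Real.sin φa = 1 := by
    have := Real.cos_sq_add_sin_sq φa
    rw [sq, sq] at this
    exact_mod_cast this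
  -- conjugation symmetry of the Weyl solutions
  have hconj : ∀ z : ℂ, z.im ≠ 0 → ∀ x ∈ Ico a b,
      θ (conj z) x + m (conj z) * φ (conj z) x = conj (θ z x + m z * φ z x) ∧
      θq (conj z) x + m (conj z) * φq (conj z) x = conj (θq z x + m z * φq z x) := by
    intro z hz x hx
    have h := (hS (conj z)).lin (hS z).conj (-1)
    have e1 : (Real.cos φa + m (conj z) * Real.sin φa : ℂ) +
        -1 * conj (Real.cos φa + m z * Real.sin φa : ℂ) = 0 := by
      rw [aux_conj hrep hz]; simp only [map_add, map_mul, conj_ofReal]; ring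
    have e2 : (-(Real.sin φa) + m (conj z) * Real.cos φa : ℂ) +
        -1 * conj (-(Real.sin φa) + m z * Real.cos φa : ℂ) = 0 := by
      rw [aux_conj hrep hz]; simp only [map_add, map_neg, map_mul, conj_ofReal]; ring
    rw [e1, e2] at h
    have h2 := Sol.unique (z := conj z) hcs h (fun t _ => by
      simp only [map_mul]; ring) (hθ (conj z)).toSol (hφ (conj z)).toSol hx
    exact ⟨by linear_combination h2.1, by linear_combination h2.2⟩
  have him : ∀ y : ℝ, 0 < y → ((y : ℂ) * I).im ≠ 0 := fun y hy => by
    simpa using hy.ne'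
  have hD0 : ∀ y : ℝ, 0 < y → 0 ≤ (m ((y : ℂ) * I)).im := fun y hy =>
    (aux_im hfin hrep hy).1
  -- energy bound
  have hen : ∀ y : ℝ, 0 < y → ∀ x ∈ Ico a b,
      ∫ v in a..x, |r v| * ‖θ ((y : ℂ) * I) v + m ((y : ℂ) * I) * φ ((y : ℂ) * I) v‖ ^ 2
        ≤ (m ((y : ℂ) * I)).im / y := by
    intro y hy
    have hz := him y hy
    refine (hS ((y : ℂ) * I)).energy hy hab ir hyp.rpos ?_ ?_
    · have h := hbcb ((y : ℂ) * I) (conj ((y : ℂ) * I)) hz (by simpa using hy.ne')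
      refine h.congr' ?_
      filter_upwards [Ioo_mem_nhdsLT hab] with x hx
      have h1 := hconj ((y : ℂ) * I) hz x ⟨hx.1.le, hx.2⟩
      simp only [Wr]
      rw [h1.1, h1.2]
    · generalize m ((y : ℂ) * I) = M
      have hM : M - conj M = 2 * M.im * I := by
        have := Complex.sub_conj M
        push_cast at this
        exact this
      simp only [map_add, map_neg, map_mul, conj_ofReal]
      linear_combination (conj M - M) * hcs - hM
  -- small intervals
  have hsmall : ∀ ε : ℝ, 0 < ε → ∃ x ∈ Ioo a b, ∀ t ∈ Ioc a x,
      (∫ v in a..t, |(p v)⁻¹| ≤ ε) ∧ (∫ v in a..t, |q v| ≤ ε) ∧ (∫ v in a..t, |s v| ≤ ε) := by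
    intro ε hε
    obtain ⟨x1, h1, k1⟩ := exists_small_s18 hab (fun x hx => (hreg x hx).1) hε
    obtain ⟨x2, h2, k2⟩ := exists_small_s18 hab (fun x hx => (hreg x hx).2.1) hε
    obtain ⟨x3, h3, k3⟩ := exists_small_s18 hab (fun x hx => (hreg x hx).2.2.2) hε
    refine ⟨min x1 (min x2 x3), ⟨lt_min h1.1 (lt_min h2.1 h3.1), (min_le_left _ _).trans_lt h1.2⟩,
      fun t ht => ⟨?_, ?_, ?_⟩⟩
    · exact (prim_abs_mono (hreg x1 h1).1 ⟨ht.1.le, ht.2.trans (min_le_left _ _)⟩).trans k1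
    · exact (prim_abs_mono (hreg x2 h2).2.1 ⟨ht.1.le, ht.2.trans
        ((min_le_right _ _).trans (min_le_left _ _))⟩).trans k2
    · exact (prim_abs_mono (hreg x3 h3).2.2.2 ⟨ht.1.le, ht.2.trans
        ((min_le_right _ _).trans (min_le_right _ _))⟩).trans k3
  -- the limit constant
  have hlim : ∀ c : ℝ, Tendsto (fun t : ℝ => m ((t : ℂ) * I)) atTop (𝓝 (c : ℂ)) →
      (Real.cos φa : ℝ) + c * Real.sin φa = 0 := by
    intro c hc
    have hA : Tendsto (fun t : ℝ => ‖(Real.cos φa + m ((t : ℂ) * I) * Real.sin φa : ℂ)‖) atTop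
        (𝓝 ‖(Real.cos φa + c * Real.sin φa : ℂ)‖) :=
      ((hc.mul_const _).const_add _).norm
    have hB : Tendsto (fun t : ℝ => ‖(-(Real.sin φa) + m ((t : ℂ) * I) * Real.cos φa : ℂ)‖) atTop
        (𝓝 ‖(-(Real.sin φa) + c * Real.cos φa : ℂ)‖) :=
      ((hc.mul_const _).const_add _).norm
    have hDl : Tendsto (fun t : ℝ => √(m ((t : ℂ) * I)).im) atTop (𝓝 0) := by
      have := ((Complex.continuous_im.tendsto _).comp hc).sqrt
      simpa using this
    set LA := ‖(Real.cos φa + c * Real.sin φa : ℂ)‖ with hLA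
    set LB := ‖(-(Real.sin φa) + c * Real.cos φa : ℂ)‖ with hLB
    have hbd : ∀ ε : ℝ, 0 < ε → ε ≤ 1 / 8 → LA ≤ 4 * ε * (LA + LB) := by
      intro ε hε hε8
      obtain ⟨x, hx, hxs⟩ := hsmall ε hε
      have hRx : 0 < RR r a x := RR_pos hx (hreg x hx).2.2.1 hyp.rpos
      have hr1 : Tendsto (fun t : ℝ => 2 * √(m ((t : ℂ) * I)).im + 4 * ε *
          (‖(Real.cos φa + m ((t : ℂ) * I) * Real.sin φa : ℂ)‖ +
            ‖(-(Real.sin φa) + m ((t : ℂ) * I) * Real.cos φa : ℂ)‖)) atTop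
          (𝓝 (2 * 0 + 4 * ε * (LA + LB))) :=
        (hDl.const_mul 2).add ((hA.add hB).const_mul _)
      have := le_of_tendsto_of_tendsto hA hr1 (by
        filter_upwards [eventually_ge_atTop (1 / RR r a x), eventually_gt_atTop 0] with y hy hy0
        have hv : 1 / y ≤ RR r a x := by
          rw [div_le_iff₀ hRx] at hy
          rw [div_le_iff₀ hy0]; linarith
        obtain ⟨t, ht, htR⟩ := exists_level hx.1 (hreg x hx).2.2.1 (by positivity : 0 < 1 / y) hv
        have htb : t ∈ Ioo a b := ⟨ht.1, ht.2.trans_lt hx.2⟩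
        have hh := hxs t ht
        exact (hS ((y : ℂ) * I)).lim_bound hy0 (hD0 y hy0) ir (hen y hy0) ⟨htb.1.le, htb.2⟩
          (hreg t htb).1 (hreg t htb).2.1 (hreg t htb).2.2.2 hh.1 hh.2.1 hh.2.2 hε8 htR)
      linarith
    have hLA0 : 0 ≤ LA := norm_nonneg _
    have hLB0 : 0 ≤ LB := norm_nonneg _
    have hz : LA = 0 := by
      by_contra hne
      have hpos : 0 < LA := lt_of_le_of_ne hLA0 (Ne.symm hne)
      have h8 : LA / (8 * (LA + LB)) ≤ 1 / 8 := by
        rw [div_le_iff₀ (by positivity)]; linarith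
      have := hbd (LA / (8 * (LA + LB))) (by positivity) h8
      have e : 4 * (LA / (8 * (LA + LB))) * (LA + LB) = LA / 2 := by
        have : LA + LB ≠ 0 := by positivity
        field_simp
        norm_num
      linarith
    have := norm_eq_zero.1 hz
    exact_mod_cast this
  constructor
  · intro hne
    have hσ : 0 < Real.sin φa :=
      Real.sin_pos_of_pos_of_lt_pi (lt_of_le_of_ne hφa.1 (Ne.symm hne)) hφa.2
    have hfin1 : (∫⁻ t : ℝ, ENNReal.ofReal ((1 + |t|)⁻¹) ∂μ) < ⊤ := by
      obtain ⟨x, hx, hxs⟩ := hsmall (min (1 / 8) (Real.sin φa / 16)) (by positivity)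
      have hρ : 0 < RR r a x := RR_pos hx (hreg x hx).2.2.1 hyp.rpos
      set ρ := RR r a x with hρdef
      have hlev : ∀ n : ℕ, ∃ t ∈ Ioc a x, RR r a t = ρ / 4 ^ n := fun n =>
        exists_level hx.1 (hreg x hx).2.2.1 (by positivity)
          (div_le_self hρ.le (one_le_pow₀ (by norm_num)))
      choose X hX hRX using hlev
      have hsum := KK_summable hx.1 (hreg x hx).1 (hreg x hx).2.2.1 hX hρ.le hRX
      have hKK : ∀ n, 0 ≤ KK p r a (X n) := fun n => KK_nonneg (hX n).1.le
      obtain ⟨η, hη, hs⟩ := aux_summable (fun y => (m ((y : ℂ) * I)).im)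
        (128 / Real.sin φa ^ 2 * (1 / ρ + 1)) (by positivity) hD0
        (fun n => 2 ^ n * KK p r a (X n) + (1 / 2) ^ n)
        (fun n => by have := hKK n; positivity)
        (hsum.add (summable_geometric_of_lt_one (by norm_num) (by norm_num))) (by
          intro n y hy
          have htb : X n ∈ Ioo a b := ⟨(hX n).1, (hX n).2.trans_lt hx.2⟩
          have hh := hxs (X n) (hX n)
          have h1 := (hS ((y : ℂ) * I)).im_bound hσ hy (hD0 y hy) ir (hen y hy)
            ⟨htb.1.le, htb.2⟩ (hreg _ htb).1 (hreg _ htb).2.1 (hreg _ htb).2.2.2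
            hh.1 hh.2.1 hh.2.2 (min_le_left _ _) (min_le_right _ _)
            (by rw [hRX n]; positivity)
          refine h1.trans ?_
          rw [mul_assoc]
          apply mul_le_mul_of_nonneg_left _ (by positivity)
          rw [hRX n]
          have e4 : ((4 : ℝ) ^ n) = 2 ^ n * 2 ^ n := by rw [← mul_pow]; norm_num
          have t1 : 1 / (y * (ρ / 4 ^ n)) = 1 / ρ * (4 ^ n / y) := by field_simp
          have t2 : KK p r a (X n) ^ 2 ≤ (2 ^ n * KK p r a (X n) + (1 / 2) ^ n) ^ 2 / 4 ^ n := by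
            rw [le_div_iff₀ (by positivity), e4]
            have : (0 : ℝ) ≤ (1 / 2) ^ n := by positivity
            have h3 : 0 ≤ 2 ^ n * KK p r a (X n) := mul_nonneg (by positivity) (hKK n)
            nlinarith
          set w := (2 ^ n * KK p r a (X n) + (1 / 2) ^ n) ^ 2 / 4 ^ n with hw
          have hw0 : 0 ≤ w := by positivity
          have t3 : y * (2 ^ n * KK p r a (X n) + (1 / 2) ^ n) ^ 2 / 4 ^ n = y * w := by
            rw [hw]; ring
          rw [t1, t3]
          have t4 : y * KK p r a (X n) ^ 2 ≤ y * w := by gcongr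
          have t5 : 0 ≤ 1 / ρ * (y * w) := by positivity
          have t6 : 0 ≤ 4 ^ n / y := by positivity
          nlinarith)
      exact aux_finite hfin hrep hη hs
    obtain ⟨c, hc1, hc2⟩ := aux_limit hfin hrep hfin1
    have h0 := hlim c (hc2 I (by simp))
    have hcv : (c : ℂ) = -((Real.cos φa / Real.sin φa : ℝ) : ℂ) := by
      have : c = -(Real.cos φa / Real.sin φa) := by
        field_simp
        linarith
      rw [this]; push_cast; ring
    rw [hcv] at hc1 hc2
    exact ⟨hfin1, hc1, hc2⟩
  · intro h0
    by_contra hne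
    obtain ⟨c, hc1, hc2⟩ := aux_limit hfin hrep (lt_top_iff_ne_top.2 hne)
    have h := hlim c (hc2 I (by simp))
    rw [h0] at h
    simp at h
end
end
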